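/- Local factorization through an injective curve: Let J be an almost complex structure on ℂⁿ and u : B → ℂⁿ a nonconstant smooth J-holomorphic curve with u(0) = 0. Then there exist an injective smooth J-holomorphic curve v : B → ℂⁿ, an ε > 0, and a holomorphic map φ : B_ε → B with φ(0) = 0, such that u = v ∘ φ on B_ε. -/

import Mathlib

open Metric Complex

namespace JCurve

open Filter Topology Asymptotics ComplexConjugate
open scoped ContDiff

variable {F : Type*} [NormedAddCommGroup F] [NormedSpace ℂ F]

/-- Averages of dilates of a smooth map are smooth. -/
theorem contDiff_integral_dilate {G : Type*} [NormedAddCommGroup G] [NormedSpace ℝ G]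
    [CompleteSpace G] (n : ℕ) : ∀ (p : ℝ → ℝ) (_ : Continuous p) (f : ℂ → G) (_ : ContDiff ℝ ∞ f),
      ContDiff ℝ n (fun z => ∫ t in (0:ℝ)..1, p t • f ((t:ℂ) * z)) := by
  induction n generalizing G with
  | zero =>
    intro p hp f hf
    have : Continuous (fun z : ℂ => ∫ t in (0:ℝ)..1, p t • f ((t:ℂ) * z)) := by
      apply intervalIntegral.continuous_parametric_intervalIntegral_of_continuous'
      have := hf.continuous
      fun_prop
    simpa using (contDiff_zero (𝕜 := ℝ)).2 this
  | succ n ih =>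
    intro p hp f hf
    have hfd : ContDiff ℝ ∞ (fderiv ℝ f) := hf.fderiv_right (by simp)
    have hc := hf.continuous
    have hcd := hfd.continuous
    have key : ∀ z : ℂ, HasFDerivAt (fun z : ℂ => ∫ t in (0:ℝ)..1, p t • f ((t:ℂ) * z))
        (∫ t in (0:ℝ)..1, (p t * t) • fderiv ℝ f ((t:ℂ) * z)) z := by
      intro z
      have hK : IsCompact (Set.Icc (0:ℝ) 1 ×ˢ closedBall z 1) :=
        isCompact_Icc.prod (isCompact_closedBall _ _)
      have hcont : Continuous (fun q : ℝ × ℂ => (p q.1 * q.1) • fderiv ℝ f ((q.1:ℂ) * q.2)) := by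
        fun_prop
      obtain ⟨C, hC⟩ := hK.exists_bound_of_continuousOn hcont.continuousOn
      apply intervalIntegral.hasFDerivAt_integral_of_dominated_of_fderiv_le
        (F' := fun z t => (p t * t) • fderiv ℝ f ((t:ℂ) * z)) (s := ball z 1)
        (bound := fun _ => C) (ball_mem_nhds z one_pos)
      · refine Eventually.of_forall fun x => ?_
        exact (by fun_prop : Continuous fun t : ℝ => p t • f ((t:ℂ) * x)).aestronglyMeasurable
      · exact (by fun_prop : Continuous fun t : ℝ => p t • f ((t:ℂ) * z)).intervalIntegrable _ _
      · exact (by fun_prop : Continuous fun t : ℝ =>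
          (p t * t) • fderiv ℝ f ((t:ℂ) * z)).aestronglyMeasurable
      · refine Eventually.of_forall fun t ht x hx => ?_
        rw [Set.uIoc_of_le zero_le_one] at ht
        exact hC (t, x) ⟨⟨ht.1.le, ht.2⟩, ball_subset_closedBall hx⟩
      · exact intervalIntegrable_const
      · refine Eventually.of_forall fun t ht x hx => ?_
        have h1 : HasFDerivAt (fun x : ℂ => (t:ℂ) * x) (t • ContinuousLinearMap.id ℝ ℂ) x := by
          have := (hasFDerivAt_id (𝕜 := ℝ) x).const_smul t
          refine this.congr_of_eventuallyEq (Eventually.of_forall fun y => ?_)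
          simp
        have h2 := ((hf.differentiable (by simp) ((t:ℂ) * x)).hasFDerivAt.comp x h1).const_smul
          (p t)
        convert! h2 using 1
        ext v
        simp [mul_smul]
    rw [show ((n + 1 : ℕ) : WithTop ℕ∞) = (n : WithTop ℕ∞) + 1 by simp, contDiff_succ_iff_fderiv]
    refine ⟨fun z => (key z).differentiableAt, by simp, ?_⟩
    have := ih (fun t => p t * t) (by fun_prop) (fderiv ℝ f) hfd
    convert! this using 1
    ext1 z
    exact (key z).fderiv

/-- Hadamard's lemma in the variables `z` and `conj z`. -/
theorem exists_hadamard [CompleteSpace F] {f : ℂ → F} (hf : ContDiff ℝ ∞ f) (h0 : f 0 = 0) :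
    ∃ A B : ℂ → F, ContDiff ℝ ∞ A ∧ ContDiff ℝ ∞ B ∧ ∀ z, f z = z • A z + conj z • B z := by
  have hfd : ContDiff ℝ ∞ (fderiv ℝ f) := hf.fderiv_right (by simp)
  set D1 : ℂ → F := fun z => ∫ t in (0:ℝ)..1, (1:ℝ) • fderiv ℝ f ((t:ℂ) * z) 1 with hD1
  set D2 : ℂ → F := fun z => ∫ t in (0:ℝ)..1, (1:ℝ) • fderiv ℝ f ((t:ℂ) * z) I with hD2
  have s1 : ContDiff ℝ ∞ D1 := contDiff_infty.2 fun n =>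
    contDiff_integral_dilate n (fun _ => 1) continuous_const (fun z => fderiv ℝ f z 1)
      (hfd.clm_apply contDiff_const)
  have s2 : ContDiff ℝ ∞ D2 := contDiff_infty.2 fun n =>
    contDiff_integral_dilate n (fun _ => 1) continuous_const (fun z => fderiv ℝ f z I)
      (hfd.clm_apply contDiff_const)
  have hcd := hfd.continuous
  have key : ∀ z, f z = z.re • D1 z + z.im • D2 z := by
    intro z
    have h : ∫ t in (0:ℝ)..1, fderiv ℝ f ((t:ℂ) * z) z = f ((1:ℝ) * z) - f ((0:ℝ) * z) := by
      apply intervalIntegral.integral_eq_sub_of_hasDerivAt (f := fun t : ℝ => f ((t:ℂ) * z))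
      · intro t _
        have h1 : HasDerivAt (fun t : ℝ => (t:ℂ) * z) z t := by
          simpa using (Complex.ofRealCLM.hasDerivAt (x := t)).mul_const z
        exact (hf.differentiable (by simp) ((t:ℂ) * z)).hasFDerivAt.comp_hasDerivAt t h1
      · exact (by fun_prop : Continuous fun t : ℝ => fderiv ℝ f ((t:ℂ) * z) z).intervalIntegrable
          _ _
    have hz : ∀ L : ℂ →L[ℝ] F, L z = z.re • L 1 + z.im • L I := by
      intro L
      conv_lhs => rw [show z = z.re • (1:ℂ) + z.im • I by simp [Complex.re_add_im]]
      rw [map_add, map_smul, map_smul]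
    simp only [ofReal_one, one_mul, ofReal_zero, zero_mul, h0, sub_zero] at h
    rw [← h, hD1, hD2]
    simp only [one_smul]
    rw [← intervalIntegral.integral_smul, ← intervalIntegral.integral_smul,
      ← intervalIntegral.integral_add]
    · exact intervalIntegral.integral_congr fun t _ => hz _
    · exact (by fun_prop : Continuous fun t : ℝ =>
        z.re • fderiv ℝ f ((t:ℂ) * z) 1).intervalIntegrable _ _
    · exact (by fun_prop : Continuous fun t : ℝ =>
        z.im • fderiv ℝ f ((t:ℂ) * z) I).intervalIntegrable _ _
  refine ⟨fun z => (2:ℂ)⁻¹ • (D1 z - I • D2 z), fun z => (2:ℂ)⁻¹ • (D1 z + I • D2 z), ?_, ?_, ?_⟩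
  · exact ((s1.sub (s2.const_smul I)).const_smul _)
  · exact ((s1.add (s2.const_smul I)).const_smul _)
  · intro z
    have e1 : (z.re : ℂ) = (z + conj z) / 2 := by rw [Complex.re_eq_add_conj]
    have e2 : (z.im : ℂ) = (z - conj z) / (2 * I) := by rw [Complex.im_eq_sub_conj]
    rw [key z, ← Complex.coe_smul z.re, ← Complex.coe_smul z.im, e1, e2]
    have hI : (2 * I)⁻¹ = -I / 2 := by
      rw [mul_inv, Complex.inv_I]; ring
    rw [div_eq_mul_inv (z - conj z), hI]
    module

end JCurve

namespace JCurve

open Filter Topology Asymptotics ComplexConjugate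
open scoped ContDiff

variable {F : Type*} [NormedAddCommGroup F] [NormedSpace ℂ F]

/-- The homogeneous polynomial `∑ zᵃ z̄ᵇ c a` over `a + b = N`. -/
noncomputable def homSum (N : ℕ) (c : ℕ → F) (z : ℂ) : F :=
  ∑ a ∈ Finset.range (N + 1), (z ^ a * conj z ^ (N - a)) • c a

/-- Twice the Cauchy-Riemann operator. -/
noncomputable def dbar (f : ℂ → F) (z : ℂ) : F := fderiv ℝ f z 1 + I • fderiv ℝ f z I

/-- Smoothness in a neighbourhood of the origin. -/
def SmoothGerm {G : Type*} [NormedAddCommGroup G] [NormedSpace ℝ G] (f : ℂ → G) : Prop :=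
  ∀ᶠ z in 𝓝 (0 : ℂ), ContDiffAt ℝ ∞ f z

theorem homSum_smul (N : ℕ) (c : ℕ → F) (t : ℝ) (z : ℂ) :
    homSum N c (t * z) = t ^ N • homSum N c z := by
  unfold homSum
  rw [Finset.smul_sum]
  refine Finset.sum_congr rfl fun a ha => ?_
  have ha' : a ≤ N := by simpa [Nat.lt_succ_iff] using ha
  rw [← Complex.coe_smul, smul_smul]
  congr 1
  simp only [map_mul, conj_ofReal, mul_pow, ofReal_pow]
  rw [show (t:ℂ) ^ N = t ^ a * t ^ (N - a) by rw [← pow_add, Nat.add_sub_cancel' ha']]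
  ring

theorem homSum_isBigO (N : ℕ) (c : ℕ → F) : homSum N c =O[𝓝 0] fun z : ℂ => ‖z‖ ^ N := by
  unfold homSum
  refine IsBigO.of_bound (∑ a ∈ Finset.range (N + 1), ‖c a‖) (Eventually.of_forall fun z => ?_)
  rw [Finset.sum_mul]
  refine norm_sum_le_of_le _ fun a ha => ?_
  have ha' : a ≤ N := by simpa [Nat.lt_succ_iff] using ha
  simp only [norm_smul, norm_mul, norm_pow, RCLike.norm_conj, norm_norm, ← pow_add,
    Nat.add_sub_cancel' ha', mul_comm]
  rfl

theorem eq_zero_of_homSum_isLittleO {N : ℕ} {c : ℕ → F}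
    (h : homSum N c =o[𝓝 0] fun z : ℂ => ‖z‖ ^ N) {a : ℕ} (ha : a ≤ N) : c a = 0 := by
  have h1 : ∀ z : ℂ, ‖z‖ = 1 → homSum N c z = 0 := by
    intro z hz
    have ht : Tendsto (fun t : ℝ => (t : ℂ) * z) (𝓝[>] 0) (𝓝 0) := by
      have : Continuous (fun t : ℝ => (t : ℂ) * z) := by fun_prop
      have := this.tendsto 0
      simp only [ofReal_zero, zero_mul] at this
      exact this.mono_left nhdsWithin_le_nhds
    have h2 := (h.comp_tendsto ht)
    have h3 : (fun t : ℝ => homSum N c z) =o[𝓝[>] 0] fun t : ℝ => (1:ℝ) := by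
      refine (IsBigO.of_bound 1 ?_).trans_isLittleO
        ((isBigO_refl (fun t : ℝ => (t ^ N)⁻¹) (𝓝[>] 0)).smul_isLittleO h2) |>.trans_isBigO
          (IsBigO.of_bound 1 ?_)
      · filter_upwards [self_mem_nhdsWithin] with t ht
        have ht' : (0:ℝ) < t := ht
        simp only [Function.comp, homSum_smul, smul_smul, one_mul]
        rw [inv_mul_cancel₀ (by positivity), one_smul]
      · filter_upwards [self_mem_nhdsWithin] with t ht
        have ht' : (0:ℝ) < t := ht
        simp only [Function.comp, norm_mul, hz, mul_one, Complex.norm_real, smul_eq_mul]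
        simp [abs_of_pos ht', ht'.ne']
    rw [isLittleO_one_iff] at h3
    exact tendsto_nhds_unique tendsto_const_nhds h3
  rw [SeparatingDual.eq_zero_iff_forall_dual_eq_zero (R := ℂ)]
  intro l
  let p : Polynomial ℂ := ∑ b ∈ Finset.range (N + 1), Polynomial.monomial b (l (c b))
  have hp : p = 0 := by
    apply Polynomial.eq_zero_of_infinite_isRoot
    have : Infinite (Set.Ioc (-Real.pi) Real.pi) :=
      (Set.Ioc_infinite (by linarith [Real.pi_pos])).to_subtype
    have : Infinite Circle := Infinite.of_injective _ Circle.argEquiv.symm.injective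
    have hinf : (Set.range fun t : Circle => (t : ℂ)).Infinite :=
      Set.infinite_range_of_injective Subtype.val_injective
    refine hinf.mono ?_
    rintro _ ⟨w, rfl⟩
    obtain ⟨z, hz⟩ : ∃ z : ℂ, z ^ 2 = w := IsAlgClosed.exists_pow_nat_eq _ two_pos
    have hz1 : ‖z‖ = 1 := by
      have : ‖z‖ ^ 2 = 1 := by rw [← norm_pow, hz, Circle.norm_coe]
      nlinarith [norm_nonneg z]
    have hzz : z * conj z = 1 := by rw [Complex.mul_conj, Complex.normSq_eq_norm_sq, hz1]; simp
    have h4 : l (z ^ N • homSum N c z) = 0 := by rw [h1 z hz1]; simp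
    simp only [Set.mem_ofPred_eq, Polynomial.IsRoot, p, Polynomial.eval_finsetSum,
      Polynomial.eval_monomial]
    rw [← h4, homSum, Finset.smul_sum, map_sum]
    refine Finset.sum_congr rfl fun b hb => ?_
    have hb' : b ≤ N := by simpa [Nat.lt_succ_iff] using hb
    rw [map_smul, map_smul, smul_smul, smul_eq_mul, mul_comm]
    congr 1
    rw [← hz]
    have h5 : z ^ N = z ^ b * z ^ (N - b) := by rw [← pow_add, Nat.add_sub_cancel' hb']
    calc (z ^ 2) ^ b = z ^ b * z ^ b * (z * conj z) ^ (N - b) := by rw [hzz]; ring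
      _ = _ := by rw [h5]; ring
  have := congrArg (fun q => Polynomial.coeff q a) hp
  simpa [p, Polynomial.finsetSum_coeff, Polynomial.coeff_monomial, Nat.lt_succ_iff, ha] using this

theorem isBigO_norm_pow_of_le {G : Type*} [NormedAddCommGroup G] {f : ℂ → G} {M N : ℕ}
    (h : f =O[𝓝 0] fun z : ℂ => ‖z‖ ^ M) (hN : N ≤ M) : f =O[𝓝 0] fun z : ℂ => ‖z‖ ^ N := by
  refine h.trans (IsBigO.of_bound 1 ?_)
  filter_upwards [ball_mem_nhds (0:ℂ) one_pos] with z hz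
  have : ‖z‖ ≤ 1 := by simpa using (mem_ball_zero_iff.1 hz).le
  simpa using pow_le_pow_of_le_one (norm_nonneg z) this hN

theorem isLittleO_norm_pow_of_lt {G : Type*} [NormedAddCommGroup G] {f : ℂ → G} {M N : ℕ}
    (h : f =O[𝓝 0] fun z : ℂ => ‖z‖ ^ M) (hN : N < M) : f =o[𝓝 0] fun z : ℂ => ‖z‖ ^ N := by
  refine h.trans_isLittleO ?_
  have := isLittleO_pow_pow (𝕜 := ℝ) hN
  exact this.comp_tendsto tendsto_norm_zero

theorem isBigO_norm_of_differentiableAt {G : Type*} [NormedAddCommGroup G] [NormedSpace ℝ G]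
    {f : ℂ → G} (h : DifferentiableAt ℝ f 0) :
    (fun z => f z - f 0) =O[𝓝 0] fun z : ℂ => ‖z‖ ^ 1 := by
  simpa using h.isBigO_sub.norm_right

/-- A smooth function vanishing to order `N` is a combination of the monomials of degree `N`
with smooth coefficients. -/
theorem exists_homSum_of_isBigO [CompleteSpace F] (N : ℕ) : ∀ {f : ℂ → F}, ContDiff ℝ ∞ f →
    f =O[𝓝 0] (fun z : ℂ => ‖z‖ ^ N) →
    ∃ W : ℕ → ℂ → F, (∀ a, ContDiff ℝ ∞ (W a)) ∧ ∀ z, f z = homSum N (fun a => W a z) z := by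
  induction N with
  | zero =>
    intro f hf _
    exact ⟨fun _ => f, fun _ => hf, fun z => by simp [homSum]⟩
  | succ N ih =>
    intro f hf hO
    obtain ⟨W, hW, hfW⟩ := ih hf (isBigO_norm_pow_of_le hO N.le_succ)
    have hW0 : ∀ a ≤ N, W a 0 = 0 := by
      intro a ha
      refine eq_zero_of_homSum_isLittleO (c := fun a => W a 0) ?_ ha
      refine isLittleO_norm_pow_of_lt (M := N + 1) ?_ N.lt_succ_self
      have : homSum N (fun a => W a 0) = fun z => f z -
          ∑ a ∈ Finset.range (N + 1), (z ^ a * conj z ^ (N - a)) • (W a z - W a 0) := by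
        funext z
        rw [hfW z]
        simp [homSum, smul_sub]
      rw [this]
      refine hO.sub (IsBigO.fun_sum fun a ha => ?_)
      have ha' : a ≤ N := by simpa [Nat.lt_succ_iff] using ha
      have h1 : (fun z : ℂ => z ^ a * conj z ^ (N - a)) =O[𝓝 0] fun z : ℂ => ‖z‖ ^ N := by
        refine IsBigO.of_bound 1 (Eventually.of_forall fun z => ?_)
        simp [← pow_add, Nat.add_sub_cancel' ha']
      have h2 := h1.smul (isBigO_norm_of_differentiableAt ((hW a).differentiable (by simp) 0))
      simpa [pow_succ] using h2
    have : ∀ a, ∃ A B : ℂ → F, ContDiff ℝ ∞ A ∧ ContDiff ℝ ∞ B ∧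
        (a ≤ N → ∀ z, W a z = z • A z + conj z • B z) := by
      intro a
      by_cases ha : a ≤ N
      · obtain ⟨A, B, hA, hB, h⟩ := exists_hadamard (hW a) (hW0 a ha)
        exact ⟨A, B, hA, hB, fun _ => h⟩
      · exact ⟨0, 0, contDiff_const, contDiff_const, fun h => absurd h ha⟩
    choose A B hA hB hAB using this
    refine ⟨fun a z => (if a = 0 then 0 else A (a - 1) z) + (if a ≤ N then B a z else 0), ?_, ?_⟩
    · intro a
      refine ContDiff.add ?_ ?_
      · split_ifs
        · exact contDiff_const
        · exact hA _
      · split_ifs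
        · exact hB _
        · exact contDiff_const
    · intro z
      rw [hfW z]
      simp only [homSum, smul_add, Finset.sum_add_distrib]
      rw [Finset.sum_range_succ' _ (N + 1), Finset.sum_range_succ (fun a => (z ^ a *
        conj z ^ (N + 1 - a)) • if a ≤ N then B a z else 0) (N + 1)]
      simp only [Nat.add_eq_zero_iff, one_ne_zero, and_false, if_false, if_true, smul_zero,
        add_zero, Nat.add_sub_cancel, Nat.not_succ_le_self]
      rw [← Finset.sum_add_distrib]
      refine Finset.sum_congr rfl fun a ha => ?_
      have ha' : a ≤ N := by simpa [Nat.lt_succ_iff] using ha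
      rw [if_pos ha', hAB a ha' z, smul_add, smul_smul, smul_smul,
        show N + 1 - (a + 1) = N - a by omega, show N + 1 - a = (N - a) + 1 by omega]
      congr 2 <;> ring

theorem SmoothGerm.exists_contDiff {G : Type*} [NormedAddCommGroup G] [NormedSpace ℝ G]
    {f : ℂ → G} (hf : SmoothGerm f) :
    ∃ g : ℂ → G, ContDiff ℝ ∞ g ∧ f =ᶠ[𝓝 0] g := by
  obtain ⟨r, hr, h⟩ := Metric.eventually_nhds_iff_ball.1 hf
  let χ : ContDiffBump (0:ℂ) := ⟨r / 4, r / 2, by linarith, by linarith⟩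
  refine ⟨fun z => χ z • f z, ?_, ?_⟩
  · rw [contDiff_iff_contDiffAt]
    intro z
    by_cases hz : z ∈ ball (0:ℂ) r
    · exact χ.contDiff.contDiffAt.smul (h z hz)
    · have hz' : z ∈ (closedBall (0:ℂ) (r / 2))ᶜ := by
        simp only [mem_ball, Set.mem_compl_iff, mem_closedBall] at hz ⊢
        linarith
      have : (fun z => χ z • f z) =ᶠ[𝓝 z] fun _ => 0 := by
        filter_upwards [isClosed_closedBall.isOpen_compl.mem_nhds hz'] with w hw
        have : χ w = 0 := χ.zero_of_le_dist (by
          simp only [Set.mem_compl_iff, mem_closedBall, not_le] at hw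
          exact hw.le)
        simp [this]
      exact contDiffAt_const.congr_of_eventuallyEq this
  · filter_upwards [χ.eventuallyEq_one] with z hz
    have : χ z = 1 := hz
    simp [this]

theorem SmoothGerm.fderiv {G : Type*} [NormedAddCommGroup G] [NormedSpace ℝ G]
    {f : ℂ → G} (hf : SmoothGerm f) : SmoothGerm (fderiv ℝ f) :=
  hf.mono fun _ h => h.fderiv_right (by simp)

theorem _root_.ContDiff.smoothGerm {G : Type*} [NormedAddCommGroup G] [NormedSpace ℝ G]
    {f : ℂ → G} (hf : ContDiff ℝ ∞ f) : SmoothGerm f :=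
  Eventually.of_forall fun _ => hf.contDiffAt

theorem contDiff_homSum (N : ℕ) (c : ℕ → F) : ContDiff ℝ ∞ (homSum N c) := by
  unfold homSum
  have : ContDiff ℝ ∞ (fun z : ℂ => conj z) := conjCLE.contDiff
  fun_prop

/-- Leading term of a smooth function vanishing to order `N`. -/
theorem SmoothGerm.exists_leading [CompleteSpace F] {f : ℂ → F} (hf : SmoothGerm f) {N : ℕ}
    (hO : f =O[𝓝 0] fun z : ℂ => ‖z‖ ^ N) :
    ∃ c : ℕ → F, (fun z => f z - homSum N c z) =O[𝓝 0] fun z : ℂ => ‖z‖ ^ (N + 1) := by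
  obtain ⟨g, hg, hfg⟩ := hf.exists_contDiff
  obtain ⟨W, hW, hgW⟩ := exists_homSum_of_isBigO N hg (hO.congr' hfg EventuallyEq.rfl)
  refine ⟨fun a => W a 0, ?_⟩
  have : (fun z => ∑ a ∈ Finset.range (N + 1), (z ^ a * conj z ^ (N - a)) • (W a z - W a 0))
      =ᶠ[𝓝 0] fun z => f z - homSum N (fun a => W a 0) z := by
    filter_upwards [hfg] with z hz
    rw [hz, hgW z]
    simp [homSum, smul_sub]
  refine IsBigO.congr' (IsBigO.fun_sum fun a ha => ?_) this EventuallyEq.rfl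
  have ha' : a ≤ N := by simpa [Nat.lt_succ_iff] using ha
  have h1 : (fun z : ℂ => z ^ a * conj z ^ (N - a)) =O[𝓝 0] fun z : ℂ => ‖z‖ ^ N := by
    refine IsBigO.of_bound 1 (Eventually.of_forall fun z => ?_)
    simp [← pow_add, Nat.add_sub_cancel' ha']
  have h2 := h1.smul (isBigO_norm_of_differentiableAt ((hW a).differentiable (by simp) 0))
  simpa [pow_succ] using h2

theorem hasFDerivAt_monomial (a b : ℕ) (z : ℂ) :
    HasFDerivAt (fun z : ℂ => z ^ a * conj z ^ b)
      ((z ^ a * (b * conj z ^ (b - 1))) • (conjCLE : ℂ →L[ℝ] ℂ) +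
        (conj z ^ b * (a * z ^ (a - 1))) • ContinuousLinearMap.id ℝ ℂ) z := by
  have h1 := ((hasFDerivAt_id (𝕜 := ℝ) z).pow a)
  have h2 := ((conjCLE : ℂ →L[ℝ] ℂ).hasFDerivAt (x := z)).pow b
  refine (h1.mul h2).congr_fderiv ?_
  ext v
  simp
  ring

theorem fderiv_monomial_isBigO {a b N : ℕ} (h : a + b = N + 1) :
    (fderiv ℝ fun z : ℂ => z ^ a * conj z ^ b) =O[𝓝 0] fun z : ℂ => ‖z‖ ^ N := by
  refine IsBigO.of_bound (b + a) (Eventually.of_forall fun z => ?_)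
  rw [(hasFDerivAt_monomial a b z).fderiv, add_mul]
  have e1 : ‖(conjCLE : ℂ →L[ℝ] ℂ)‖ ≤ 1 := by
    refine ContinuousLinearMap.opNorm_le_bound _ zero_le_one fun v => by simp
  have e2 : ‖ContinuousLinearMap.id ℝ ℂ‖ ≤ 1 := ContinuousLinearMap.norm_id_le
  refine (norm_add_le _ _).trans (add_le_add ?_ ?_)
  · refine (norm_smul_le _ _).trans ?_
    refine (mul_le_of_le_one_right (norm_nonneg _) e1).trans ?_
    rcases b with _ | b
    · simp
    · obtain rfl : N = a + b := by omega
      simp [pow_add]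
      exact le_of_eq (by norm_cast; simp; ring)
  · refine (norm_smul_le _ _).trans ?_
    refine (mul_le_of_le_one_right (norm_nonneg _) e2).trans ?_
    rcases a with _ | a
    · simp
    · obtain rfl : N = a + b := by omega
      simp [pow_add]
      exact le_of_eq (by norm_cast; simp; ring)

/-- The derivative of a smooth function vanishing to order `N + 1` vanishes to order `N`. -/
theorem SmoothGerm.fderiv_isBigO [CompleteSpace F] {f : ℂ → F} (hf : SmoothGerm f) {N : ℕ}
    (hO : f =O[𝓝 0] fun z : ℂ => ‖z‖ ^ (N + 1)) :
    _root_.fderiv ℝ f =O[𝓝 0] fun z : ℂ => ‖z‖ ^ N := by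
  obtain ⟨g, hg, hfg⟩ := hf.exists_contDiff
  obtain ⟨W, hW, hgW⟩ := exists_homSum_of_isBigO (N + 1) hg (hO.congr' hfg EventuallyEq.rfl)
  refine IsBigO.congr' ?_ hfg.fderiv.symm EventuallyEq.rfl
  have hgd : ∀ z, HasFDerivAt g (∑ a ∈ Finset.range (N + 1 + 1),
      ((z ^ a * conj z ^ (N + 1 - a)) • _root_.fderiv ℝ (W a) z +
      (_root_.fderiv ℝ (fun z : ℂ => z ^ a * conj z ^ (N + 1 - a)) z).smulRight (W a z))) z := by
    intro z
    have : g = fun z => homSum (N + 1) (fun a => W a z) z := funext hgW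
    rw [this]
    unfold homSum
    refine HasFDerivAt.fun_sum fun a _ => ?_
    exact (hasFDerivAt_monomial a _ z).differentiableAt.hasFDerivAt.smul
      ((hW a).differentiable (by simp) z).hasFDerivAt
  have : _root_.fderiv ℝ g = fun z => ∑ a ∈ Finset.range (N + 1 + 1),
      ((z ^ a * conj z ^ (N + 1 - a)) • _root_.fderiv ℝ (W a) z +
      (_root_.fderiv ℝ (fun z : ℂ => z ^ a * conj z ^ (N + 1 - a)) z).smulRight (W a z)) :=
    funext fun z => (hgd z).fderiv
  rw [this]
  refine IsBigO.fun_sum fun a ha => ?_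
  have ha' : a ≤ N + 1 := by simpa [Nat.lt_succ_iff] using ha
  refine IsBigO.add ?_ ?_
  · have h1 : (fun z : ℂ => z ^ a * conj z ^ (N + 1 - a)) =O[𝓝 0] fun z : ℂ => ‖z‖ ^ N := by
      refine isBigO_norm_pow_of_le (M := N + 1) ?_ N.le_succ
      refine IsBigO.of_bound 1 (Eventually.of_forall fun z => ?_)
      simp [← pow_add, Nat.add_sub_cancel' ha']
    have h2 : (_root_.fderiv ℝ (W a)) =O[𝓝 0] fun _ : ℂ => (1:ℝ) :=
      (((hW a).continuous_fderiv (by simp)).tendsto 0).isBigO_one ℝ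
    simpa using h1.smul h2
  · have h1 := fderiv_monomial_isBigO (a := a) (b := N + 1 - a) (N := N) (by omega)
    have h2 : (W a) =O[𝓝 0] fun _ : ℂ => (1:ℝ) :=
      (((hW a).continuous).tendsto 0).isBigO_one ℝ
    have h3 := h1.norm_left.mul h2.norm_left
    refine IsBigO.trans (IsBigO.of_bound 1 (Eventually.of_forall fun z => ?_)) (by simpa using h3)
    refine ContinuousLinearMap.opNorm_le_bound _ (by positivity) fun v => ?_
    rw [ContinuousLinearMap.smulRight_apply, norm_smul, one_mul, norm_mul, norm_norm, norm_norm,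
      mul_right_comm]
    exact mul_le_mul_of_nonneg_right (ContinuousLinearMap.le_opNorm _ _) (norm_nonneg _)

theorem dbar_homSum (N : ℕ) (c : ℕ → F) (z : ℂ) :
    dbar (homSum (N + 1) c) z = homSum N (fun a => (2 * (N + 1 - a : ℕ) : ℂ) • c a) z := by
  have h : HasFDerivAt (homSum (N + 1) c) (∑ a ∈ Finset.range (N + 1 + 1),
      (_root_.fderiv ℝ (fun z : ℂ => z ^ a * conj z ^ (N + 1 - a)) z).smulRight (c a)) z := by
    unfold homSum
    refine HasFDerivAt.fun_sum fun a _ => ?_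
    exact (hasFDerivAt_monomial a _ z).differentiableAt.hasFDerivAt.smul_const (c a)
  rw [dbar, h.fderiv, sum_apply, sum_apply,
    Finset.smul_sum, ← Finset.sum_add_distrib, homSum, Finset.sum_range_succ]
  have : ∀ a, (_root_.fderiv ℝ (fun z : ℂ => z ^ a * conj z ^ (N + 1 - a)) z).smulRight (c a) 1 +
      I • (_root_.fderiv ℝ (fun z : ℂ => z ^ a * conj z ^ (N + 1 - a)) z).smulRight (c a) I =
      (2 * (z ^ a * (((N + 1 - a : ℕ) : ℂ) * conj z ^ (N + 1 - a - 1)))) • c a := by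
    intro a
    rw [(hasFDerivAt_monomial a _ z).fderiv]
    simp only [ContinuousLinearMap.smulRight_apply, smul_smul, ← add_smul]
    congr 1
    simp
    ring_nf
    simp
    ring
  simp only [this]
  rw [show N + 1 - (N + 1) = 0 by omega]
  simp only [Nat.cast_zero, zero_mul, mul_zero, zero_smul, add_zero]
  refine Finset.sum_congr rfl fun a ha => ?_
  have ha' : a ≤ N := by simpa [Nat.lt_succ_iff] using ha
  rw [smul_smul, show N + 1 - a - 1 = N - a by omega]
  congr 1
  ring

theorem dbar_isBigO [CompleteSpace F] {f : ℂ → F} (hf : SmoothGerm f) {N : ℕ}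
    (hO : f =O[𝓝 0] fun z : ℂ => ‖z‖ ^ (N + 1)) : dbar f =O[𝓝 0] fun z : ℂ => ‖z‖ ^ N := by
  refine IsBigO.trans (IsBigO.of_bound 2 (Eventually.of_forall fun z => ?_))
    (hf.fderiv_isBigO hO)
  have h1 := (_root_.fderiv ℝ f z).le_opNorm 1
  have h2 := (_root_.fderiv ℝ f z).le_opNorm I
  simp only [norm_one, mul_one, norm_I] at h1 h2
  refine (norm_add_le _ _).trans ?_
  rw [norm_smul, norm_I, one_mul]
  linarith

theorem dbar_sub {f g : ℂ → F} {z : ℂ} (hf : DifferentiableAt ℝ f z)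
    (hg : DifferentiableAt ℝ g z) : dbar (fun z => f z - g z) z = dbar f z - dbar g z := by
  have := fderiv_fun_sub hf hg
  simp only [dbar, this, sub_apply, smul_sub]
  abel

/-- A smooth function vanishing to order `N + 1` whose Cauchy-Riemann defect vanishes to the same
order has a holomorphic leading term. -/
theorem SmoothGerm.exists_holomorphic_leading [CompleteSpace F] {f : ℂ → F} (hf : SmoothGerm f)
    {N : ℕ} (hO : f =O[𝓝 0] fun z : ℂ => ‖z‖ ^ (N + 1))
    (hd : dbar f =O[𝓝 0] fun z : ℂ => ‖z‖ ^ (N + 1)) :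
    ∃ c : F, (fun z => f z - z ^ (N + 1) • c) =O[𝓝 0] fun z : ℂ => ‖z‖ ^ (N + 2) := by
  obtain ⟨c, hc⟩ := hf.exists_leading hO
  have hsm : SmoothGerm (fun z => f z - homSum (N + 1) c z) :=
    hf.mono fun z hz => hz.sub (contDiff_homSum _ _).contDiffAt
  have h1 := dbar_isBigO hsm hc
  have h2 : (dbar fun z => f z - homSum (N + 1) c z) =ᶠ[𝓝 0] fun z => dbar f z -
      homSum N (fun a => (2 * (N + 1 - a : ℕ) : ℂ) • c a) z := by
    filter_upwards [hf] with z hz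
    rw [dbar_sub (hz.differentiableAt (by simp))
      ((contDiff_homSum _ _).differentiable (by simp) z), dbar_homSum]
  have h3 := hd.sub (h1.congr' h2 EventuallyEq.rfl)
  simp only [sub_sub_cancel] at h3
  have h4 := isLittleO_norm_pow_of_lt h3 N.lt_succ_self
  have h5 : ∀ a ≤ N, c a = 0 := by
    intro a ha
    have := eq_zero_of_homSum_isLittleO h4 ha
    rw [smul_eq_zero] at this
    refine this.resolve_left ?_
    have : N + 1 - a ≠ 0 := by omega
    simp only [mul_eq_zero, not_or]
    exact ⟨two_ne_zero, by exact_mod_cast this⟩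
  refine ⟨c (N + 1), hc.congr_left fun z => ?_⟩
  rw [homSum, Finset.sum_range_succ, Finset.sum_eq_zero, zero_add]
  · simp
  · intro a ha
    rw [h5 a (by simpa [Nat.lt_succ_iff] using ha), smul_zero]

/-- Solving the Cauchy-Riemann equation to leading order. -/
theorem SmoothGerm.exists_dbar_solution [CompleteSpace F] {e : ℂ → F} (he : SmoothGerm e) {N : ℕ}
    (hO : e =O[𝓝 0] fun z : ℂ => ‖z‖ ^ N) :
    ∃ q : ℂ → F, ContDiff ℝ ∞ q ∧ (q =O[𝓝 0] fun z : ℂ => ‖z‖ ^ (N + 1)) ∧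
      (fun z => dbar q z - e z) =O[𝓝 0] fun z : ℂ => ‖z‖ ^ (N + 1) := by
  obtain ⟨c, hc⟩ := he.exists_leading hO
  refine ⟨homSum (N + 1) (fun a => (2 * (N + 1 - a : ℕ) : ℂ)⁻¹ • c a), contDiff_homSum _ _,
    homSum_isBigO _ _, hc.neg_left.congr_left fun z => ?_⟩
  rw [dbar_homSum, neg_sub]
  congr 1
  refine Finset.sum_congr rfl fun a ha => ?_
  have ha' : a ≤ N := by simpa [Nat.lt_succ_iff] using ha
  have : N + 1 - a ≠ 0 := by omega
  beta_reduce
  rw [smul_inv_smul₀]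
  simp only [ne_eq, mul_eq_zero, not_or]
  exact ⟨two_ne_zero, by exact_mod_cast this⟩

end JCurve

namespace JCurve

open Filter Topology Asymptotics ComplexConjugate
open scoped ContDiff Interval

/-- A form of the Cauchy-Pompeiu inequality. -/
theorem norm_le_of_norm_dbar_le {h : ℂ → ℂ} {z₀ : ℂ} {R M D : ℝ} {s : Set ℂ} (hR : 0 < R)
    (hD0 : 0 ≤ D) (hs : s.Countable) (hc : ContinuousOn h (closedBall z₀ R))
    (hd : ∀ z ∈ ball z₀ R, z ∉ s → DifferentiableAt ℝ h z)
    (hM : ∀ z ∈ sphere z₀ R, ‖h z‖ ≤ M)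
    (hD : ∀ z ∈ ball z₀ R, z ∉ s → ‖dbar h z‖ ≤ D) : ‖h z₀‖ ≤ M + R * D := by
  refine le_of_forall_pos_le_add fun η hη => ?_
  obtain ⟨ε, hε, hεR, hεh⟩ : ∃ ε, 0 < ε ∧ ε < R ∧ ∀ z ∈ closedBall z₀ ε, ‖h z - h z₀‖ ≤ η := by
    have h1 : ContinuousAt h z₀ := hc.continuousAt (closedBall_mem_nhds _ hR)
    obtain ⟨δ, hδ, h2⟩ := Metric.continuousAt_iff.1 h1 η hη
    refine ⟨min (δ / 2) (R / 2), by positivity, (min_le_right _ _).trans_lt (by linarith),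
      fun z hz => ?_⟩
    rw [← dist_eq_norm]
    refine (h2 ?_).le
    have := (mem_closedBall.1 hz).trans (min_le_left _ _)
    linarith
  set G : ℂ → ℂ := fun w => h (z₀ + exp w) with hG
  set Z : ℂ := ⟨Real.log ε, 0⟩
  set W : ℂ := ⟨Real.log R, 2 * Real.pi⟩
  have hlog : Real.log ε ≤ Real.log R := Real.log_le_log hε hεR.le
  set s' : Set ℂ := (fun w => z₀ + exp w) ⁻¹' s
  have hs' : s'.Countable := (hs.preimage (add_right_injective z₀)).preimage_cexp
  set T : Set ℂ := {w | w.re < Real.log R} \ s' with hT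
  have hTm : MeasurableSet T :=
    ((isOpen_lt continuous_re continuous_const).measurableSet).diff hs'.measurableSet
  have hexp : ∀ w ∈ T, z₀ + exp w ∈ ball z₀ R := by
    intro w hw
    have : w.re < Real.log R := hw.1
    rw [mem_ball, dist_eq_norm, add_sub_cancel_left, norm_exp]
    rwa [← Real.lt_log_iff_exp_lt hR]
  have hderiv : ∀ w ∈ T, HasFDerivAt G ((fderiv ℝ h (z₀ + exp w)).comp
      ((ContinuousLinearMap.toSpanSingleton ℂ (exp w)).restrictScalars ℝ)) w := by
    intro w hw
    have h1 : HasFDerivAt (fun w => z₀ + exp w)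
        ((ContinuousLinearMap.toSpanSingleton ℂ (exp w)).restrictScalars ℝ) w := by
      have := (((hasStrictDerivAt_exp w).hasDerivAt.hasFDerivAt).const_add z₀).restrictScalars ℝ
      exact this
    exact (hd _ (hexp w hw) hw.2).hasFDerivAt.comp w h1
  set G' : ℂ → ℂ →L[ℝ] ℂ := T.indicator (fderiv ℝ G) with hG'
  have hbound : ∀ w, ‖I • G' w 1 - G' w I‖ ≤ Real.exp w.re * D := by
    intro w
    by_cases hw : w ∈ T
    · rw [hG', Set.indicator_of_mem hw, (hderiv w hw).fderiv]
      have e1 : ∀ c : ℂ, fderiv ℝ h (z₀ + exp w) c = c.re • fderiv ℝ h (z₀ + exp w) 1 +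
          c.im • fderiv ℝ h (z₀ + exp w) I := by
        intro c
        conv_lhs => rw [show c = c.re • (1:ℂ) + c.im • I by simp]
        rw [map_add, map_smul, map_smul]
      have : I • ((fderiv ℝ h (z₀ + exp w)).comp
          ((ContinuousLinearMap.toSpanSingleton ℂ (exp w)).restrictScalars ℝ)) 1 -
          ((fderiv ℝ h (z₀ + exp w)).comp
          ((ContinuousLinearMap.toSpanSingleton ℂ (exp w)).restrictScalars ℝ)) I =
          I * conj (exp w) * dbar h (z₀ + exp w) := by
        simp only [ContinuousLinearMap.comp_apply, ContinuousLinearMap.coe_restrictScalars',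
          ContinuousLinearMap.toSpanSingleton_apply, smul_eq_mul, one_mul, dbar]
        rw [e1 (exp w), e1 (I * exp w)]
        set p := fderiv ℝ h (z₀ + exp w) 1
        set q := fderiv ℝ h (z₀ + exp w) I
        have e2 : conj (exp w) = (exp w).re - (exp w).im * I := by
          apply Complex.ext <;> simp
        rw [e2]
        simp only [mul_re, mul_im, I_re, I_im, real_smul]
        push_cast
        linear_combination (((exp w).im : ℂ) * p - (exp w).re * q + (exp w).im * I * q) * I_sq
      rw [this, norm_mul, norm_mul, norm_I, one_mul, RCLike.norm_conj, norm_exp]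
      exact mul_le_mul_of_nonneg_left (hD _ (hexp w hw) hw.2) (Real.exp_pos _).le
    · rw [hG', Set.indicator_of_notMem hw]
      simp only [zero_apply, smul_zero, sub_zero, norm_zero]
      positivity
  have hGc : ContinuousOn G {w | w.re ≤ Real.log R} := by
    refine hc.comp (by fun_prop) fun w hw => ?_
    have : w.re ≤ Real.log R := hw
    rw [mem_closedBall, dist_eq_norm, add_sub_cancel_left, norm_exp]
    rwa [← Real.le_log_iff_exp_le hR]
  have hrect : ([[Z.re, W.re]] ×ℂ [[Z.im, W.im]]) ⊆ {w | w.re ≤ Real.log R} := by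
    intro w hw
    have := (mem_reProdIm.1 hw).1
    rw [show [[Z.re, W.re]] = Set.Icc (Real.log ε) (Real.log R) from Set.uIcc_of_le hlog] at this
    exact this.2
  have hGm : Measurable G' := (measurable_fderiv ℝ G).indicator hTm
  have hcomp : IsCompact ([[Z.re, W.re]] ×ℂ [[Z.im, W.im]]) :=
    isCompact_uIcc.reProdIm isCompact_uIcc
  have main := integral_boundary_rect_of_hasFDerivAt_real_off_countable G G' Z W s' hs'
    (hGc.mono hrect) (by
      intro w hw
      have hwT : w ∈ T := by
        refine ⟨?_, hw.2⟩
        have := (mem_reProdIm.1 hw.1).1.2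
        rwa [show max Z.re W.re = Real.log R from max_eq_right hlog] at this
      rw [hG', Set.indicator_of_mem hwT]
      exact (hderiv w hwT).differentiableAt.hasFDerivAt) (by
      refine MeasureTheory.Measure.integrableOn_of_bounded (M := R * D) hcomp.measure_lt_top.ne
        ?_ ?_
      · refine Measurable.aestronglyMeasurable ?_
        exact ((((ContinuousLinearMap.measurable_apply (1:ℂ)).comp hGm).const_smul I).sub
          ((ContinuousLinearMap.measurable_apply I).comp hGm))
      · refine (MeasureTheory.ae_restrict_mem hcomp.measurableSet).mono fun w hw => ?_
        refine (hbound w).trans (mul_le_mul_of_nonneg_right ?_ hD0)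
        rw [← Real.le_log_iff_exp_le hR]
        exact hrect hw)
  have hper : ∀ x : ℝ, G (x + W.im * I) = G (x + Z.im * I) := by
    intro x
    simp only [hG, W, Z]
    congr 2
    simp [exp_add, exp_two_pi_mul_I]
  simp only [hper, sub_self, zero_add] at main
  have hZr : Z.re = Real.log ε := rfl
  have hWr : W.re = Real.log R := rfl
  have hZi : Z.im = 0 := rfl
  have hWi : W.im = 2 * Real.pi := rfl
  rw [hZr, hWr, hZi, hWi] at main
  have hpi := Real.pi_pos
  have b1 : ‖∫ x : ℝ in Real.log ε..Real.log R, ∫ y : ℝ in (0:ℝ)..2 * Real.pi,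
      I • G' (x + y * I) 1 - G' (x + y * I) I‖ ≤ 2 * Real.pi * (R * D) := by
    have i1 : ∀ x : ℝ, ‖∫ y : ℝ in (0:ℝ)..2 * Real.pi,
        I • G' (x + y * I) 1 - G' (x + y * I) I‖ ≤ Real.exp x * D * (2 * Real.pi) := by
      intro x
      have := intervalIntegral.norm_integral_le_of_norm_le_const (a := 0) (b := 2 * Real.pi)
        (f := fun y : ℝ => I • G' (x + y * I) 1 - G' (x + y * I) I) (C := Real.exp x * D)
        (fun y _ => by simpa using hbound (x + y * I))
      rwa [sub_zero, abs_of_pos (by positivity)] at this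
    have i2 := intervalIntegral.norm_integral_le_of_norm_le (μ := MeasureTheory.volume) hlog
      (Eventually.of_forall fun x _ => i1 x)
      ((by fun_prop : Continuous fun x : ℝ =>
        Real.exp x * D * (2 * Real.pi)).intervalIntegrable _ _)
    refine i2.trans ?_
    rw [intervalIntegral.integral_mul_const, intervalIntegral.integral_mul_const, integral_exp,
      Real.exp_log hR, Real.exp_log hε]
    have : 0 ≤ ε * (D * (2 * Real.pi)) := by positivity
    nlinarith
  have b2 : ‖∫ y : ℝ in (0:ℝ)..2 * Real.pi, G ((Real.log R : ℝ) + y * I)‖ ≤ M * (2 * Real.pi) := by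
    have := intervalIntegral.norm_integral_le_of_norm_le_const (a := 0) (b := 2 * Real.pi)
      (f := fun y : ℝ => G ((Real.log R : ℝ) + y * I)) (C := M) (fun y _ => by
        apply hM
        rw [mem_sphere, dist_eq_norm, add_sub_cancel_left, norm_exp]
        simp [Real.exp_log hR])
    rwa [sub_zero, abs_of_pos (by positivity)] at this
  have b3 : ‖∫ y : ℝ in (0:ℝ)..2 * Real.pi, (G ((Real.log ε : ℝ) + y * I) - h z₀)‖ ≤
      η * (2 * Real.pi) := by
    have := intervalIntegral.norm_integral_le_of_norm_le_const (a := 0) (b := 2 * Real.pi)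
      (f := fun y : ℝ => G ((Real.log ε : ℝ) + y * I) - h z₀) (C := η) (fun y _ => by
        apply hεh
        rw [mem_closedBall, dist_eq_norm, add_sub_cancel_left, norm_exp]
        simp [Real.exp_log hε])
    rwa [sub_zero, abs_of_pos (by positivity)] at this
  have hGi : IntervalIntegrable (fun y : ℝ => G ((Real.log ε : ℝ) + y * I)) MeasureTheory.volume
      0 (2 * Real.pi) := by
    refine Continuous.intervalIntegrable ?_ _ _
    refine hGc.comp_continuous (by fun_prop) fun y => ?_
    simpa using hlog
  rw [intervalIntegral.integral_sub hGi intervalIntegrable_const, intervalIntegral.integral_const,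
    sub_zero] at b3
  set A := ∫ y : ℝ in (0:ℝ)..2 * Real.pi, G ((Real.log R : ℝ) + y * I)
  set B := ∫ y : ℝ in (0:ℝ)..2 * Real.pi, G ((Real.log ε : ℝ) + y * I)
  rw [← main, ← smul_sub, norm_smul, norm_I, one_mul] at b1
  have h3 : ‖(2 * Real.pi) • h z₀‖ ≤ ‖A‖ + ‖A - B‖ + ‖B - (2 * Real.pi) • h z₀‖ := by
    calc ‖(2 * Real.pi) • h z₀‖ = ‖A - (A - B) - (B - (2 * Real.pi) • h z₀)‖ := by congr 1; abel
      _ ≤ _ := (norm_sub_le _ _).trans (add_le_add_left (norm_sub_le _ _) _)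
  rw [norm_smul, Real.norm_of_nonneg (by positivity)] at h3
  have h4 : 2 * Real.pi * ‖h z₀‖ ≤ 2 * Real.pi * (M + R * D + η) := by linarith
  exact le_of_mul_le_mul_left h4 (by positivity)

variable {F : Type*} [NormedAddCommGroup F] [NormedSpace ℂ F]

theorem dbar_clm_comp (l : F →L[ℂ] ℂ) {θ : ℂ → F} {z : ℂ} (h : DifferentiableAt ℝ θ z) :
    dbar (fun z => l (θ z)) z = l (dbar θ z) := by
  have h1 : HasFDerivAt (fun z => l (θ z)) ((l.restrictScalars ℝ).comp (fderiv ℝ θ z)) z :=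
    (l.restrictScalars ℝ).hasFDerivAt.comp z h.hasFDerivAt
  simp [dbar, h1.fderiv]

/-- A Carleman-type estimate with polynomial weights. -/
theorem eq_zero_of_weight {θ : ℂ → F} {C r : ℝ} {s : Set ℂ} {c : ℕ → ℂ} (hC : 0 ≤ C) (hr : 0 < r)
    (hrC : 12 * r * C ≤ 1) (hs : s.Countable) (hθc : ContinuousOn θ (closedBall 0 (4 * r)))
    (hθd : ∀ z ∈ ball (0:ℂ) (4 * r), z ∉ s → DifferentiableAt ℝ θ z ∧ ‖dbar θ z‖ ≤ C * ‖θ z‖)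
    (hc : ∀ i, ‖c i‖ ≤ r / 4)
    (hroot : ∀ N z₀, ∏ i ∈ Finset.range N, (z₀ - c i) = 0 → θ z₀ = 0 ∧
      Tendsto (fun z => ‖θ z‖ ^ 2 / ‖∏ i ∈ Finset.range N, (z - c i)‖) (𝓝[≠] z₀) (𝓝 0)) {z : ℂ}
    (hz : ‖z‖ ≤ r / 4) : θ z = 0 := by
  have hcomp : IsCompact (closedBall (0:ℂ) (4 * r)) := isCompact_closedBall _ _
  have hne : (closedBall (0:ℂ) (4 * r)).Nonempty := ⟨0, by simp; positivity⟩
  obtain ⟨x, -, hx⟩ := hcomp.exists_isMaxOn hne hθc.norm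
  set S := ‖θ x‖
  have hS : ∀ z, ‖z‖ ≤ 4 * r → ‖θ z‖ ≤ S := fun z hz => hx (by simpa using hz)
  have key : ∀ N : ℕ, ‖θ z‖ ^ 2 ≤ 2 * S ^ 2 * (2 / 3) ^ N := by
    intro N
    set P : ℂ → ℂ := fun z => ∏ i ∈ Finset.range N, (z - c i) with hP
    have hPd : Differentiable ℂ P := by
      intro z
      simp only [hP]
      fun_prop
    have hPc : Continuous P := hPd.continuous
    set g : ℂ → ℝ := fun z => ‖θ z‖ ^ 2 / ‖P z‖ with hg
    have hroot' : ∀ z₀, P z₀ = 0 → ‖z₀‖ < 4 * r := by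
      intro z₀ h
      obtain ⟨i, -, hi⟩ := Finset.prod_eq_zero_iff.1 h
      rw [sub_eq_zero] at hi
      rw [hi]
      linarith [hc i]
    have hgc0 : ∀ z₀, P z₀ = 0 → Tendsto g (𝓝 z₀) (𝓝 0) := by
      intro z₀ h
      have h1 : g z₀ = 0 := by simp [hg, h]
      have h2 : ContinuousAt g z₀ := by
        rw [continuousAt_iff_punctured_nhds, h1]
        exact (hroot N z₀ h).2
      simpa [h1] using h2.tendsto
    have hgc : ContinuousOn g (closedBall 0 (4 * r)) := by
      intro z₀ hz₀
      by_cases h : P z₀ = 0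
      · have : g z₀ = 0 := by simp [hg, h]
        refine ContinuousAt.continuousWithinAt ?_
        have h2 := hgc0 z₀ h
        rwa [← this] at h2
      · exact ((hθc z₀ hz₀).norm.pow 2).div hPc.norm.continuousWithinAt (by simpa using h)
    obtain ⟨y, hy, hymax⟩ := hcomp.exists_isMaxOn hne hgc
    set M := g y with hM
    have hgM : ∀ z, ‖z‖ ≤ 4 * r → g z ≤ M := fun z hz => hymax (by simpa using hz)
    have hM0 : 0 ≤ M := by simp only [hM, hg]; positivity
    have hPlow : ∀ z, r ≤ ‖z‖ → (3 * r / 4) ^ N ≤ ‖P z‖ := by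
      intro z hz
      simp only [hP, norm_prod]
      calc (3 * r / 4) ^ N = ∏ i ∈ Finset.range N, (3 * r / 4) := by
            rw [Finset.prod_const, Finset.card_range]
        _ ≤ _ := Finset.prod_le_prod (fun _ _ => by positivity) fun i _ => by
          have := norm_sub_norm_le z (c i)
          linarith [hc i]
    have hout : ∀ z, r ≤ ‖z‖ → ‖z‖ ≤ 4 * r → g z ≤ S ^ 2 / (3 * r / 4) ^ N := by
      intro z h1 h2
      simp only [hg]
      gcongr
      · exact hS z h2
      · exact hPlow z h1
    have hMle : M ≤ 2 * (S ^ 2 / (3 * r / 4) ^ N) := by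
      by_cases hyr : r ≤ ‖y‖
      · have := hout y hyr (by simpa using hy)
        have h2 : 0 ≤ S ^ 2 / (3 * r / 4) ^ N := by positivity
        linarith
      push Not at hyr
      obtain ⟨l, hl1, hl2⟩ := exists_dual_vector'' ℂ (θ y)
      set h : ℂ → ℂ := fun z => (l (θ z)) ^ 2 / P z with hh
      have hlθ : ∀ z, ‖l (θ z)‖ ≤ ‖θ z‖ := fun z => by
        simpa using l.le_of_opNorm_le hl1 (θ z)
      have hhg : ∀ z, ‖h z‖ ≤ g z := by
        intro z
        simp only [hh, hg, norm_div, norm_pow]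
        gcongr
        exact hlθ z
      have hsub : ∀ z ∈ closedBall y (3 * r), ‖z‖ ≤ 4 * r := by
        intro z hz
        rw [mem_closedBall, dist_eq_norm] at hz
        have := norm_sub_norm_le z y
        linarith
      have hy2 : ‖h y‖ = M := by
        simp only [hh, hM, hg, norm_div, norm_pow, hl2]
        simp
      rw [← hy2]
      have hpom := norm_le_of_norm_dbar_le (h := h) (z₀ := y) (R := 3 * r)
        (M := S ^ 2 / (3 * r / 4) ^ N) (D := 2 * C * M) (s := s ∪ {z | P z = 0}) (by positivity)
        (by positivity) (hs.union (by
          refine Set.Finite.countable (((Finset.range N).finite_toSet.image c).subset ?_)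
          intro z hz
          obtain ⟨i, hi, h0⟩ := Finset.prod_eq_zero_iff.1 hz
          exact ⟨i, hi, (sub_eq_zero.1 h0).symm⟩)) (by
          intro z₀ hz₀
          by_cases h0 : P z₀ = 0
          · have e1 : h z₀ = 0 := by simp [hh, h0]
            refine ContinuousAt.continuousWithinAt ?_
            rw [ContinuousAt, e1]
            exact squeeze_zero_norm hhg (hgc0 z₀ h0)
          · have h1 : ContinuousWithinAt θ (closedBall y (3 * r)) z₀ :=
              (hθc z₀ (by simpa using hsub z₀ hz₀)).mono fun z hz => by simpa using hsub z hz
            exact ((l.continuous.continuousAt.comp_continuousWithinAt h1).pow 2).div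
              hPc.continuousWithinAt h0)
        (by
          intro z hz hzs
          simp only [Set.mem_union, not_or] at hzs
          have hz4 : z ∈ ball (0:ℂ) (4 * r) := by
            rw [mem_ball, dist_eq_norm] at hz
            have := norm_sub_norm_le z y
            simp only [mem_ball, dist_zero_right]
            linarith
          have h1 := (hθd z hz4 hzs.1).1
          have h2 : DifferentiableAt ℝ (fun z => l (θ z)) z :=
            (l.restrictScalars ℝ).differentiableAt.comp z h1
          exact (h2.pow 2).mul ((DifferentiableAt.fun_inv (hPd z) hzs.2).restrictScalars ℝ))
        (by
          intro z hz
          refine (hhg z).trans (hout z ?_ (hsub z (sphere_subset_closedBall hz)))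
          rw [mem_sphere, dist_eq_norm] at hz
          have := norm_sub_le z y
          linarith)
        (by
          intro z hz hzs
          simp only [Set.mem_union, not_or] at hzs
          have hz4 : z ∈ ball (0:ℂ) (4 * r) := by
            rw [mem_ball, dist_eq_norm] at hz
            have := norm_sub_norm_le z y
            simp only [mem_ball, dist_zero_right]
            linarith
          have h1 := hθd z hz4 hzs.1
          have hP0 : P z ≠ 0 := hzs.2
          have h2 : HasFDerivAt (fun z => l (θ z)) ((l.restrictScalars ℝ).comp (fderiv ℝ θ z)) z :=
            (l.restrictScalars ℝ).hasFDerivAt.comp z h1.1.hasFDerivAt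
          have h3 : HasFDerivAt (fun z => (P z)⁻¹)
              (((ContinuousLinearMap.toSpanSingleton ℂ
                (-(deriv P z) / (P z) ^ 2)) : ℂ →L[ℂ] ℂ).restrictScalars ℝ) z :=
            (((hPd z).hasDerivAt.inv hP0).hasFDerivAt).restrictScalars ℝ
          have h4 : HasFDerivAt h _ z := (h2.pow 2).mul h3
          have h5 : dbar h z = 2 * (l (θ z)) * l (dbar θ z) / P z := by
            simp only [dbar, h4.fderiv]
            simp
            linear_combination (l (θ z)) ^ 2 * (-(deriv P z) / (P z) ^ 2) * I_sq
          rw [h5, norm_div, norm_mul, norm_mul]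
          have h6 : ‖l (dbar θ z)‖ ≤ C * ‖θ z‖ :=
            (by simpa using l.le_of_opNorm_le hl1 (dbar θ z) : ‖l (dbar θ z)‖ ≤ ‖dbar θ z‖).trans
              h1.2
          have h7 : ‖(2:ℂ)‖ * ‖l (θ z)‖ * ‖l (dbar θ z)‖ ≤ 2 * C * ‖θ z‖ ^ 2 := by
            rw [show ‖(2:ℂ)‖ = 2 by simp]
            calc 2 * ‖l (θ z)‖ * ‖l (dbar θ z)‖ ≤ 2 * ‖θ z‖ * (C * ‖θ z‖) := by
                  gcongr
                  exact hlθ z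
              _ = _ := by ring
          calc _ ≤ 2 * C * ‖θ z‖ ^ 2 / ‖P z‖ := by gcongr
            _ = 2 * C * g z := by simp only [hg]; ring
            _ ≤ 2 * C * M := by
              gcongr
              exact hgM z (mem_ball_zero_iff.1 hz4).le)
      rw [hy2] at hpom ⊢
      have : 3 * r * (2 * C * M) ≤ M / 2 := by nlinarith
      linarith
    have hPup : ‖P z‖ ≤ (r / 2) ^ N := by
      simp only [hP, norm_prod]
      calc _ ≤ ∏ i ∈ Finset.range N, (r / 2) :=
            Finset.prod_le_prod (fun _ _ => norm_nonneg _) fun i _ => by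
              have := norm_sub_le z (c i)
              linarith [hc i]
        _ = _ := by rw [Finset.prod_const, Finset.card_range]
    by_cases hPz : P z = 0
    · rw [(hroot N z hPz).1]
      rw [norm_zero, zero_pow two_ne_zero]
      positivity
    have h1 : ‖θ z‖ ^ 2 = g z * ‖P z‖ := by
      simp only [hg]
      rw [div_mul_cancel₀ _ (by simpa using hPz)]
    rw [h1]
    calc g z * ‖P z‖ ≤ (2 * (S ^ 2 / (3 * r / 4) ^ N)) * (r / 2) ^ N := by
          gcongr
          exact (hgM z (by linarith)).trans hMle
      _ = 2 * S ^ 2 * ((r / 2) / (3 * r / 4)) ^ N := by rw [div_pow (r / 2)]; field_simp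
      _ = _ := by
        rw [show r / 2 / (3 * r / 4) = 2 / 3 by field_simp; norm_num]
  have hlim : Tendsto (fun N : ℕ => 2 * S ^ 2 * (2 / 3 : ℝ) ^ N) atTop (𝓝 (2 * S ^ 2 * 0)) :=
    (tendsto_pow_atTop_nhds_zero_of_lt_one (by norm_num) (by norm_num)).const_mul _
  rw [mul_zero] at hlim
  have := ge_of_tendsto' hlim key
  have h2 : ‖θ z‖ ^ 2 = 0 := le_antisymm this (by positivity)
  simpa using h2

/-- Unique continuation for the Cauchy-Riemann inequality. -/
theorem eventually_eq_zero_of_dbar_le {θ : ℂ → F} {C : ℝ} (h0 : ContinuousAt θ 0)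
    (hd : ∀ᶠ z in 𝓝[≠] 0, DifferentiableAt ℝ θ z ∧ ‖dbar θ z‖ ≤ C * ‖θ z‖)
    (h : (∀ N : ℕ, θ =O[𝓝 0] fun z => ‖z‖ ^ N) ∨ ∃ᶠ z in 𝓝[≠] 0, θ z = 0) :
    ∀ᶠ z in 𝓝 0, θ z = 0 := by
  obtain ⟨ρ, hρ, hball⟩ := Metric.eventually_nhds_iff_ball.1 (eventually_nhdsWithin_iff.1 hd)
  have hρ' : ∀ z ∈ ball (0:ℂ) ρ, z ∉ ({0} : Set ℂ) →
      DifferentiableAt ℝ θ z ∧ ‖dbar θ z‖ ≤ max C 0 * ‖θ z‖ := fun z hz hz0 =>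
    ⟨(hball z hz hz0).1, (hball z hz hz0).2.trans (by gcongr; exact le_max_left _ _)⟩
  set D := max C 0
  have hD : 0 ≤ D := le_max_right _ _
  obtain ⟨r, hr, hrρ, hrD⟩ : ∃ r : ℝ, 0 < r ∧ 4 * r < ρ ∧ 12 * r * D ≤ 1 := by
    refine ⟨min (ρ / 8) (1 / (12 * (D + 1))), by positivity, ?_, ?_⟩
    · have := min_le_left (ρ / 8) (1 / (12 * (D + 1)))
      linarith
    · calc 12 * min (ρ / 8) (1 / (12 * (D + 1))) * D ≤ 12 * (1 / (12 * (D + 1))) * (D + 1) := by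
            gcongr
            · exact min_le_right _ _
            · linarith
        _ = 1 := by field_simp
  have hcont : ∀ z ∈ ball (0:ℂ) ρ, ContinuousAt θ z := by
    intro z hz
    by_cases hz0 : z = 0
    · rwa [hz0]
    · exact (hρ' z hz hz0).1.continuousAt
  have hθc : ContinuousOn θ (closedBall 0 (4 * r)) := fun z hz =>
    (hcont z (closedBall_subset_ball hrρ hz)).continuousWithinAt
  have main : ∃ c : ℕ → ℂ, (∀ i, ‖c i‖ ≤ r / 4) ∧
      (∀ N z₀, ∏ i ∈ Finset.range N, (z₀ - c i) = 0 → θ z₀ = 0 ∧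
      Tendsto (fun z => ‖θ z‖ ^ 2 / ‖∏ i ∈ Finset.range N, (z - c i)‖) (𝓝[≠] z₀) (𝓝 0)) := by
    rcases h with h | h
    · refine ⟨fun _ => 0, fun _ => by simp; positivity, fun N z₀ hz₀ => ?_⟩
      simp only [sub_zero, Finset.prod_const, Finset.card_range] at hz₀ ⊢
      obtain rfl : z₀ = 0 := eq_zero_of_pow_eq_zero hz₀
      constructor
      · exact (h 1).eq_zero_imp.self_of_nhds (by simp)
      · have h1 := (h N).norm_left.mul_isLittleO
          (isLittleO_norm_pow_of_lt (h 1) zero_lt_one).norm_left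
        refine Tendsto.mono_left ?_ nhdsWithin_le_nhds
        refine IsLittleO.tendsto_div_nhds_zero ?_
        simpa [sq] using h1
    · have hinf : ({z | θ z = 0} ∩ (ball 0 (r / 4) \ {0})).Infinite := by
        intro hfin
        have h1 : ∀ᶠ z in 𝓝[≠] (0:ℂ), z ∉ {z | θ z = 0} ∩ (ball 0 (r / 4) \ {0}) :=
          nhdsWithin_le_nhds (hfin.isClosed.isOpen_compl.mem_nhds fun h => h.2.2 rfl)
        have h2 : ∀ᶠ z in 𝓝[≠] (0:ℂ), z ∈ ball (0:ℂ) (r / 4) :=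
          nhdsWithin_le_nhds (ball_mem_nhds _ (by positivity))
        obtain ⟨z, hz, h3, h4, h5⟩ :=
          (h.and_eventually (h1.and (h2.and self_mem_nhdsWithin))).exists
        exact h3 ⟨hz, h4, h5⟩
      let c := hinf.natEmbedding
      refine ⟨fun i => c i, fun i => ?_, fun N z₀ hz₀ => ?_⟩
      · exact (mem_ball_zero_iff.1 (c i).2.2.1).le
      · obtain ⟨i, hi, hi0⟩ := Finset.prod_eq_zero_iff.1 hz₀
        obtain rfl : z₀ = c i := sub_eq_zero.1 hi0
        have hθ0 : θ (c i) = 0 := (c i).2.1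
        refine ⟨hθ0, ?_⟩
        have hdi : DifferentiableAt ℝ θ (c i) := (hρ' (c i) (ball_subset_ball (by linarith)
          (c i).2.2.1) (c i).2.2.2).1
        have h1 : θ =O[𝓝 (c i : ℂ)] fun z => z - c i := by
          simpa [hθ0] using hdi.isBigO_sub
        have h2 : θ =o[𝓝 (c i : ℂ)] fun _ => (1:ℝ) := by
          rw [isLittleO_one_iff]
          simpa [hθ0] using hdi.continuousAt.tendsto
        have h3 := h1.norm_left.norm_right.mul_isLittleO h2.norm_left
        set Q : ℂ → ℂ := fun z => ∏ j ∈ (Finset.range N).erase i, (z - c j) with hQ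
        have hQ0 : Q (c i) ≠ 0 := by
          refine Finset.prod_ne_zero_iff.2 fun j hj => sub_ne_zero.2 fun h => ?_
          exact (Finset.ne_of_mem_erase hj) (c.injective (Subtype.ext h)).symm
        have hQc : Continuous Q := by fun_prop
        have h4 : (fun z => z - c i) =O[𝓝 (c i : ℂ)]
            fun z => ∏ j ∈ Finset.range N, (z - c j) := by
          have h5 : ∀ᶠ z in 𝓝 (c i : ℂ), ‖Q (c i)‖ / 2 < ‖Q z‖ :=
            hQc.norm.continuousAt.eventually_const_lt (half_lt_self (norm_pos_iff.2 hQ0))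
          refine IsBigO.of_bound (‖Q (c i)‖ / 2)⁻¹ (h5.mono fun z hz => ?_)
          rw [← Finset.mul_prod_erase _ _ hi, norm_mul]
          have h6 : 0 < ‖Q (c i)‖ / 2 := half_pos (norm_pos_iff.2 hQ0)
          calc ‖z - c i‖ = (‖Q (c i)‖ / 2)⁻¹ * (‖z - c i‖ * (‖Q (c i)‖ / 2)) := by
                field_simp
            _ ≤ (‖Q (c i)‖ / 2)⁻¹ * (‖z - c i‖ * ‖Q z‖) := by gcongr
        refine Tendsto.mono_left (IsLittleO.tendsto_div_nhds_zero ?_) nhdsWithin_le_nhds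
        refine IsLittleO.trans_isBigO ?_ h4.norm_right
        simpa [sq] using h3
  obtain ⟨c, hc, hroot⟩ := main
  filter_upwards [closedBall_mem_nhds (0:ℂ) (show 0 < r / 4 by positivity)] with z hz
  exact eq_zero_of_weight hD hr hrD (Set.countable_singleton 0) hθc
    (fun z hz hz0 => hρ' z (ball_subset_ball hrρ.le hz) hz0) hc hroot (by simpa using hz)

end JCurve

namespace JCurve

open Filter Topology Asymptotics ComplexConjugate
open scoped ContDiff

variable {F : Type*} [NormedAddCommGroup F] [NormedSpace ℂ F]

/-- Smooth germs of `J`-holomorphic curves at the origin. -/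
def CurveGerm (J : F → F →L[ℝ] F) (u : ℂ → F) : Prop :=
  ∀ᶠ z in 𝓝 (0 : ℂ), ContDiffAt ℝ ∞ u z ∧ fderiv ℝ u z 1 + J (u z) (fderiv ℝ u z I) = 0

variable {J : F → F →L[ℝ] F} {u : ℂ → F}

theorem CurveGerm.smoothGerm (h : CurveGerm J u) : SmoothGerm u := h.mono fun _ h => h.1

theorem CurveGerm.continuousAt (h : CurveGerm J u) : ContinuousAt u 0 :=
  h.self_of_nhds.1.continuousAt

theorem fderiv_I_mul {z : ℂ} (hJsq : ∀ x w, J x (J x w) = -w)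
    (hz : fderiv ℝ u z 1 + J (u z) (fderiv ℝ u z I) = 0) (h : ℂ) :
    fderiv ℝ u z (I * h) = J (u z) (fderiv ℝ u z h) := by
  have e1 : fderiv ℝ u z 1 = - J (u z) (fderiv ℝ u z I) := eq_neg_of_add_eq_zero_left hz
  have e2 : J (u z) (fderiv ℝ u z 1) = fderiv ℝ u z I := by
    rw [e1, map_neg, hJsq, neg_neg]
  have e3 : ∀ c : ℂ, fderiv ℝ u z c = c.re • fderiv ℝ u z 1 + c.im • fderiv ℝ u z I := by
    intro c
    conv_lhs => rw [show c = c.re • (1:ℂ) + c.im • I by simp]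
    rw [map_add, map_smul, map_smul]
  rw [e3 (I * h), e3 h, map_add, map_smul, map_smul, e2, e1]
  simp [add_comm]

theorem CurveGerm.dbar_isBigO (hu : CurveGerm J u) (hJ : ContDiff ℝ ∞ J)
    (hJ0 : ∀ w, J 0 w = I • w) (hu0 : u 0 = 0) : dbar u =O[𝓝 0] u := by
  have h1 : (fun z => J (u z) - J 0) =O[𝓝 0] u := by
    have := (hJ.differentiable (by simp) 0).isBigO_sub
    have h2 : Tendsto u (𝓝 0) (𝓝 0) := by simpa [hu0] using hu.continuousAt.tendsto
    have h3 := this.comp_tendsto h2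
    simp only [sub_zero] at h3
    exact h3
  have h2 : (fderiv ℝ u) =O[𝓝 0] fun _ => (1:ℝ) :=
    hu.smoothGerm.fderiv.self_of_nhds.continuousAt.tendsto.isBigO_one ℝ
  refine IsBigO.trans (IsBigO.of_bound 1 ?_) (g := fun z => ‖J (u z) - J 0‖ * ‖fderiv ℝ u z‖) ?_
  · filter_upwards [hu] with z hz
    have : dbar u z = - ((J (u z) - J 0) (fderiv ℝ u z I)) := by
      rw [dbar, eq_neg_of_add_eq_zero_left hz.2, sub_apply, hJ0]
      abel
    rw [this, norm_neg, one_mul, norm_mul, norm_norm, norm_norm]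
    refine (ContinuousLinearMap.le_opNorm _ _).trans ?_
    gcongr
    simpa using (fderiv ℝ u z).le_opNorm I
  · simpa using (h1.norm_left.norm_right.mul h2.norm_left)

/-- Zeros of a nonconstant curve are isolated and of finite order. -/
theorem CurveGerm.eventually_eq_zero (hu : CurveGerm J u) (hJ : ContDiff ℝ ∞ J)
    (hJ0 : ∀ w, J 0 w = I • w) (hu0 : u 0 = 0)
    (h : (∀ N : ℕ, u =O[𝓝 0] fun z => ‖z‖ ^ N) ∨ ∃ᶠ z in 𝓝[≠] 0, u z = 0) :
    ∀ᶠ z in 𝓝 0, u z = 0 := by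
  obtain ⟨C, hC⟩ := (hu.dbar_isBigO hJ hJ0 hu0).bound
  refine eventually_eq_zero_of_dbar_le (C := C) hu.continuousAt ?_ h
  refine nhdsWithin_le_nhds ?_
  filter_upwards [hu, hC] with z hz hz2
  exact ⟨hz.1.differentiableAt (by simp), hz2⟩

theorem CurveGerm.exists_leading [CompleteSpace F] (hu : CurveGerm J u) (hJ : ContDiff ℝ ∞ J)
    (hJ0 : ∀ w, J 0 w = I • w) (hu0 : u 0 = 0) (hne : ¬ ∀ᶠ z in 𝓝 0, u z = 0) :
    ∃ (K : ℕ) (a : F), a ≠ 0 ∧ (fun z => u z - z ^ (K + 1) • a) =O[𝓝 0]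
      fun z : ℂ => ‖z‖ ^ (K + 2) := by
  have h1 : ∃ N : ℕ, ¬ u =O[𝓝 0] fun z => ‖z‖ ^ N := by
    by_contra! h
    exact hne (hu.eventually_eq_zero hJ hJ0 hu0 (Or.inl h))
  classical
  have h2 := Nat.find_spec h1
  have h3 : ∀ N < Nat.find h1, u =O[𝓝 0] fun z => ‖z‖ ^ N := fun N hN =>
    not_not.1 (Nat.find_min h1 hN)
  have h4 : u =O[𝓝 0] fun z => ‖z‖ ^ 1 := by
    simpa [hu0] using
      isBigO_norm_of_differentiableAt (hu.self_of_nhds.1.differentiableAt (by simp))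
  obtain ⟨K, hK⟩ : ∃ K, Nat.find h1 = K + 2 := by
    rcases h : Nat.find h1 with _ | _ | K
    · rw [h] at h2
      exact absurd (isBigO_norm_pow_of_le h4 zero_le_one) h2
    · rw [h] at h2
      exact absurd h4 h2
    · exact ⟨K, rfl⟩
  rw [hK] at h2 h3
  have h5 := h3 (K + 1) (by omega)
  obtain ⟨a, ha⟩ := hu.smoothGerm.exists_holomorphic_leading h5
    ((hu.dbar_isBigO hJ hJ0 hu0).trans h5)
  refine ⟨K, a, ?_, ha⟩
  rintro rfl
  simp only [smul_zero, sub_zero] at ha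
  exact h2 ha

/-- The complex linear part of `J`-linear maps. -/
noncomputable def linPart (J : F → F →L[ℝ] F) (x : F) : F →L[ℝ] F :=
  (2⁻¹ : ℝ) • (ContinuousLinearMap.id ℝ F - (I • J x))

theorem linPart_apply (x w : F) : linPart J x w = (2⁻¹ : ℝ) • (w - I • J x w) := rfl

theorem linPart_J (hJsq : ∀ x w, J x (J x w) = -w) (x w : F) :
    linPart J x (J x w) = I • linPart J x w := by
  rw [linPart_apply, linPart_apply, hJsq, smul_comm I, smul_sub I, smul_smul I, I_mul_I]
  congr 1
  simp [add_comm]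

theorem linPart_zero (hJ0 : ∀ w, J 0 w = I • w) (w : F) : linPart J 0 w = w := by
  rw [linPart_apply, hJ0, smul_smul, I_mul_I, neg_one_smul, sub_neg_eq_add, ← two_smul ℝ w,
    smul_smul]
  norm_num

theorem contDiff_linPart (hJ : ContDiff ℝ ∞ J) : ContDiff ℝ ∞ (linPart J) :=
  (contDiff_const.sub (hJ.const_smul I)).const_smul (2⁻¹ : ℝ)

end JCurve

namespace JCurve

open Filter Topology Asymptotics ComplexConjugate
open scoped ContDiff

variable {F : Type*} [NormedAddCommGroup F] [NormedSpace ℂ F]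

/-- The filter of pairs `(z, w)` tending to the origin with `‖w‖ ≤ 2 ‖z‖`. -/
noncomputable def coneFilter : Filter (ℂ × ℂ) := 𝓝 0 ⊓ 𝓟 {p | ‖p.2‖ ≤ 2 * ‖p.1‖}

theorem tendsto_fst_coneFilter : Tendsto Prod.fst coneFilter (𝓝 (0:ℂ)) :=
  (continuous_fst.tendsto (0 : ℂ × ℂ)).mono_left inf_le_left

theorem tendsto_snd_coneFilter : Tendsto Prod.snd coneFilter (𝓝 (0:ℂ)) :=
  (continuous_snd.tendsto (0 : ℂ × ℂ)).mono_left inf_le_left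

theorem exists_ball_of_eventually_coneFilter {P : ℂ × ℂ → Prop} (h : ∀ᶠ p in coneFilter, P p) :
    ∃ ρ > 0, ∀ z w : ℂ, ‖z‖ < ρ → ‖w‖ ≤ 2 * ‖z‖ → P (z, w) := by
  rw [coneFilter, eventually_inf_principal] at h
  obtain ⟨ρ, hρ, hP⟩ := Metric.eventually_nhds_iff_ball.1 h
  refine ⟨ρ / 2, by positivity, fun z w hz hw => hP (z, w) ?_ hw⟩
  rw [mem_ball_zero_iff, Prod.norm_mk, max_lt_iff]
  constructor <;> linarith

theorem norm_snd_pow_isBigO (N : ℕ) :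
    (fun p : ℂ × ℂ => ‖p.2‖ ^ N) =O[coneFilter] fun p => ‖p.1‖ ^ N := by
  refine IsBigO.pow ?_ N
  refine IsBigO.of_bound 2 ?_
  rw [coneFilter, eventually_inf_principal]
  refine Eventually.of_forall fun p hp => ?_
  simpa using hp

theorem isBigO_fst_of_isBigO {G : Type*} [NormedAddCommGroup G] {f : ℂ → G} {N : ℕ}
    (h : f =O[𝓝 0] fun z => ‖z‖ ^ N) :
    (fun p : ℂ × ℂ => f p.1) =O[coneFilter] fun p => ‖p.1‖ ^ N :=
  h.comp_tendsto tendsto_fst_coneFilter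

theorem isBigO_snd_of_isBigO {G : Type*} [NormedAddCommGroup G] {f : ℂ → G} {N : ℕ}
    (h : f =O[𝓝 0] fun z => ‖z‖ ^ N) :
    (fun p : ℂ × ℂ => f p.2) =O[coneFilter] fun p => ‖p.1‖ ^ N :=
  (h.comp_tendsto tendsto_snd_coneFilter).trans (norm_snd_pow_isBigO N)

variable {J : F → F →L[ℝ] F} {u : ℂ → F} {K : ℕ} {a : F} {l : F →L[ℂ] ℂ}

/-- A complex functional applied to the linear part of `J` along a curve. -/
noncomputable def lamPart (J : F → F →L[ℝ] F) (l : F →L[ℂ] ℂ) (u : ℂ → F) (z : ℂ) : F →L[ℝ] ℂ :=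
  (l.restrictScalars ℝ).comp (linPart J (u z))

/-- The defining function for the branches of `u w = u z`. -/
noncomputable def branchFun (J : F → F →L[ℝ] F) (l : F →L[ℂ] ℂ) (u : ℂ → F) (z w : ℂ) : ℂ :=
  lamPart J l u z (u w - u z)

/-- A curve with leading term `z ^ (K + 1) • a`, and a functional normalised on `a`. -/
structure LeadingData (J : F → F →L[ℝ] F) (u : ℂ → F) (K : ℕ) (a : F) (l : F →L[ℂ] ℂ) : Prop where
  smooth : ContDiff ℝ ∞ J
  sq : ∀ x w, J x (J x w) = -w
  zero : ∀ w, J 0 w = I • w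
  curve : CurveGerm J u
  curve_zero : u 0 = 0
  leading : (fun z => u z - z ^ (K + 1) • a) =O[𝓝 0] fun z : ℂ => ‖z‖ ^ (K + 2)
  norm : l a = 1

namespace LeadingData

theorem smoothGerm_linPart (h : LeadingData J u K a l) :
    SmoothGerm (fun z => linPart J (u z)) :=
  h.curve.mono fun _ hz => (contDiff_linPart h.smooth).contDiffAt.comp _ hz.1

theorem smoothGerm_lamPart (h : LeadingData J u K a l) : SmoothGerm (lamPart J l u) :=
  h.smoothGerm_linPart.mono fun _ hz =>
    (((ContinuousLinearMap.compL ℝ F F ℂ) (l.restrictScalars ℝ)).contDiff.contDiffAt).comp _ hz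

theorem curve_isBigO (h : LeadingData J u K a l) :
    u =O[𝓝 0] fun z : ℂ => ‖z‖ ^ (K + 1) := by
  have h1 := isBigO_norm_pow_of_le h.leading (Nat.le_succ (K + 1))
  have h2 : (fun z : ℂ => z ^ (K + 1) • a) =O[𝓝 0] fun z : ℂ => ‖z‖ ^ (K + 1) := by
    refine IsBigO.of_bound ‖a‖ (Eventually.of_forall fun z => ?_)
    rw [norm_smul, norm_pow, norm_pow, norm_norm, mul_comm]
  simpa using h1.add h2

theorem linPart_sub_isBigO (h : LeadingData J u K a l) :
    (fun z => linPart J (u z) - ContinuousLinearMap.id ℝ F) =O[𝓝 0]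
      fun z : ℂ => ‖z‖ ^ (K + 1) := by
  have h1 := ((contDiff_linPart h.smooth).differentiable (by simp) (0:F)).isBigO_sub
  have h2 : Tendsto u (𝓝 0) (𝓝 0) := by
    simpa [h.curve_zero] using h.curve.continuousAt.tendsto
  have h3 := h1.comp_tendsto h2
  have h4 : linPart J (0:F) = ContinuousLinearMap.id ℝ F := by
    ext w
    simp [linPart_zero h.zero]
  simp only [sub_zero, h4] at h3
  exact h3.trans h.curve_isBigO

theorem fderiv_sub_isBigO [CompleteSpace F] (h : LeadingData J u K a l) :
    (fun z => fderiv ℝ u z - (ContinuousLinearMap.toSpanSingleton ℂ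
      (((K + 1 : ℕ) * z ^ K) • a)).restrictScalars ℝ) =O[𝓝 0] fun z : ℂ => ‖z‖ ^ (K + 1) := by
  have hd : ∀ z : ℂ, HasFDerivAt (fun z : ℂ => z ^ (K + 1) • a)
      ((ContinuousLinearMap.toSpanSingleton ℂ
      (((K + 1 : ℕ) * z ^ K) • a)).restrictScalars ℝ) z := by
    intro z
    have := ((hasDerivAt_pow (K + 1) z).smul_const a).hasFDerivAt.restrictScalars ℝ
    simpa using this
  have hsm : SmoothGerm (fun z => u z - z ^ (K + 1) • a) := by
    refine h.curve.mono fun z hz => hz.1.sub ?_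
    exact ((contDiff_id.pow (K + 1)).smul contDiff_const).contDiffAt
  refine (hsm.fderiv_isBigO (N := K + 1) h.leading).congr' ?_ EventuallyEq.rfl
  filter_upwards [h.curve] with z hz
  exact ((hz.1.differentiableAt (by simp)).hasFDerivAt.sub (hd z)).fderiv

theorem fderiv_isBigO [CompleteSpace F] (h : LeadingData J u K a l) :
    fderiv ℝ u =O[𝓝 0] fun z : ℂ => ‖z‖ ^ K :=
  h.curve.smoothGerm.fderiv_isBigO h.curve_isBigO

theorem lamPart_comp_fderiv [CompleteSpace F] (h : LeadingData J u K a l) :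
    (fun p : ℂ × ℂ => (lamPart J l u p.1).comp (fderiv ℝ u p.2) -
      (ContinuousLinearMap.toSpanSingleton ℂ
        ((K + 1 : ℕ) * p.2 ^ K : ℂ)).restrictScalars ℝ) =O[coneFilter]
        fun p => ‖p.1‖ ^ (K + 1) := by
  set L := (l.restrictScalars ℝ : F →L[ℝ] ℂ)
  have e : ∀ p : ℂ × ℂ, (lamPart J l u p.1).comp (fderiv ℝ u p.2) -
      (ContinuousLinearMap.toSpanSingleton ℂ ((K + 1 : ℕ) * p.2 ^ K : ℂ)).restrictScalars ℝ =
      L.comp ((linPart J (u p.1) - ContinuousLinearMap.id ℝ F).comp (fderiv ℝ u p.2)) +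
      L.comp (fderiv ℝ u p.2 - (ContinuousLinearMap.toSpanSingleton ℂ
      (((K + 1 : ℕ) * p.2 ^ K) • a)).restrictScalars ℝ) := by
    intro p
    ext w
    simp [lamPart, L, h.norm]
  simp only [e]
  refine IsBigO.add ?_ ?_
  · have h1 := (isBigO_fst_of_isBigO h.linPart_sub_isBigO).norm_left.mul
      (isBigO_snd_of_isBigO h.fderiv_isBigO).norm_left
    refine IsBigO.trans (IsBigO.of_bound ‖L‖ (Eventually.of_forall fun p => ?_))
      (h1.trans (IsBigO.of_bound 1 ?_))
    · refine (ContinuousLinearMap.opNorm_comp_le _ _).trans ?_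
      rw [norm_mul, norm_norm, norm_norm]
      gcongr
      exact ContinuousLinearMap.opNorm_comp_le _ _
    · filter_upwards [tendsto_fst_coneFilter (ball_mem_nhds (0:ℂ) one_pos)] with p hp
      have hp' : ‖p.1‖ ≤ 1 := (mem_ball_zero_iff.1 hp).le
      rw [one_mul, norm_mul]
      refine mul_le_of_le_one_right (norm_nonneg _) ?_
      simpa using pow_le_one₀ (norm_nonneg _) hp'
  · refine IsBigO.trans (IsBigO.of_bound ‖L‖ (Eventually.of_forall fun p => ?_))
      (isBigO_snd_of_isBigO h.fderiv_sub_isBigO)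
    exact ContinuousLinearMap.opNorm_comp_le _ _

theorem branchFun_sub_isBigO (h : LeadingData J u K a l) :
    (fun p : ℂ × ℂ => branchFun J l u p.1 p.2 - (p.2 ^ (K + 1) - p.1 ^ (K + 1))) =O[coneFilter]
      fun p => ‖p.1‖ ^ (K + 2) := by
  set L := (l.restrictScalars ℝ : F →L[ℝ] ℂ)
  have e : ∀ p : ℂ × ℂ, branchFun J l u p.1 p.2 - (p.2 ^ (K + 1) - p.1 ^ (K + 1)) =
      L ((linPart J (u p.1) - ContinuousLinearMap.id ℝ F) (u p.2 - u p.1)) +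
      (L (u p.2 - p.2 ^ (K + 1) • a) - L (u p.1 - p.1 ^ (K + 1) • a)) := by
    intro p
    simp [branchFun, lamPart, L, h.norm]
    ring
  simp only [e]
  have hL : ∀ {f : ℂ × ℂ → F} {N : ℕ}, f =O[coneFilter] (fun p => ‖p.1‖ ^ N) →
      (fun p => L (f p)) =O[coneFilter] (fun p => ‖p.1‖ ^ N) := fun hf =>
    (L.isBigO_comp _ _).trans hf
  refine IsBigO.add (hL ?_) ((hL (isBigO_snd_of_isBigO h.leading)).sub
    (hL (isBigO_fst_of_isBigO h.leading)))
  have h1 := (isBigO_fst_of_isBigO h.linPart_sub_isBigO).norm_left.mul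
      ((isBigO_snd_of_isBigO h.curve_isBigO).sub (isBigO_fst_of_isBigO h.curve_isBigO)).norm_left
  refine IsBigO.trans (IsBigO.of_bound 1 (Eventually.of_forall fun p => ?_))
      (h1.trans (IsBigO.of_bound 1 ?_))
  · rw [one_mul, norm_mul, norm_norm, norm_norm]
    exact ContinuousLinearMap.le_opNorm _ _
  · filter_upwards [tendsto_fst_coneFilter (ball_mem_nhds (0:ℂ) one_pos)] with p hp
    have hp' : ‖p.1‖ ≤ 1 := (mem_ball_zero_iff.1 hp).le
    rw [one_mul, ← pow_add, norm_pow, norm_pow, norm_norm]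
    exact pow_le_pow_of_le_one (norm_nonneg _) hp' (by omega)

end LeadingData

/-- A perturbed linear map has a zero. -/
theorem exists_zero_of_norm_sub_le {f : ℂ → ℂ} {b m : ℂ} {ε : ℝ} (hm : m ≠ 0) (hε : 0 ≤ ε)
    (h : ∀ x ∈ closedBall b ε, ∀ y ∈ closedBall b ε, ‖f x - f y - m * (x - y)‖ ≤ ‖m‖ / 2 * ‖x - y‖)
    (hb : ‖f b‖ ≤ ‖m‖ / 2 * ε) : ∃ x ∈ closedBall b ε, f x = 0 := by
  have hm' : 0 < ‖m‖ := norm_pos_iff.2 hm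
  let T : ℂ → ℂ := fun x => x - f x / m
  have hT : ∀ x ∈ closedBall b ε, ∀ y ∈ closedBall b ε, ‖T x - T y‖ ≤ 1 / 2 * ‖x - y‖ := by
    intro x hx y hy
    have : T x - T y = - (f x - f y - m * (x - y)) / m := by
      simp only [T]
      field_simp
      ring
    rw [this, norm_div, norm_neg, div_le_iff₀ hm']
    refine (h x hx y hy).trans (le_of_eq ?_)
    ring
  have hbb : b ∈ closedBall b ε := by simpa using hε
  have hTb : ‖T b - b‖ ≤ ε / 2 := by
    have : T b - b = - (f b / m) := by simp only [T]; ring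
    rw [this, norm_neg, norm_div, div_le_iff₀ hm']
    refine hb.trans (le_of_eq ?_)
    ring
  have hmaps : Set.MapsTo T (closedBall b ε) (closedBall b ε) := by
    intro x hx
    have h1 := hT x hx b hbb
    rw [mem_closedBall, dist_eq_norm] at hx ⊢
    calc ‖T x - b‖ = ‖(T x - T b) + (T b - b)‖ := by congr 1; ring
      _ ≤ _ := norm_add_le _ _
      _ ≤ ε := by linarith
  have hcontr : ContractingWith (1 / 2) (hmaps.restrict T _ _) := by
    refine ⟨by norm_num, LipschitzWith.of_dist_le_mul fun x y => ?_⟩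
    have := hT x x.2 y y.2
    simpa [Subtype.dist_eq, dist_eq_norm] using this
  obtain ⟨y, hy, hfix, -⟩ := hcontr.exists_fixedPoint' isClosed_closedBall.isComplete hmaps hbb
    (edist_ne_top _ _)
  refine ⟨y, hy, ?_⟩
  have h1 : y - f y / m = y := hfix
  have h2 : f y / m = 0 := by linear_combination -h1
  simpa [hm] using h2

end JCurve

namespace JCurve

open Filter Topology Asymptotics ComplexConjugate
open scoped ContDiff

variable {F : Type*} [NormedAddCommGroup F] [NormedSpace ℂ F]
variable {J : F → F →L[ℝ] F} {u : ℂ → F} {K : ℕ} {a : F} {l : F →L[ℂ] ℂ}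

theorem exists_root_near {n : ℕ} (hn : 0 < n) {c : ℝ} (hc : 0 < c) {q : ℂ}
    (hq : ‖q ^ n - 1‖ < c ^ n) : ∃ ζ : ℂ, ζ ^ n = 1 ∧ ‖q - ζ‖ < c := by
  by_contra! H
  have h1 := (Complex.isPrimitiveRoot_exp n hn.ne')
  have h2 := congrArg (Polynomial.eval q) (Polynomial.X_pow_sub_one_eq_prod hn h1)
  rw [Polynomial.eval_prod] at h2
  simp only [Polynomial.eval_sub, Polynomial.eval_pow, Polynomial.eval_X, Polynomial.eval_one,
    Polynomial.eval_C] at h2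
  rw [h2, norm_prod] at hq
  have h3 : ∏ _ζ ∈ Polynomial.nthRootsFinset n (1:ℂ), c ≤
      ∏ ζ ∈ Polynomial.nthRootsFinset n (1:ℂ), ‖q - ζ‖ :=
    Finset.prod_le_prod (fun _ _ => hc.le) fun ζ hζ =>
      H ζ ((Polynomial.mem_nthRootsFinset hn _).1 hζ)
  rw [Finset.prod_const, h1.card_nthRootsFinset] at h3
  exact absurd hq (not_lt.2 h3)

theorem norm_eq_one_of_pow_succ {ζ : ℂ} {K : ℕ} (h : ζ ^ (K + 1) = 1) : ‖ζ‖ = 1 :=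
  Complex.norm_eq_one_of_pow_eq_one h K.succ_ne_zero

namespace LeadingData

theorem exists_fderiv_near [CompleteSpace F] (h : LeadingData J u K a l) :
    ∃ c : ℝ, 0 < c ∧ c < 1 ∧ ∃ ρ > 0, ∀ ζ z w : ℂ, ζ ^ (K + 1) = 1 → z ≠ 0 → ‖z‖ < ρ →
      w ∈ closedBall (z * ζ) (c * ‖z‖) → DifferentiableAt ℝ u w ∧
      ‖(lamPart J l u z).comp (fderiv ℝ u w) - (ContinuousLinearMap.toSpanSingleton ℂ
        ((K + 1 : ℕ) * (z * ζ) ^ K : ℂ)).restrictScalars ℝ‖ ≤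
          ‖((K + 1 : ℕ) * (z * ζ) ^ K : ℂ)‖ / 2 := by
  have hcont : ContinuousAt (fun q : ℂ => q ^ K) 1 := by fun_prop
  obtain ⟨c₁, hc₁, hc⟩ := Metric.continuousAt_iff.1 hcont (1 / 4) (by norm_num)
  obtain ⟨C, hC⟩ := h.lamPart_comp_fderiv.bound
  obtain ⟨ρ₁, hρ₁, hb⟩ := exists_ball_of_eventually_coneFilter hC
  obtain ⟨ρ₂, hρ₂, hd⟩ := Metric.eventually_nhds_iff_ball.1 h.curve
  refine ⟨min (c₁ / 2) (1 / 2), by positivity, (min_le_right _ _).trans_lt (by norm_num),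
    min (min ρ₁ (ρ₂ / 2)) (1 / (4 * (|C| + 1))), by positivity, fun ζ z w hζ hz hzρ hw => ?_⟩
  have hz' : 0 < ‖z‖ := norm_pos_iff.2 hz
  have hζ1 : ‖ζ‖ = 1 := norm_eq_one_of_pow_succ hζ
  have hζ0 : ζ ≠ 0 := norm_ne_zero_iff.1 (by rw [hζ1]; norm_num)
  rw [lt_min_iff, lt_min_iff] at hzρ
  rw [mem_closedBall, dist_eq_norm] at hw
  have hw2 : ‖w‖ ≤ 2 * ‖z‖ := by
    have h1 : min (c₁ / 2) (1 / 2) * ‖z‖ ≤ 1 * ‖z‖ := by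
      gcongr
      exact (min_le_right _ _).trans (by norm_num)
    calc ‖w‖ = ‖(w - z * ζ) + z * ζ‖ := by congr 1; ring
      _ ≤ ‖w - z * ζ‖ + ‖z * ζ‖ := norm_add_le _ _
      _ ≤ 2 * ‖z‖ := by rw [norm_mul z, hζ1]; linarith
  have hwρ : w ∈ ball (0:ℂ) ρ₂ := by
    rw [mem_ball_zero_iff]
    linarith [hzρ.1.2]
  refine ⟨(hd w hwρ).1.differentiableAt (by simp), ?_⟩
  have hB := hb z w hzρ.1.1 hw2
  simp only [norm_pow, norm_norm] at hB
  have hm : ‖((K + 1 : ℕ) * (z * ζ) ^ K : ℂ)‖ = (K + 1) * ‖z‖ ^ K := by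
    rw [norm_mul, norm_pow, norm_mul, hζ1, mul_one, Complex.norm_natCast]
    push_cast
    ring
  rw [hm]
  obtain ⟨q, rfl⟩ : ∃ q, w = z * ζ * q := ⟨w / (z * ζ), by field_simp⟩
  have hq : dist q 1 < c₁ := by
    rw [dist_eq_norm]
    have h1 : z * ζ * q - z * ζ = (z * ζ) * (q - 1) := by ring
    rw [h1, norm_mul, norm_mul, hζ1, mul_one, mul_comm] at hw
    have := (le_of_mul_le_mul_right hw hz').trans (min_le_left _ _)
    linarith
  have hq2 := hc hq
  rw [dist_eq_norm, one_pow] at hq2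
  have hdiff : ‖(ContinuousLinearMap.toSpanSingleton ℂ
        ((K + 1 : ℕ) * (z * ζ * q) ^ K : ℂ)).restrictScalars ℝ -
      (ContinuousLinearMap.toSpanSingleton ℂ
        ((K + 1 : ℕ) * (z * ζ) ^ K : ℂ)).restrictScalars ℝ‖ ≤ (K + 1) * ‖z‖ ^ K * (1 / 4) := by
    refine ContinuousLinearMap.opNorm_le_bound _ (by positivity) fun x => ?_
    have e : (((ContinuousLinearMap.toSpanSingleton ℂ
        ((K + 1 : ℕ) * (z * ζ * q) ^ K : ℂ)).restrictScalars ℝ -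
      (ContinuousLinearMap.toSpanSingleton ℂ
        ((K + 1 : ℕ) * (z * ζ) ^ K : ℂ)).restrictScalars ℝ) x) =
        ((K + 1 : ℕ) * (z * ζ) ^ K) * (q ^ K - 1) * x := by
      simp
      ring
    rw [e, norm_mul, norm_mul, hm]
    gcongr
  have hsmall : C * ‖z‖ ^ (K + 1) ≤ (K + 1) * ‖z‖ ^ K * (1 / 4) := by
    have h1 : ‖z‖ * (4 * (|C| + 1)) ≤ 1 := by
      have := hzρ.2.le
      rwa [le_div_iff₀ (by positivity)] at this
    have h2 : C * ‖z‖ ≤ 1 / 4 := by nlinarith [le_abs_self C, norm_nonneg z]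
    have h3 : (0:ℝ) ≤ ‖z‖ ^ K := by positivity
    have h4 : (0:ℝ) ≤ K := by positivity
    calc C * ‖z‖ ^ (K + 1) = (C * ‖z‖) * ‖z‖ ^ K := by ring
      _ ≤ 1 / 4 * ‖z‖ ^ K := by gcongr
      _ ≤ (K + 1) * ‖z‖ ^ K * (1 / 4) := by nlinarith [mul_nonneg h4 h3]
  calc _ = ‖((lamPart J l u z).comp (fderiv ℝ u (z * ζ * q)) -
        (ContinuousLinearMap.toSpanSingleton ℂ
        ((K + 1 : ℕ) * (z * ζ * q) ^ K : ℂ)).restrictScalars ℝ) +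
        ((ContinuousLinearMap.toSpanSingleton ℂ
        ((K + 1 : ℕ) * (z * ζ * q) ^ K : ℂ)).restrictScalars ℝ -
      (ContinuousLinearMap.toSpanSingleton ℂ
        ((K + 1 : ℕ) * (z * ζ) ^ K : ℂ)).restrictScalars ℝ)‖ := by
        congr 1; abel
    _ ≤ _ := norm_add_le _ _
    _ ≤ _ := by linarith

theorem exists_branchFun_near [CompleteSpace F] (h : LeadingData J u K a l) :
    ∃ c : ℝ, 0 < c ∧ c < 1 ∧ ∃ ρ > 0, ∀ ζ z : ℂ, ζ ^ (K + 1) = 1 → z ≠ 0 → ‖z‖ < ρ →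
      (∀ w ∈ closedBall (z * ζ) (c * ‖z‖), ∀ x : ℂ,
        ‖z‖ ^ K * ‖x‖ ≤ 2 * ‖lamPart J l u z (fderiv ℝ u w x)‖) ∧
      ∀ w ∈ closedBall (z * ζ) (c * ‖z‖), ∀ w' ∈ closedBall (z * ζ) (c * ‖z‖),
        ‖branchFun J l u z w - branchFun J l u z w' - ((K + 1 : ℕ) * (z * ζ) ^ K : ℂ) * (w - w')‖ ≤
          ‖((K + 1 : ℕ) * (z * ζ) ^ K : ℂ)‖ / 2 * ‖w - w'‖ := by
  obtain ⟨c, hc, hc1, ρ, hρ, H⟩ := h.exists_fderiv_near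
  refine ⟨c, hc, hc1, ρ, hρ, fun ζ z hζ hz hzρ => ⟨fun w hw x => ?_, fun w hw w' hw' => ?_⟩⟩
  · have h1 := (ContinuousLinearMap.le_opNorm _ x).trans
      (mul_le_mul_of_nonneg_right (H ζ z w hζ hz hzρ hw).2 (norm_nonneg x))
    have hζ1 : ‖ζ‖ = 1 := norm_eq_one_of_pow_succ hζ
    set m : ℂ := ((K + 1 : ℕ) * (z * ζ) ^ K : ℂ) with hm_def
    have hm : ‖m‖ = (K + 1) * ‖z‖ ^ K := by
      rw [hm_def, norm_mul, norm_pow, norm_mul, hζ1, mul_one, Complex.norm_natCast]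
      push_cast
      ring
    have h2 : ‖x * m‖ ≤ ‖lamPart J l u z (fderiv ℝ u w x)‖ +
        ‖lamPart J l u z (fderiv ℝ u w x) - x * m‖ := by
      have := norm_sub_le (lamPart J l u z (fderiv ℝ u w x))
        (lamPart J l u z (fderiv ℝ u w x) - x * m)
      simpa using this
    have h3 : ‖lamPart J l u z (fderiv ℝ u w x) - x * m‖ ≤ ‖m‖ / 2 * ‖x‖ := by simpa using h1
    rw [norm_mul] at h2
    have h4 : ‖z‖ ^ K * ‖x‖ ≤ ‖m‖ * ‖x‖ := by
      rw [hm]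
      gcongr
      refine le_mul_of_one_le_left (by positivity) ?_
      have : (0:ℝ) ≤ K := by positivity
      linarith
    linarith
  · have h1 := (convex_closedBall (z * ζ) (c * ‖z‖)).norm_image_sub_le_of_norm_hasFDerivWithin_le'
      (f := fun w => branchFun J l u z w)
      (f' := fun w => (lamPart J l u z).comp (fderiv ℝ u w))
      (φ := (ContinuousLinearMap.toSpanSingleton ℂ
        ((K + 1 : ℕ) * (z * ζ) ^ K : ℂ)).restrictScalars ℝ)
      (fun x hx => ?_) (fun x hx => (H ζ z x hζ hz hzρ hx).2) hw' hw
    · refine le_trans (le_of_eq ?_) h1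
      congr 2
      simp [mul_comm]
    · have := (H ζ z x hζ hz hzρ hx).1.hasFDerivAt
      exact ((lamPart J l u z).hasFDerivAt.comp x (this.sub_const (u z))).hasFDerivWithinAt

theorem exists_root_of_eq (h : LeadingData J u K a l) {c : ℝ} (hc : 0 < c) :
    ∃ ρ > 0, ∀ z w : ℂ, z ≠ 0 → ‖z‖ < ρ → ‖w‖ < ρ → u w = u z →
      ∃ ζ : ℂ, ζ ^ (K + 1) = 1 ∧ w ∈ closedBall (z * ζ) (c * ‖z‖) := by
  obtain ⟨C, hC⟩ := (h.leading).bound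
  have hla : (fun z => l (u z) - z ^ (K + 1)) =O[𝓝 0] fun z : ℂ => ‖z‖ ^ (K + 2) := by
    have := (l.isBigO_comp (fun z => u z - z ^ (K + 1) • a) (𝓝 0)).trans h.leading
    simpa [h.norm] using this
  obtain ⟨ρ₀, hρ₀, hb⟩ := Metric.eventually_nhds_iff_ball.1
    ((isLittleO_norm_pow_of_lt hla (Nat.lt_succ_self (K + 1))).def (c := 1 / 5) (by norm_num))
  obtain ⟨ρ₁, hρ₁, hb'⟩ := Metric.eventually_nhds_iff_ball.1
    ((isLittleO_norm_pow_of_lt hla (Nat.lt_succ_self (K + 1))).def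
      (c := c ^ (K + 1) / 2 / (1 + 2 ^ (K + 1))) (by positivity))
  refine ⟨min ρ₀ ρ₁, by positivity, fun z w hz hzρ hwρ huw => ?_⟩
  rw [lt_min_iff] at hzρ hwρ
  have hz' : 0 < ‖z‖ := norm_pos_iff.2 hz
  have e1 := hb z (mem_ball_zero_iff.2 hzρ.1)
  have e2 := hb w (mem_ball_zero_iff.2 hwρ.1)
  have e1' := hb' z (mem_ball_zero_iff.2 hzρ.2)
  have e2' := hb' w (mem_ball_zero_iff.2 hwρ.2)
  simp only [norm_pow, norm_norm] at e1 e2 e1' e2'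
  have e3 : ‖w ^ (K + 1) - z ^ (K + 1)‖ ≤ ‖l (u z) - z ^ (K + 1)‖ + ‖l (u w) - w ^ (K + 1)‖ := by
    refine le_trans (le_of_eq ?_) (norm_sub_le _ _)
    rw [huw]
    congr 1
    ring
  have e4 : ‖w‖ ^ (K + 1) ≤ (2 * ‖z‖) ^ (K + 1) := by
    have h1 : ‖w‖ ^ (K + 1) ≤ ‖w ^ (K + 1) - z ^ (K + 1)‖ + ‖z‖ ^ (K + 1) := by
      have := norm_add_le (w ^ (K + 1) - z ^ (K + 1)) (z ^ (K + 1))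
      simpa using this
    have h2 : ‖w‖ ^ (K + 1) ≤ 3 / 2 * ‖z‖ ^ (K + 1) := by linarith
    rw [mul_pow]
    have h3 : (2:ℝ) ≤ 2 ^ (K + 1) := by
      simpa using pow_le_pow_right₀ (one_le_two : (1:ℝ) ≤ 2) (Nat.le_add_left 1 K)
    have h4 : (0:ℝ) ≤ ‖z‖ ^ (K + 1) := by positivity
    nlinarith
  obtain ⟨q, rfl⟩ : ∃ q, w = z * q := ⟨w / z, by field_simp⟩
  have e5 : ‖q ^ (K + 1) - 1‖ < c ^ (K + 1) := by
    have h1 : (z * q) ^ (K + 1) - z ^ (K + 1) = z ^ (K + 1) * (q ^ (K + 1) - 1) := by ring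
    rw [h1, norm_mul, norm_pow] at e3
    set A := ‖z‖ ^ (K + 1) with hA
    have hApos : 0 < A := by positivity
    set δ := c ^ (K + 1) / 2 / (1 + 2 ^ (K + 1)) with hδ
    have hδpos : 0 < δ := by positivity
    have h2 : A * ‖q ^ (K + 1) - 1‖ ≤ A * (c ^ (K + 1) / 2) := by
      have h3 : δ * ‖z * q‖ ^ (K + 1) ≤ δ * (2 * ‖z‖) ^ (K + 1) := by gcongr
      rw [mul_pow, ← hA] at h3
      have h4 : δ * (1 + 2 ^ (K + 1)) = c ^ (K + 1) / 2 := by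
        rw [hδ]; field_simp
      have h5 : A * (c ^ (K + 1) / 2) = δ * A + δ * (2 ^ (K + 1) * A) := by rw [← h4]; ring
      linarith
    have h6 := le_of_mul_le_mul_left h2 hApos
    have h7 : 0 < c ^ (K + 1) := by positivity
    linarith
  obtain ⟨ζ, hζ, hqζ⟩ := exists_root_near K.succ_pos hc e5
  refine ⟨ζ, hζ, ?_⟩
  rw [mem_closedBall, dist_eq_norm, ← mul_sub, norm_mul, mul_comm]
  gcongr

end LeadingData

end JCurve

namespace JCurve

open Filter Topology Asymptotics ComplexConjugate
open scoped ContDiff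

variable {F : Type*} [NormedAddCommGroup F] [NormedSpace ℂ F]
variable {J : F → F →L[ℝ] F} {u : ℂ → F} {K : ℕ} {a : F} {l : F →L[ℂ] ℂ}

/-- A local solution `ψ` of `branchFun J l u z (ψ z) = 0` asymptotic to `ζ z`. -/
def IsBranch (J : F → F →L[ℝ] F) (l : F →L[ℂ] ℂ) (u : ℂ → F) (ζ : ℂ) (ψ : ℂ → ℂ) : Prop :=
  (∀ᶠ z in 𝓝 0, branchFun J l u z (ψ z) = 0) ∧
    (fun z => ψ z - z * ζ) =O[𝓝 0] fun z : ℂ => ‖z‖ ^ 2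

theorem differentiableAt_of_implicit {G : ℂ × ℂ → ℂ} {G' : ℂ × ℂ →L[ℝ] ℂ} {ψ : ℂ → ℂ} {z₀ : ℂ}
    (hG : HasFDerivAt G G' (z₀, ψ z₀)) (hinj : ∀ x, G' (0, x) = 0 → x = 0)
    (h0 : ∀ᶠ z in 𝓝 z₀, G (z, ψ z) = 0)
    (hO : (fun z => ψ z - ψ z₀) =O[𝓝 z₀] fun z => z - z₀) : DifferentiableAt ℝ ψ z₀ := by
  let B : ℂ →L[ℝ] ℂ := G'.comp (ContinuousLinearMap.inr ℝ ℂ ℂ)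
  have hB : Function.Injective B.toLinearMap := by
    refine (injective_iff_map_eq_zero _).2 fun x hx => hinj x ?_
    simpa [B] using hx
  let e : ℂ ≃L[ℝ] ℂ := (LinearEquiv.ofInjectiveEndo B.toLinearMap hB).toContinuousLinearEquiv
  have he : ∀ x, e x = G' (0, x) := fun x => by
    change B x = _
    simp [B]
  have h1 : (fun z => (z, ψ z) - (z₀, ψ z₀)) =O[𝓝 z₀] fun z => z - z₀ :=
    (isBigO_refl _ _).prod_left hO
  have hcont : Tendsto (fun z => (z, ψ z)) (𝓝 z₀) (𝓝 (z₀, ψ z₀)) := by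
    have h2 : Tendsto (fun z => z - z₀) (𝓝 z₀) (𝓝 0) := by
      have : ContinuousAt (fun z => z - z₀) z₀ := by fun_prop
      simpa [ContinuousAt] using this
    have h3 := h1.trans_tendsto h2
    exact tendsto_sub_nhds_zero_iff.1 h3
  have h2 := (hG.isLittleO.comp_tendsto hcont).trans_isBigO h1
  have h3 : (fun z => e (ψ z - ψ z₀) + G' (z - z₀, 0)) =o[𝓝 z₀] fun z => z - z₀ := by
    refine (h2.neg_left).congr' ?_ EventuallyEq.rfl
    filter_upwards [h0] with z hz
    simp only [Function.comp, hz, h0.self_of_nhds, he, sub_zero, zero_sub, neg_neg]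
    rw [← map_add]
    simp
  have h4 := ((e.symm : ℂ →L[ℝ] ℂ).isBigO_comp _ _).trans_isLittleO h3
  refine ⟨-((e.symm : ℂ →L[ℝ] ℂ).comp (G'.comp (ContinuousLinearMap.inl ℝ ℂ ℂ))), ?_⟩
  refine HasFDerivAt.of_isLittleO (h4.congr_left fun z => ?_)
  simp

theorem IsBranch.isBigO {ζ : ℂ} {ψ : ℂ → ℂ} (hψ : IsBranch J l u ζ ψ) :
    ψ =O[𝓝 0] fun z : ℂ => ‖z‖ ^ 1 := by
  have h1 := isBigO_norm_pow_of_le hψ.2 one_le_two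
  have h2 : (fun z : ℂ => z * ζ) =O[𝓝 0] fun z : ℂ => ‖z‖ ^ 1 := by
    refine IsBigO.of_bound ‖ζ‖ (Eventually.of_forall fun z => ?_)
    rw [norm_mul, pow_one, norm_norm, mul_comm]
  simpa using h1.add h2

theorem IsBranch.map_zero {ζ : ℂ} {ψ : ℂ → ℂ} (hψ : IsBranch J l u ζ ψ) : ψ 0 = 0 := by
  simpa using hψ.2.eq_zero_imp.self_of_nhds

theorem IsBranch.tendsto {ζ : ℂ} {ψ : ℂ → ℂ} (hψ : IsBranch J l u ζ ψ) :
    Tendsto ψ (𝓝 0) (𝓝 0) := by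
  refine hψ.isBigO.trans_tendsto ?_
  have : ContinuousAt (fun z : ℂ => ‖z‖ ^ 1) 0 := by fun_prop
  simpa [ContinuousAt] using this

namespace LeadingData

theorem exists_isBranch [CompleteSpace F] (h : LeadingData J u K a l) {ζ : ℂ}
    (hζ : ζ ^ (K + 1) = 1) : ∃ ψ, IsBranch J l u ζ ψ := by
  obtain ⟨c, hc, -, ρ, hρ, H⟩ := h.exists_branchFun_near
  obtain ⟨C, hC⟩ := h.branchFun_sub_isBigO.bound
  obtain ⟨ρ₁, hρ₁, hb⟩ := exists_ball_of_eventually_coneFilter hC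
  have hζ1 : ‖ζ‖ = 1 := norm_eq_one_of_pow_succ hζ
  set D := |C| + 1 with hD
  have hDpos : 0 < D := by positivity
  have key : ∀ᶠ z in 𝓝 (0:ℂ), ∃ w ∈ closedBall (z * ζ) (2 * D * ‖z‖ ^ 2),
      branchFun J l u z w = 0 := by
    filter_upwards [ball_mem_nhds (0:ℂ) hρ, ball_mem_nhds (0:ℂ) hρ₁,
      ball_mem_nhds (0:ℂ) (show 0 < c / (2 * D) by positivity)] with z hz hz1 hz2
    rw [mem_ball_zero_iff] at hz hz1 hz2
    rcases eq_or_ne z 0 with rfl | hz0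
    · exact ⟨0, by simp, by simp [branchFun]⟩
    have hz' : 0 < ‖z‖ := norm_pos_iff.2 hz0
    have hle : 2 * D * ‖z‖ ^ 2 ≤ c * ‖z‖ := by
      rw [lt_div_iff₀ (by positivity)] at hz2
      nlinarith
    have hm : ‖((K + 1 : ℕ) * (z * ζ) ^ K : ℂ)‖ = (K + 1) * ‖z‖ ^ K := by
      rw [norm_mul, norm_pow, norm_mul, hζ1, mul_one, Complex.norm_natCast]
      push_cast
      ring
    refine exists_zero_of_norm_sub_le (m := ((K + 1 : ℕ) * (z * ζ) ^ K : ℂ)) ?_ (by positivity)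
      (fun x hx y hy => (H ζ z hζ hz0 hz).2 x (closedBall_subset_closedBall hle hx) y
        (closedBall_subset_closedBall hle hy)) ?_
    · rw [← norm_ne_zero_iff, hm]
      positivity
    · have := hb z (z * ζ) hz1 (by rw [norm_mul, hζ1]; linarith)
      simp only [norm_pow, norm_norm, mul_pow, hζ, mul_one, sub_self, sub_zero] at this
      rw [hm]
      calc _ ≤ C * ‖z‖ ^ (K + 2) := this
        _ ≤ D * ‖z‖ ^ (K + 2) := by
          gcongr
          linarith [le_abs_self C]
        _ = 1 * ‖z‖ ^ K / 2 * (2 * D * ‖z‖ ^ 2) := by ring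
        _ ≤ _ := by
          gcongr
          have : (0:ℝ) ≤ K := by positivity
          linarith
  have key' : ∀ z : ℂ, ∃ w, (∃ w ∈ closedBall (z * ζ) (2 * D * ‖z‖ ^ 2),
      branchFun J l u z w = 0) → w ∈ closedBall (z * ζ) (2 * D * ‖z‖ ^ 2) ∧
      branchFun J l u z w = 0 := fun z => by
    by_cases hz : ∃ w ∈ closedBall (z * ζ) (2 * D * ‖z‖ ^ 2), branchFun J l u z w = 0
    · exact ⟨hz.choose, fun _ => hz.choose_spec⟩
    · exact ⟨0, fun h => (hz h).elim⟩
  choose ψ hψ using key'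
  refine ⟨ψ, key.mono fun z hz => (hψ z hz).2, IsBigO.of_bound (2 * D) (key.mono fun z hz => ?_)⟩
  have := (hψ z hz).1
  rw [mem_closedBall, dist_eq_norm] at this
  simpa using this

theorem exists_near_branch [CompleteSpace F] (h : LeadingData J u K a l) :
    ∃ c > 0, ∀ ζ ψ, ζ ^ (K + 1) = 1 → IsBranch J l u ζ ψ → ∀ᶠ z in 𝓝[≠] (0:ℂ),
      ψ z ∈ closedBall (z * ζ) (c / 2 * ‖z‖) ∧ ∀ w ∈ closedBall (z * ζ) (c * ‖z‖),
        ‖z‖ ^ K * ‖w - ψ z‖ ≤ 2 * ‖branchFun J l u z w‖ ∧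
        ∀ x, ‖z‖ ^ K * ‖x‖ ≤ 2 * ‖lamPart J l u z (fderiv ℝ u w x)‖ := by
  obtain ⟨c, hc, -, ρ, hρ, H⟩ := h.exists_branchFun_near
  refine ⟨c, hc, fun ζ ψ hζ hψ => ?_⟩
  have hζ1 : ‖ζ‖ = 1 := norm_eq_one_of_pow_succ hζ
  have hsm := (isLittleO_norm_pow_of_lt hψ.2 one_lt_two).def (c := c / 2) (by positivity)
  filter_upwards [self_mem_nhdsWithin, nhdsWithin_le_nhds (ball_mem_nhds (0:ℂ) hρ),
    nhdsWithin_le_nhds hsm, nhdsWithin_le_nhds hψ.1] with z hz0 hzρ hz1 hz2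
  rw [mem_ball_zero_iff] at hzρ
  have hz3 : ψ z ∈ closedBall (z * ζ) (c / 2 * ‖z‖) := by
    rw [mem_closedBall, dist_eq_norm]
    simpa using hz1
  refine ⟨hz3, fun w hw => ⟨?_, (H ζ z hζ hz0 hzρ).1 w hw⟩⟩
  have hz4 : ψ z ∈ closedBall (z * ζ) (c * ‖z‖) := by
    refine closedBall_subset_closedBall ?_ hz3
    gcongr
    linarith
  have := (H ζ z hζ hz0 hzρ).2 w hw _ hz4
  rw [hz2, sub_zero] at this
  set m : ℂ := ((K + 1 : ℕ) * (z * ζ) ^ K : ℂ) with hm_def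
  have hm : ‖m‖ = (K + 1) * ‖z‖ ^ K := by
    rw [hm_def, norm_mul, norm_pow, norm_mul, hζ1, mul_one, Complex.norm_natCast]
    push_cast
    ring
  have h1 : ‖m * (w - ψ z)‖ ≤ ‖branchFun J l u z w‖ +
      ‖branchFun J l u z w - m * (w - ψ z)‖ := by
    have := norm_sub_le (branchFun J l u z w) (branchFun J l u z w - m * (w - ψ z))
    simpa using this
  rw [norm_mul] at h1
  have h4 : ‖z‖ ^ K * ‖w - ψ z‖ ≤ ‖m‖ * ‖w - ψ z‖ := by
    rw [hm]
    gcongr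
    refine le_mul_of_one_le_left (by positivity) ?_
    have : (0:ℝ) ≤ K := by positivity
    linarith
  linarith

theorem eventuallyEq_of_isBranch [CompleteSpace F] (h : LeadingData J u K a l) {ζ : ℂ}
    {ψ ψ' : ℂ → ℂ} (hζ : ζ ^ (K + 1) = 1) (hψ : IsBranch J l u ζ ψ) (hψ' : IsBranch J l u ζ ψ') :
    ψ =ᶠ[𝓝 0] ψ' := by
  obtain ⟨c, hc, H⟩ := h.exists_near_branch
  have h1 : ∀ᶠ z in 𝓝[≠] (0:ℂ), ψ z = ψ' z := by
    filter_upwards [H ζ ψ hζ hψ, H ζ ψ' hζ hψ', nhdsWithin_le_nhds hψ'.1, self_mem_nhdsWithin]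
      with z hz hz' hz0 hzne
    have hz'' : 0 < ‖z‖ := norm_pos_iff.2 hzne
    have := (hz.2 (ψ' z) (closedBall_subset_closedBall (by gcongr; linarith) hz'.1)).1
    rw [hz0, norm_zero, mul_zero] at this
    have h2 : ‖ψ' z - ψ z‖ ≤ 0 := by
      by_contra! h3
      have : 0 < ‖z‖ ^ K * ‖ψ' z - ψ z‖ := by positivity
      linarith
    exact (sub_eq_zero.1 (norm_le_zero_iff.1 h2)).symm
  rw [eventually_nhdsWithin_iff] at h1
  filter_upwards [h1] with z hz
  rcases eq_or_ne z 0 with rfl | h0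
  · rw [hψ.map_zero, hψ'.map_zero]
  · exact hz h0

theorem exists_eq_branch [CompleteSpace F] (h : LeadingData J u K a l) {ψ : ℂ → ℂ → ℂ}
    (hψ : ∀ ζ, ζ ^ (K + 1) = 1 → IsBranch J l u ζ (ψ ζ)) :
    ∃ ρ > 0, ∀ z w : ℂ, z ≠ 0 → ‖z‖ < ρ → ‖w‖ < ρ → u w = u z →
      ∃ ζ : ℂ, ζ ^ (K + 1) = 1 ∧ w = ψ ζ z := by
  obtain ⟨c, hc, H⟩ := h.exists_near_branch
  obtain ⟨ρ₀, hρ₀, H₀⟩ := h.exists_root_of_eq hc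
  have h1 : ∀ᶠ z in 𝓝[≠] (0:ℂ), ∀ ζ ∈ Polynomial.nthRootsFinset (K + 1) (1:ℂ),
      ∀ w ∈ closedBall (z * ζ) (c * ‖z‖), branchFun J l u z w = 0 → w = ψ ζ z := by
    rw [eventually_all_finset]
    intro ζ hζ
    rw [Polynomial.mem_nthRootsFinset K.succ_pos] at hζ
    filter_upwards [H ζ _ hζ (hψ ζ hζ), self_mem_nhdsWithin] with z hz hzne w hw hw0
    have hz'' : 0 < ‖z‖ := norm_pos_iff.2 hzne
    have := (hz.2 w hw).1
    rw [hw0, norm_zero, mul_zero] at this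
    have h2 : ‖w - ψ ζ z‖ ≤ 0 := by
      by_contra! h3
      have : 0 < ‖z‖ ^ K * ‖w - ψ ζ z‖ := by positivity
      linarith
    exact (sub_eq_zero.1 (norm_le_zero_iff.1 h2))
  rw [eventually_nhdsWithin_iff] at h1
  obtain ⟨ρ₁, hρ₁, H₁⟩ := Metric.eventually_nhds_iff_ball.1 h1
  refine ⟨min ρ₀ ρ₁, by positivity, fun z w hz hzρ hwρ huw => ?_⟩
  rw [lt_min_iff] at hzρ hwρ
  obtain ⟨ζ, hζ, hw⟩ := H₀ z w hz hzρ.1 hwρ.1 huw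
  refine ⟨ζ, hζ, H₁ z (mem_ball_zero_iff.2 hzρ.2) hz ζ
    ((Polynomial.mem_nthRootsFinset K.succ_pos _).2 hζ) w hw ?_⟩
  simp [branchFun, huw]

theorem isBranch_differentiable [CompleteSpace F] (h : LeadingData J u K a l) {ζ : ℂ}
    {ψ : ℂ → ℂ} (hζ : ζ ^ (K + 1) = 1) (hψ : IsBranch J l u ζ ψ) :
    ∀ᶠ z in 𝓝[≠] (0:ℂ), DifferentiableAt ℝ ψ z ∧ ∀ x,
      lamPart J l u z (fderiv ℝ u (ψ z) (fderiv ℝ ψ z x)) =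
        lamPart J l u z (fderiv ℝ u z x) - fderiv ℝ (lamPart J l u) z x (u (ψ z) - u z) := by
  obtain ⟨c, hc, H⟩ := h.exists_near_branch
  have hH := H ζ ψ hζ hψ
  have hcurve : ∀ᶠ z in 𝓝[≠] (0:ℂ), DifferentiableAt ℝ u z :=
    nhdsWithin_le_nhds (h.curve.mono fun z hz => hz.1.differentiableAt (by simp))
  have hcurve' : ∀ᶠ z in 𝓝[≠] (0:ℂ), DifferentiableAt ℝ u (ψ z) :=
    nhdsWithin_le_nhds (hψ.tendsto.eventually
      (h.curve.mono fun z hz => hz.1.differentiableAt (by simp)))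
  have hlam : ∀ᶠ z in 𝓝[≠] (0:ℂ), DifferentiableAt ℝ (lamPart J l u) z :=
    nhdsWithin_le_nhds (h.smoothGerm_lamPart.mono fun z hz => hz.differentiableAt (by simp))
  have open' : ∀ {p : ℂ → Prop}, (∀ᶠ z in 𝓝[≠] (0:ℂ), p z) →
      ∀ᶠ z in 𝓝[≠] (0:ℂ), ∀ᶠ y in 𝓝 z, p y := by
    intro p hp
    have := eventually_eventually_nhdsWithin.2 hp
    filter_upwards [this, self_mem_nhdsWithin] with z hz hz0
    rwa [IsOpen.nhdsWithin_eq isOpen_compl_singleton hz0] at hz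
  filter_upwards [hH, open' hH, hcurve, hcurve', hlam, open' (nhdsWithin_le_nhds hψ.1),
    self_mem_nhdsWithin] with z₀ hz₀ hnear hd hd' hl hG hz0
  have hz' : 0 < ‖z₀‖ := norm_pos_iff.2 hz0
  let G : ℂ × ℂ → ℂ := fun p => branchFun J l u p.1 p.2
  have hfst : HasFDerivAt (fun p : ℂ × ℂ => lamPart J l u p.1)
      ((fderiv ℝ (lamPart J l u) z₀).comp (ContinuousLinearMap.fst ℝ ℂ ℂ)) (z₀, ψ z₀) :=
    HasFDerivAt.comp (z₀, ψ z₀) (g := lamPart J l u) hl.hasFDerivAt hasFDerivAt_fst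
  have hsnd : HasFDerivAt (fun p : ℂ × ℂ => u p.2 - u p.1)
      ((fderiv ℝ u (ψ z₀)).comp (ContinuousLinearMap.snd ℝ ℂ ℂ) -
        (fderiv ℝ u z₀).comp (ContinuousLinearMap.fst ℝ ℂ ℂ)) (z₀, ψ z₀) :=
    (HasFDerivAt.comp (z₀, ψ z₀) (g := u) hd'.hasFDerivAt hasFDerivAt_snd).sub
      (HasFDerivAt.comp (z₀, ψ z₀) (g := u) hd.hasFDerivAt hasFDerivAt_fst)
  have hGd := hfst.clm_apply hsnd
  have hψd : DifferentiableAt ℝ ψ z₀ := by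
    refine differentiableAt_of_implicit (G := G) hGd ?_ hG ?_
    · intro x hx
      have := (hz₀.2 (ψ z₀) (closedBall_subset_closedBall (by gcongr; linarith) hz₀.1)).2 x
      have hx' : lamPart J l u z₀ (fderiv ℝ u (ψ z₀) x) = 0 := by simpa using hx
      rw [hx', norm_zero, mul_zero] at this
      by_contra h3
      have h4 : 0 < ‖x‖ := norm_pos_iff.2 h3
      have : 0 < ‖z₀‖ ^ K * ‖x‖ := by positivity
      linarith
    · have h1 : (fun z => G (z, ψ z₀) - G (z₀, ψ z₀)) =O[𝓝 z₀] fun z => z - z₀ := by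
        have : HasFDerivAt (fun z => G (z, ψ z₀)) _ z₀ :=
          HasFDerivAt.comp z₀ (f := fun z => (z, ψ z₀)) hGd (hasFDerivAt_prodMk_left z₀ (ψ z₀))
        exact this.isBigO_sub
      rw [show G (z₀, ψ z₀) = 0 from hG.self_of_nhds] at h1
      simp only [sub_zero] at h1
      refine IsBigO.trans (IsBigO.of_bound (2 / (‖z₀‖ / 2) ^ K) ?_) h1
      have e1 : ∀ᶠ z in 𝓝 z₀, ψ z₀ ∈ closedBall (z * ζ) (c * ‖z‖) := by
        have : ContinuousAt (fun z => c * ‖z‖ - ‖ψ z₀ - z * ζ‖) z₀ := by fun_prop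
        have h2 : 0 < c * ‖z₀‖ - ‖ψ z₀ - z₀ * ζ‖ := by
          have := hz₀.1
          rw [mem_closedBall, dist_eq_norm] at this
          have : 0 < c * ‖z₀‖ := by positivity
          linarith
        filter_upwards [this.eventually (lt_mem_nhds h2)] with z hz
        rw [mem_closedBall, dist_eq_norm]
        linarith
      have e2 : ∀ᶠ z in 𝓝 z₀, ‖z₀‖ / 2 < ‖z‖ :=
        (continuous_norm.continuousAt (x := z₀)).eventually
          (lt_mem_nhds (show ‖z₀‖ / 2 < ‖z₀‖ by linarith))
      filter_upwards [hnear, e1, e2] with z hz hz1 hz2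
      have h3 := (hz.2 _ hz1).1
      have h4 : (‖z₀‖ / 2) ^ K * ‖ψ z₀ - ψ z‖ ≤ ‖z‖ ^ K * ‖ψ z₀ - ψ z‖ := by gcongr
      rw [norm_sub_rev, div_mul_eq_mul_div, le_div_iff₀ (by positivity), mul_comm]
      exact h4.trans h3
  refine ⟨hψd, fun x => ?_⟩
  have h1 : HasFDerivAt (fun z => G (z, ψ z)) _ z₀ :=
    HasFDerivAt.comp z₀ (f := fun z => (z, ψ z)) hGd ((hasFDerivAt_id z₀).prodMk hψd.hasFDerivAt)
  have h2 : HasFDerivAt (fun z => G (z, ψ z)) (0 : ℂ →L[ℝ] ℂ) z₀ :=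
    (hasFDerivAt_const (0:ℂ) z₀).congr_of_eventuallyEq hG
  have h3 := DFunLike.congr_fun (h1.unique h2) x
  simp at h3
  rw [map_sub (fderiv ℝ (lamPart J l u) z₀ x)]
  linear_combination h3

theorem isBranch_fderiv_bound [CompleteSpace F] (h : LeadingData J u K a l) {ζ : ℂ}
    {ψ : ℂ → ℂ} (hζ : ζ ^ (K + 1) = 1) (hψ : IsBranch J l u ζ ψ) :
    ∃ C, ∀ᶠ z in 𝓝[≠] (0:ℂ), ∀ x, ‖fderiv ℝ ψ z x‖ ≤ C * ‖x‖ := by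
  obtain ⟨c, hc, H⟩ := h.exists_near_branch
  obtain ⟨C₁, hC₁⟩ := h.fderiv_isBigO.bound
  obtain ⟨C₂, hC₂⟩ := (h.smoothGerm_lamPart.self_of_nhds.continuousAt.tendsto.isBigO_one ℝ).bound
  obtain ⟨C₃, hC₃⟩ :=
    (h.smoothGerm_lamPart.fderiv.self_of_nhds.continuousAt.tendsto.isBigO_one ℝ).bound
  have h4 : (fun z => u (ψ z) - u z) =O[𝓝 0] fun z : ℂ => ‖z‖ ^ K := by
    refine isBigO_norm_pow_of_le (M := K + 1) ?_ (Nat.le_succ K)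
    refine IsBigO.sub ((h.curve_isBigO.comp_tendsto hψ.tendsto).trans ?_) h.curve_isBigO
    simpa [Function.comp_def] using (hψ.isBigO.norm_left.pow (K + 1))
  obtain ⟨C₄, hC₄⟩ := h4.bound
  refine ⟨2 * (C₂ * |C₁| + C₃ * |C₄|), ?_⟩
  filter_upwards [H ζ ψ hζ hψ, h.isBranch_differentiable hζ hψ, nhdsWithin_le_nhds hC₁,
    nhdsWithin_le_nhds hC₂, nhdsWithin_le_nhds hC₃, nhdsWithin_le_nhds hC₄, self_mem_nhdsWithin]
    with z hz hd h1 h2 h3 h4 hz0 x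
  have hz' : 0 < ‖z‖ := norm_pos_iff.2 hz0
  simp only [norm_pow, norm_norm, norm_one, mul_one] at h1 h2 h3 h4
  have hC2 : 0 ≤ C₂ := (norm_nonneg _).trans h2
  have hC3 : 0 ≤ C₃ := (norm_nonneg _).trans h3
  have e1 := (hz.2 (ψ z) (closedBall_subset_closedBall (by gcongr; linarith) hz.1)).2
    (fderiv ℝ ψ z x)
  rw [hd.2 x] at e1
  have e2 : ‖lamPart J l u z (fderiv ℝ u z x)‖ ≤ C₂ * ((|C₁| * ‖z‖ ^ K) * ‖x‖) := by
    refine ((lamPart J l u z).le_opNorm _).trans ?_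
    gcongr
    refine ((fderiv ℝ u z).le_opNorm _).trans ?_
    gcongr
    exact h1.trans (by gcongr; exact le_abs_self _)
  have e3 : ‖fderiv ℝ (lamPart J l u) z x (u (ψ z) - u z)‖ ≤ C₃ * ‖x‖ * (|C₄| * ‖z‖ ^ K) := by
    refine (ContinuousLinearMap.le_opNorm _ _).trans ?_
    gcongr
    · refine ((fderiv ℝ (lamPart J l u) z).le_opNorm _).trans ?_
      gcongr
    · exact h4.trans (by gcongr; exact le_abs_self _)
  have e4 := norm_sub_le (lamPart J l u z (fderiv ℝ u z x))
    (fderiv ℝ (lamPart J l u) z x (u (ψ z) - u z))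
  have e5 : ‖z‖ ^ K * ‖fderiv ℝ ψ z x‖ ≤ ‖z‖ ^ K * (2 * (C₂ * |C₁| + C₃ * |C₄|) * ‖x‖) := by
    refine e1.trans ?_
    calc _ ≤ 2 * (C₂ * ((|C₁| * ‖z‖ ^ K) * ‖x‖) + C₃ * ‖x‖ * (|C₄| * ‖z‖ ^ K)) := by linarith
      _ = _ := by ring
  exact le_of_mul_le_mul_left e5 (by positivity)

end LeadingData

end JCurve

namespace JCurve

open Filter Topology Asymptotics ComplexConjugate
open scoped ContDiff

variable {F : Type*} [NormedAddCommGroup F] [NormedSpace ℂ F]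
variable {J : F → F →L[ℝ] F} {u : ℂ → F} {K : ℕ} {a : F} {l : F →L[ℂ] ℂ}

/-- The linear part of `J` applied to the defect `u ∘ ψ - u`. -/
noncomputable def branchDefect (J : F → F →L[ℝ] F) (u : ℂ → F) (ψ : ℂ → ℂ) (z : ℂ) : F :=
  linPart J (u z) (u (ψ z) - u z)

namespace LeadingData

theorem eventually_norm_linPart_sub_le (h : LeadingData J u K a l) :
    ∀ᶠ z in 𝓝 (0:ℂ), ‖linPart J (u z) - ContinuousLinearMap.id ℝ F‖ ≤ 1 / 2 := by
  have h1 := (isBigO_norm_pow_of_le h.linPart_sub_isBigO (Nat.le_add_left 1 K))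
  have h2 : Tendsto (fun z : ℂ => ‖z‖ ^ 1) (𝓝 0) (𝓝 0) := by
    have : ContinuousAt (fun z : ℂ => ‖z‖ ^ 1) 0 := by fun_prop
    simpa [ContinuousAt] using this
  have h3 := (h1.trans_tendsto h2).norm
  rw [norm_zero] at h3
  exact h3.eventually_le_const (by norm_num)

theorem norm_le_branchDefect {z : ℂ} (ψ : ℂ → ℂ)
    (hz : ‖linPart J (u z) - ContinuousLinearMap.id ℝ F‖ ≤ 1 / 2) :
    ‖u (ψ z) - u z‖ ≤ 2 * ‖branchDefect J u ψ z‖ := by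
  have h1 := ((linPart J (u z) - ContinuousLinearMap.id ℝ F).le_opNorm (u (ψ z) - u z)).trans
    (mul_le_mul_of_nonneg_right hz (norm_nonneg _))
  have h2 := norm_sub_le (branchDefect J u ψ z)
    ((linPart J (u z) - ContinuousLinearMap.id ℝ F) (u (ψ z) - u z))
  have h3 : branchDefect J u ψ z -
      ((linPart J (u z) - ContinuousLinearMap.id ℝ F) (u (ψ z) - u z)) = u (ψ z) - u z := by
    simp [branchDefect]
  rw [h3] at h2
  linarith

theorem exists_dbar_branchDefect [CompleteSpace F] (h : LeadingData J u K a l) {ζ : ℂ}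
    {ψ : ℂ → ℂ} (hζ : ζ ^ (K + 1) = 1) (hψ : IsBranch J l u ζ ψ) :
    ∃ C, ∀ᶠ z in 𝓝[≠] (0:ℂ), DifferentiableAt ℝ (branchDefect J u ψ) z ∧
      ‖dbar (branchDefect J u ψ) z‖ ≤ C * ‖u (ψ z) - u z‖ ∧
      ‖z‖ ^ K * ‖dbar ψ z‖ ≤ C * ‖u (ψ z) - u z‖ := by
  obtain ⟨c, hc, H⟩ := h.exists_near_branch
  obtain ⟨C₁, hC₁⟩ := ((h.fderiv_isBigO.comp_tendsto hψ.tendsto).trans (by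
    simpa [Function.comp_def] using (hψ.isBigO.norm_left.pow K) :
    ((fun z : ℂ => ‖z‖ ^ K) ∘ ψ) =O[𝓝 0] fun z : ℂ => ‖z‖ ^ K)).bound
  obtain ⟨C₃, hC₃⟩ :=
    (h.smoothGerm_linPart.fderiv.self_of_nhds.continuousAt.tendsto.isBigO_one ℝ).bound
  obtain ⟨C₅, hC₅⟩ := h.isBranch_fderiv_bound hζ hψ
  obtain ⟨L, t, ht, hL⟩ := ((h.smooth.contDiffAt (x := (0:F))).of_le
    (by simp : (1 : WithTop ℕ∞) ≤ ∞)).exists_lipschitzOnWith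
  have hu0 : Tendsto u (𝓝 0) (𝓝 0) := by
    simpa [h.curve_zero] using h.curve.continuousAt.tendsto
  let M : ℝ := 2 * |C₃| + 2 * (L * (|C₁| * |C₅|))
  have hM : 0 ≤ M := by positivity
  refine ⟨(2 * |C₁| * (2 * ‖l‖) + 1 + 2 * ‖l‖) * M, ?_⟩
  have open' : ∀ᶠ z in 𝓝[≠] (0:ℂ), ∀ᶠ y in 𝓝 z, branchFun J l u y (ψ y) = 0 :=
    nhdsWithin_le_nhds (eventually_eventually_nhds.2 hψ.1)
  filter_upwards [H ζ ψ hζ hψ, h.isBranch_differentiable hζ hψ, nhdsWithin_le_nhds hC₁,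
    nhdsWithin_le_nhds hC₃, hC₅, nhdsWithin_le_nhds (hu0 ht),
    nhdsWithin_le_nhds (hψ.tendsto.eventually (hu0 ht)), nhdsWithin_le_nhds h.curve,
    nhdsWithin_le_nhds (hψ.tendsto.eventually h.curve), open',
    nhdsWithin_le_nhds h.eventually_norm_linPart_sub_le,
    nhdsWithin_le_nhds (h.smoothGerm_linPart), self_mem_nhdsWithin,
    nhdsWithin_le_nhds (ball_mem_nhds (0:ℂ) one_pos)]
    with z hz hd h1 h3 h5 ht1 ht2 hu hu' hG hid hΦ hz0 hzb
  rw [mem_ball_zero_iff] at hzb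
  have hz' : 0 < ‖z‖ := norm_pos_iff.2 hz0
  simp only [Function.comp, norm_pow, norm_norm, norm_one, mul_one] at h1 h3
  replace h1 : ‖fderiv ℝ u (ψ z)‖ ≤ |C₁| * ‖z‖ ^ K := h1.trans (by gcongr; exact le_abs_self _)
  have h1' : ‖fderiv ℝ u (ψ z)‖ ≤ |C₁| :=
    h1.trans (mul_le_of_le_one_right (abs_nonneg _) (pow_le_one₀ (norm_nonneg _) hzb.le))
  replace h3 : ‖fderiv ℝ (fun z => linPart J (u z)) z‖ ≤ |C₃| := h3.trans (le_abs_self _)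
  set Φ := fun z => linPart J (u z) with hΦdef
  have hΦn : ‖Φ z‖ ≤ 2 := by
    have e1 := norm_add_le (linPart J (u z) - ContinuousLinearMap.id ℝ F)
      (ContinuousLinearMap.id ℝ F)
    have e2 := ContinuousLinearMap.norm_id_le (𝕜 := ℝ) (E := F)
    rw [sub_add_cancel] at e1
    simp only [hΦdef]
    linarith
  have hΦd : DifferentiableAt ℝ Φ z := hΦ.differentiableAt (by simp)
  have hud : HasFDerivAt u (fderiv ℝ u z) z := (hu.1.differentiableAt (by simp)).hasFDerivAt
  have hud' : HasFDerivAt u (fderiv ℝ u (ψ z)) (ψ z) :=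
    (hu'.1.differentiableAt (by simp)).hasFDerivAt
  have hθ : HasFDerivAt (branchDefect J u ψ) _ z :=
    hΦd.hasFDerivAt.clm_apply ((hud'.comp z hd.1.hasFDerivAt).sub hud)
  set η := u (ψ z) - u z with hη
  set D := fderiv ℝ ψ z with hD
  set R : F := (fderiv ℝ Φ z 1 η + I • fderiv ℝ Φ z I η) +
    Φ z ((J (u z) - J (u (ψ z))) (fderiv ℝ u (ψ z) (D I))) with hR
  have hθ' : ∀ x, fderiv ℝ (branchDefect J u ψ) z x =
      Φ z (fderiv ℝ u (ψ z) (D x)) - Φ z (fderiv ℝ u z x) + fderiv ℝ Φ z x η := by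
    intro x
    rw [hθ.fderiv]
    simp [hη, hD]
  have hIΦ : ∀ y, I • Φ z y = Φ z (J (u z) y) := fun y => (linPart_J h.sq _ _).symm
  have hτ : fderiv ℝ u (ψ z) (dbar ψ z) =
      fderiv ℝ u (ψ z) (D 1) + J (u (ψ z)) (fderiv ℝ u (ψ z) (D I)) := by
    rw [← fderiv_I_mul h.sq hu'.2, ← map_add]
    rfl
  have hid1 : dbar (branchDefect J u ψ) z = Φ z (fderiv ℝ u (ψ z) (dbar ψ z)) + R := by
    have hzero : Φ z (fderiv ℝ u z 1) = - Φ z (J (u z) (fderiv ℝ u z I)) := by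
      rw [← map_neg, ← eq_neg_of_add_eq_zero_left hu.2]
    rw [dbar, hθ', hθ', smul_add, smul_sub, hIΦ, hIΦ, hτ, hR, sub_apply,
      map_sub (Φ z), map_add, hzero]
    abel
  have hRn : ‖R‖ ≤ M * ‖η‖ := by
    have hLip : ‖J (u z) - J (u (ψ z))‖ ≤ L * ‖η‖ := by
      have := hL.dist_le_mul _ ht1 _ ht2
      rwa [dist_eq_norm, dist_eq_norm, norm_sub_rev (u z)] at this
    have e : ∀ x : ℂ, ‖x‖ = 1 → ‖fderiv ℝ Φ z x η‖ ≤ |C₃| * ‖η‖ := by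
      intro x hx
      refine (ContinuousLinearMap.le_opNorm _ _).trans ?_
      gcongr
      refine ((fderiv ℝ Φ z).le_opNorm _).trans ?_
      rwa [hx, mul_one]
    have e1 := e 1 norm_one
    have e2 : ‖I • fderiv ℝ Φ z I η‖ ≤ |C₃| * ‖η‖ := by
      rw [norm_smul, norm_I, one_mul]
      exact e I norm_I
    have e3 : ‖Φ z ((J (u z) - J (u (ψ z))) (fderiv ℝ u (ψ z) (D I)))‖ ≤
        2 * ((L * ‖η‖) * (|C₁| * |C₅|)) := by
      refine (ContinuousLinearMap.le_opNorm _ _).trans ?_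
      gcongr
      refine (ContinuousLinearMap.le_opNorm _ _).trans ?_
      gcongr
      refine (ContinuousLinearMap.le_opNorm _ _).trans ?_
      gcongr
      have := h5 I
      rw [norm_I, mul_one] at this
      exact this.trans (le_abs_self _)
    calc ‖R‖ ≤ _ := norm_add_le _ _
      _ ≤ (|C₃| * ‖η‖ + |C₃| * ‖η‖) + 2 * ((L * ‖η‖) * (|C₁| * |C₅|)) :=
        add_le_add ((norm_add_le _ _).trans (add_le_add e1 e2)) e3
      _ = M * ‖η‖ := by simp only [M]; ring
  have hl0 : l (dbar (branchDefect J u ψ) z) = 0 := by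
    rw [← dbar_clm_comp l hθ.differentiableAt]
    have : (fun y => l (branchDefect J u ψ y)) =ᶠ[𝓝 z] fun _ => (0:ℂ) := hG
    rw [dbar, this.fderiv_eq]
    simp
  have hτn : ‖z‖ ^ K * ‖dbar ψ z‖ ≤ 2 * ‖l‖ * (M * ‖η‖) := by
    have e1 := (hz.2 (ψ z) (closedBall_subset_closedBall (by gcongr; linarith) hz.1)).2 (dbar ψ z)
    have e2 : lamPart J l u z (fderiv ℝ u (ψ z) (dbar ψ z)) = - l R := by
      rw [hid1, map_add] at hl0
      exact eq_neg_of_add_eq_zero_left hl0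
    rw [e2, norm_neg] at e1
    refine e1.trans ?_
    rw [mul_assoc]
    gcongr
    exact (l.le_opNorm R).trans (by gcongr)
  refine ⟨hθ.differentiableAt, ?_, ?_⟩
  · rw [hid1]
    have e1 : ‖Φ z (fderiv ℝ u (ψ z) (dbar ψ z))‖ ≤ 2 * |C₁| * (2 * ‖l‖ * (M * ‖η‖)) := by
      calc _ ≤ 2 * ((|C₁| * ‖z‖ ^ K) * ‖dbar ψ z‖) := by
            refine (ContinuousLinearMap.le_opNorm _ _).trans ?_
            gcongr
            refine (ContinuousLinearMap.le_opNorm _ _).trans ?_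
            gcongr
        _ = 2 * |C₁| * (‖z‖ ^ K * ‖dbar ψ z‖) := by ring
        _ ≤ _ := by gcongr
    have e2 : 0 ≤ 2 * ‖l‖ * M * ‖η‖ := by positivity
    calc _ ≤ _ := norm_add_le _ _
      _ ≤ _ := by linarith
  · refine hτn.trans ?_
    have e2 : 0 ≤ 2 * |C₁| * (2 * ‖l‖) * M * ‖η‖ := by positivity
    have e3 : 0 ≤ M * ‖η‖ := by positivity
    linarith

theorem isBranch_eq_or_ne [CompleteSpace F] (h : LeadingData J u K a l) {ζ : ℂ}
    {ψ : ℂ → ℂ} (hζ : ζ ^ (K + 1) = 1) (hψ : IsBranch J l u ζ ψ) :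
    (∀ᶠ z in 𝓝 (0:ℂ), u (ψ z) = u z) ∨ ∀ᶠ z in 𝓝[≠] (0:ℂ), u (ψ z) ≠ u z := by
  by_cases hne : ∀ᶠ z in 𝓝[≠] (0:ℂ), u (ψ z) ≠ u z
  · exact Or.inr hne
  left
  have hfr : ∃ᶠ z in 𝓝[≠] (0:ℂ), branchDefect J u ψ z = 0 := by
    refine (not_eventually.1 hne).mono fun z hz => ?_
    rw [not_not] at hz
    rw [branchDefect, hz, sub_self, map_zero]
  obtain ⟨C, hC⟩ := h.exists_dbar_branchDefect hζ hψ
  have hcont : ContinuousAt (branchDefect J u ψ) 0 := by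
    have h1 : ContinuousAt (fun z => linPart J (u z)) 0 :=
      h.smoothGerm_linPart.self_of_nhds.continuousAt
    have h2 : ContinuousAt ψ 0 := by
      rw [ContinuousAt, hψ.map_zero]
      exact hψ.tendsto
    have h3 : ContinuousAt (fun z => u (ψ z)) 0 :=
      ContinuousAt.comp (by rw [hψ.map_zero]; exact h.curve.continuousAt) h2
    exact h1.clm_apply (h3.sub h.curve.continuousAt)
  have hb : ∀ᶠ z in 𝓝[≠] (0:ℂ), DifferentiableAt ℝ (branchDefect J u ψ) z ∧
      ‖dbar (branchDefect J u ψ) z‖ ≤ (2 * |C|) * ‖branchDefect J u ψ z‖ := by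
    filter_upwards [hC, nhdsWithin_le_nhds h.eventually_norm_linPart_sub_le] with z hz hz1
    refine ⟨hz.1, hz.2.1.trans ?_⟩
    calc _ ≤ |C| * ‖u (ψ z) - u z‖ := by gcongr; exact le_abs_self _
      _ ≤ |C| * (2 * ‖branchDefect J u ψ z‖) := by
        gcongr
        exact norm_le_branchDefect ψ hz1
      _ = _ := by ring
  filter_upwards [eventually_eq_zero_of_dbar_le hcont hb (Or.inr hfr),
    h.eventually_norm_linPart_sub_le] with z hz hz1
  have := norm_le_branchDefect ψ hz1
  rw [hz, norm_zero, mul_zero] at this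
  exact sub_eq_zero.1 (norm_le_zero_iff.1 this)

theorem isBranch_holomorphic [CompleteSpace F] (h : LeadingData J u K a l) {ζ : ℂ}
    {ψ : ℂ → ℂ} (hζ : ζ ^ (K + 1) = 1) (hψ : IsBranch J l u ζ ψ)
    (heq : ∀ᶠ z in 𝓝 (0:ℂ), u (ψ z) = u z) :
    (∀ᶠ z in 𝓝 (0:ℂ), DifferentiableAt ℂ ψ z) ∧ HasDerivAt ψ ζ 0 := by
  have h0 : HasDerivAt ψ ζ 0 := by
    rw [hasDerivAt_iff_isLittleO]
    have := isLittleO_norm_pow_of_lt hψ.2 one_lt_two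
    simp only [pow_one] at this
    simpa [hψ.map_zero] using this.of_norm_right
  obtain ⟨C, hC⟩ := h.exists_dbar_branchDefect hζ hψ
  have h1 : ∀ᶠ z in 𝓝[≠] (0:ℂ), DifferentiableAt ℂ ψ z := by
    filter_upwards [hC, nhdsWithin_le_nhds heq, h.isBranch_differentiable hζ hψ,
      self_mem_nhdsWithin] with z hz hz1 hz2 hz0
    have hz' : 0 < ‖z‖ := norm_pos_iff.2 hz0
    have e1 := hz.2.2
    rw [hz1, sub_self, norm_zero, mul_zero] at e1
    have e2 : dbar ψ z = 0 := by
      by_contra h3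
      have : 0 < ‖dbar ψ z‖ := norm_pos_iff.2 h3
      have : 0 < ‖z‖ ^ K * ‖dbar ψ z‖ := by positivity
      linarith
    refine differentiableAt_complex_iff_differentiableAt_real.2 ⟨hz2.1, ?_⟩
    rw [dbar] at e2
    have e3 : fderiv ℝ ψ z 1 = - (I • fderiv ℝ ψ z I) := eq_neg_of_add_eq_zero_left e2
    rw [e3, smul_neg, smul_smul, I_mul_I, neg_one_smul, neg_neg]
  refine ⟨?_, h0⟩
  rw [eventually_nhdsWithin_iff] at h1
  filter_upwards [h1] with z hz
  rcases eq_or_ne z 0 with rfl | hne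
  · exact h0.differentiableAt
  · exact hz hne

end LeadingData

end JCurve

namespace JCurve

open Filter Topology Asymptotics ComplexConjugate
open scoped ContDiff

variable {F : Type*} [NormedAddCommGroup F] [NormedSpace ℂ F]
variable {J : F → F →L[ℝ] F} {u : ℂ → F} {K : ℕ} {a : F} {l : F →L[ℂ] ℂ}

theorem eq_nthRootsFinset_of_mul_mem {Γ : Finset ℂ} (h1 : 1 ∈ Γ) (h0 : ∀ ζ ∈ Γ, ζ ≠ 0)
    (hmul : ∀ ζ ∈ Γ, ∀ ξ ∈ Γ, ζ * ξ ∈ Γ) : Γ = Polynomial.nthRootsFinset Γ.card (1:ℂ) := by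
  have hpos : 0 < Γ.card := Finset.card_pos.2 ⟨1, h1⟩
  refine Finset.eq_of_subset_of_card_le (fun ζ hζ => ?_) ?_
  · rw [Polynomial.mem_nthRootsFinset hpos]
    have hinj : Set.InjOn (fun ξ => ζ * ξ) Γ := fun x _ y _ hxy => mul_left_cancel₀ (h0 ζ hζ) hxy
    have himg : Γ.image (fun ξ => ζ * ξ) = Γ := by
      refine Finset.eq_of_subset_of_card_le (fun x hx => ?_) ?_
      · obtain ⟨y, hy, rfl⟩ := Finset.mem_image.1 hx
        exact hmul ζ hζ y hy
      · rw [Finset.card_image_of_injOn hinj]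
    have hprod : ∏ ξ ∈ Γ, ζ * ξ = ∏ ξ ∈ Γ, ξ := by
      conv_rhs => rw [← himg]
      rw [Finset.prod_image hinj]
    rw [Finset.prod_mul_distrib, Finset.prod_const] at hprod
    exact mul_eq_right₀ (Finset.prod_ne_zero_iff.2 h0) |>.1 hprod
  · rw [(Complex.isPrimitiveRoot_exp _ hpos.ne').card_nthRootsFinset]

namespace LeadingData

theorem isBranch_id : IsBranch J l u 1 fun z => z :=
  ⟨Eventually.of_forall fun z => by simp [branchFun], by
    simpa using isBigO_zero (fun z : ℂ => ‖z‖ ^ 2) (𝓝 (0:ℂ))⟩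

theorem isBranch_comp {ζ ξ : ℂ} {ψ χ : ℂ → ℂ} (hψ : IsBranch J l u ζ ψ) (hχ : IsBranch J l u ξ χ)
    (hψu : ∀ᶠ z in 𝓝 (0:ℂ), u (ψ z) = u z) (hχu : ∀ᶠ z in 𝓝 (0:ℂ), u (χ z) = u z) :
    IsBranch J l u (ζ * ξ) (fun z => ψ (χ z)) ∧ ∀ᶠ z in 𝓝 (0:ℂ), u (ψ (χ z)) = u z := by
  have hu : ∀ᶠ z in 𝓝 (0:ℂ), u (ψ (χ z)) = u z := by
    filter_upwards [hχ.tendsto.eventually hψu, hχu] with z h1 h2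
    rw [h1, h2]
  refine ⟨⟨hu.mono fun z hz => by simp [branchFun, hz], ?_⟩, hu⟩
  have h1 : (fun z => ψ (χ z) - χ z * ζ) =O[𝓝 0] fun z : ℂ => ‖z‖ ^ 2 := by
    refine (hψ.2.comp_tendsto hχ.tendsto).trans ?_
    simpa [Function.comp_def] using hχ.isBigO.norm_left.pow 2
  have h2 : (fun z => ζ * (χ z - z * ξ)) =O[𝓝 0] fun z : ℂ => ‖z‖ ^ 2 := hχ.2.const_mul_left ζ
  refine (h1.add h2).congr_left fun z => ?_
  ring

/-- A curve with leading data is, in a suitable holomorphic coordinate `ξ = g z`, exactly invariant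
under the `m`-th roots of unity, and has no other coincidences. -/
theorem exists_coordinate [CompleteSpace F] (h : LeadingData J u K a l) :
    ∃ m : ℕ, 0 < m ∧ ∃ g H : ℂ → ℂ, AnalyticAt ℂ g 0 ∧ AnalyticAt ℂ H 0 ∧ g 0 = 0 ∧ H 0 = 0 ∧
      (∀ᶠ z in 𝓝 0, H (g z) = z) ∧ (∀ᶠ z in 𝓝 0, g (H z) = z) ∧
      ∃ ρ > 0, ∀ ζ ξ : ℂ, ‖ζ‖ < ρ → ‖ξ‖ < ρ → (u (H ζ) = u (H ξ) ↔ ζ ^ m = ξ ^ m) := by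
  classical
  have hex : ∀ ζ : ℂ, ∃ ψ, ζ ^ (K + 1) = 1 → IsBranch J l u ζ ψ := fun ζ => by
    by_cases hζ : ζ ^ (K + 1) = 1
    · obtain ⟨ψ, hψ⟩ := h.exists_isBranch hζ
      exact ⟨ψ, fun _ => hψ⟩
    · exact ⟨0, fun h => (hζ h).elim⟩
  choose ψ hψ using hex
  let Γ : Finset ℂ := (Polynomial.nthRootsFinset (K + 1) (1:ℂ)).filter
    fun ζ => ∀ᶠ z in 𝓝 (0:ℂ), u (ψ ζ z) = u z
  have hΓ : ∀ ζ, ζ ∈ Γ ↔ ζ ^ (K + 1) = 1 ∧ ∀ᶠ z in 𝓝 (0:ℂ), u (ψ ζ z) = u z := fun ζ => by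
    simp only [Γ, Finset.mem_filter, Polynomial.mem_nthRootsFinset K.succ_pos]
  have h1Γ : (1:ℂ) ∈ Γ := by
    refine (hΓ 1).2 ⟨one_pow _, ?_⟩
    filter_upwards [h.eventuallyEq_of_isBranch (one_pow _) (hψ 1 (one_pow _)) isBranch_id]
      with z hz
    rw [hz]
  have h0Γ : ∀ ζ ∈ Γ, ζ ≠ 0 := by
    rintro ζ hζ rfl
    simpa using ((hΓ 0).1 hζ).1
  have hcomp : ∀ ζ ∈ Γ, ∀ ξ ∈ Γ, ζ * ξ ∈ Γ ∧ ∀ᶠ z in 𝓝 (0:ℂ), ψ ζ (ψ ξ z) = ψ (ζ * ξ) z := by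
    intro ζ hζ ξ hξ
    rw [hΓ] at hζ hξ
    have hpow : (ζ * ξ) ^ (K + 1) = 1 := by rw [mul_pow, hζ.1, hξ.1, one_mul]
    obtain ⟨e1, e2⟩ := isBranch_comp (hψ ζ hζ.1) (hψ ξ hξ.1) hζ.2 hξ.2
    have e3 := h.eventuallyEq_of_isBranch hpow e1 (hψ _ hpow)
    refine ⟨(hΓ _).2 ⟨hpow, ?_⟩, e3⟩
    filter_upwards [e2, e3] with z hz hz'
    rw [← hz', hz]
  have hroots := eq_nthRootsFinset_of_mul_mem h1Γ h0Γ fun ζ hζ ξ hξ => (hcomp ζ hζ ξ hξ).1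
  set m := Γ.card with hm_def
  have hm : 0 < m := Finset.card_pos.2 ⟨1, h1Γ⟩
  have hΓm : ∀ ζ, ζ ∈ Γ ↔ ζ ^ m = 1 := fun ζ => by
    rw [hroots, Polynomial.mem_nthRootsFinset hm]
  let g : ℂ → ℂ := fun z => ∑ ζ ∈ Γ, ζ⁻¹ * ψ ζ z
  have hhol : ∀ ζ ∈ Γ, (∀ᶠ z in 𝓝 (0:ℂ), DifferentiableAt ℂ (ψ ζ) z) ∧ HasDerivAt (ψ ζ) ζ 0 :=
    fun ζ hζ => h.isBranch_holomorphic ((hΓ ζ).1 hζ).1 (hψ ζ ((hΓ ζ).1 hζ).1) ((hΓ ζ).1 hζ).2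
  have hψ0 : ∀ ζ ∈ Γ, Tendsto (ψ ζ) (𝓝 0) (𝓝 0) := fun ζ hζ => (hψ ζ ((hΓ ζ).1 hζ).1).tendsto
  have hg : AnalyticAt ℂ g 0 := by
    rw [Complex.analyticAt_iff_eventually_differentiableAt]
    filter_upwards [(eventually_all_finset Γ).2 fun ζ hζ => (hhol ζ hζ).1] with z hz
    exact DifferentiableAt.fun_sum fun ζ hζ => (hz ζ hζ).const_mul _
  have hg0 : g 0 = 0 := Finset.sum_eq_zero fun ζ hζ => by
    rw [(hψ ζ ((hΓ ζ).1 hζ).1).map_zero, mul_zero]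
  have hgd : HasDerivAt g (m : ℂ) 0 := by
    have : HasDerivAt g (∑ ζ ∈ Γ, ζ⁻¹ * ζ) 0 :=
      HasDerivAt.fun_sum fun ζ hζ => ((hhol ζ hζ).2).const_mul _
    rwa [Finset.sum_congr rfl (fun ζ hζ => inv_mul_cancel₀ (h0Γ ζ hζ)), Finset.sum_const,
      nsmul_eq_mul, mul_one] at this
  have hgψ : ∀ᶠ z in 𝓝 (0:ℂ), ∀ ξ ∈ Γ, g (ψ ξ z) = ξ * g z := by
    rw [eventually_all_finset]
    intro ξ hξ
    filter_upwards [(eventually_all_finset Γ).2 fun ζ hζ => (hcomp ζ hζ ξ hξ).2] with z hz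
    have hinj : Set.InjOn (fun ζ => ζ * ξ) Γ := fun x _ y _ hxy =>
      mul_right_cancel₀ (h0Γ ξ hξ) hxy
    have himg : Γ.image (fun ζ => ζ * ξ) = Γ := by
      refine Finset.eq_of_subset_of_card_le (fun x hx => ?_) ?_
      · obtain ⟨y, hy, rfl⟩ := Finset.mem_image.1 hx
        exact (hcomp y hy ξ hξ).1
      · rw [Finset.card_image_of_injOn hinj]
    have e1 : g z = ∑ ζ ∈ Γ, (ζ * ξ)⁻¹ * ψ (ζ * ξ) z := by
      change ∑ ζ ∈ Γ, ζ⁻¹ * ψ ζ z = _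
      conv_lhs => rw [← himg]
      rw [Finset.sum_image hinj]
    rw [e1, Finset.mul_sum]
    refine Finset.sum_congr rfl fun ζ hζ => ?_
    rw [hz ζ hζ]
    have := h0Γ ξ hξ
    have := h0Γ ζ hζ
    field_simp
  have hd0 : deriv g 0 ≠ 0 := by
    rw [hgd.deriv]
    exact_mod_cast hm.ne'
  let H := HasStrictDerivAt.localInverse g (deriv g 0) 0 hg.hasStrictDerivAt hd0
  have hH : AnalyticAt ℂ H 0 := by
    have := hg.analyticAt_localInverse hd0
    rwa [hg0] at this
  have hHl : ∀ᶠ z in 𝓝 0, H (g z) = z := hg.hasStrictDerivAt.eventually_left_inverse hd0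
  have hHr : ∀ᶠ z in 𝓝 0, g (H z) = z := by
    have := hg.hasStrictDerivAt.eventually_right_inverse hd0
    rwa [hg0] at this
  have hH0 : H 0 = 0 := by
    have := hHl.self_of_nhds
    rwa [hg0] at this
  have hHt : Tendsto H (𝓝 0) (𝓝 0) := by
    have := hH.continuousAt.tendsto
    rwa [hH0] at this
  refine ⟨m, hm, g, H, hg, hH, hg0, hH0, hHl, hHr, ?_⟩
  obtain ⟨ρ₀, hρ₀, hexh⟩ := h.exists_eq_branch hψ
  have hnot : ∀ᶠ z in 𝓝 (0:ℂ), z ≠ 0 → ∀ ζ ∈ Polynomial.nthRootsFinset (K + 1) (1:ℂ),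
      u (ψ ζ z) = u z → ζ ∈ Γ := by
    have hnot' : ∀ᶠ z in 𝓝[≠] (0:ℂ), ∀ ζ ∈ Polynomial.nthRootsFinset (K + 1) (1:ℂ),
        u (ψ ζ z) = u z → ζ ∈ Γ := by
      rw [eventually_all_finset]
      intro ζ hζ
      rw [Polynomial.mem_nthRootsFinset K.succ_pos] at hζ
      rcases h.isBranch_eq_or_ne hζ (hψ ζ hζ) with h1 | h1
      · exact Eventually.of_forall fun _ _ => (hΓ ζ).2 ⟨hζ, h1⟩
      · exact h1.mono fun z hz hz' => (hz hz').elim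
    exact eventually_nhdsWithin_iff.1 hnot'
  have huψ : ∀ᶠ z in 𝓝 (0:ℂ), ∀ ζ ∈ Γ, u (ψ ζ z) = u z ∧ H (g (ψ ζ z)) = ψ ζ z := by
    rw [eventually_all_finset]
    exact fun ζ hζ => ((hΓ ζ).1 hζ).2.and ((hψ0 ζ hζ).eventually hHl)
  have hall : ∀ᶠ ζ in 𝓝 (0:ℂ), g (H ζ) = ζ ∧ ‖H ζ‖ < ρ₀ ∧ (H ζ ≠ 0 → ∀ ξ ∈
      Polynomial.nthRootsFinset (K + 1) (1:ℂ), u (ψ ξ (H ζ)) = u (H ζ) → ξ ∈ Γ) ∧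
      (∀ ξ ∈ Γ, u (ψ ξ (H ζ)) = u (H ζ) ∧ H (g (ψ ξ (H ζ))) = ψ ξ (H ζ)) ∧
      ∀ ξ ∈ Γ, g (ψ ξ (H ζ)) = ξ * g (H ζ) := by
    filter_upwards [hHr, hHt.eventually (ball_mem_nhds 0 hρ₀), hHt.eventually hnot,
      hHt.eventually huψ, hHt.eventually hgψ] with ζ e1 e2 e3 e4 e5
    exact ⟨e1, mem_ball_zero_iff.1 e2, e3, e4, e5⟩
  obtain ⟨ρ, hρ, hb⟩ := Metric.eventually_nhds_iff_ball.1 hall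
  have key : ∀ ζ ξ : ℂ, ‖ζ‖ < ρ → ‖ξ‖ < ρ → ζ ≠ 0 → u (H ξ) = u (H ζ) → ζ ^ m = ξ ^ m := by
    intro ζ ξ hζ hξ hζ0 hu
    obtain ⟨b1, b2, b3, b4, b5⟩ := hb ζ (mem_ball_zero_iff.2 hζ)
    obtain ⟨c1, c2, -, -, -⟩ := hb ξ (mem_ball_zero_iff.2 hξ)
    have hne : H ζ ≠ 0 := fun h0 => hζ0 (by rw [← b1, h0, hg0])
    obtain ⟨η, hη, hηw⟩ := hexh (H ζ) (H ξ) hne b2 c2 hu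
    have hηΓ : η ∈ Γ := b3 hne η ((Polynomial.mem_nthRootsFinset K.succ_pos _).2 hη)
      (by rw [← hηw, hu])
    have e := b5 η hηΓ
    rw [← hηw, c1, b1] at e
    rw [e, mul_pow, (hΓm η).1 hηΓ, one_mul]
  refine ⟨ρ, hρ, fun ζ ξ hζ hξ => ⟨fun hu => ?_, fun hpow => ?_⟩⟩
  · by_cases hζ0 : ζ = 0
    · by_cases hξ0 : ξ = 0
      · rw [hζ0, hξ0]
      · exact (key ξ ζ hξ hζ hξ0 hu).symm
    · exact key ζ ξ hζ hξ hζ0 hu.symm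
  · by_cases hζ0 : ζ = 0
    · rw [hζ0, zero_pow hm.ne'] at hpow
      rw [hζ0, eq_zero_of_pow_eq_zero hpow.symm]
    · obtain ⟨b1, b2, b3, b4, b5⟩ := hb ζ (mem_ball_zero_iff.2 hζ)
      have hηΓ : ξ / ζ ∈ Γ := by
        rw [hΓm, div_pow, ← hpow, div_self (pow_ne_zero _ hζ0)]
      have e1 := b5 _ hηΓ
      rw [b1, div_mul_cancel₀ _ hζ0] at e1
      have e2 := b4 _ hηΓ
      rw [e1] at e2
      rw [e2.2, e2.1]

end LeadingData

end JCurve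

namespace JCurve

open Filter Topology Asymptotics ComplexConjugate
open scoped ContDiff

variable {F : Type*} [NormedAddCommGroup F] [NormedSpace ℂ F]

theorem tendsto_pow_nhdsNE {m : ℕ} (hm : 0 < m) :
    Tendsto (fun ζ : ℂ => ζ ^ m) (𝓝[≠] 0) (𝓝[≠] 0) := by
  refine tendsto_nhdsWithin_iff.2 ⟨?_, ?_⟩
  · have : Tendsto (fun ζ : ℂ => ζ ^ m) (𝓝 0) (𝓝 (0 ^ m)) := (continuous_pow m).tendsto 0
    rw [zero_pow hm.ne'] at this
    exact this.mono_left nhdsWithin_le_nhds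
  · filter_upwards [self_mem_nhdsWithin] with ζ hζ using pow_ne_zero m hζ

theorem tendsto_pow_nhds {m : ℕ} (hm : 0 < m) :
    Tendsto (fun ζ : ℂ => ζ ^ m) (𝓝 0) (𝓝 0) := by
  have : Tendsto (fun ζ : ℂ => ζ ^ m) (𝓝 0) (𝓝 (0 ^ m)) := (continuous_pow m).tendsto 0
  rwa [zero_pow hm.ne'] at this

theorem exists_pow_eq {m : ℕ} (hm : 0 < m) (ξ : ℂ) : ∃ ζ : ℂ, ζ ^ m = ξ :=
  IsAlgClosed.exists_pow_nat_eq ξ hm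

/-- A property of `m`-th roots that holds near zero holds for all roots of small numbers. -/
theorem eventually_of_pow {m : ℕ} {P : ℂ → Prop} (h : ∀ᶠ ζ in 𝓝 (0:ℂ), P ζ) :
    ∀ᶠ ξ in 𝓝 (0:ℂ), ∀ ζ, ζ ^ m = ξ → P ζ := by
  obtain ⟨r, hr, hb⟩ := Metric.eventually_nhds_iff_ball.1 h
  filter_upwards [ball_mem_nhds (0:ℂ) (pow_pos hr m)] with ξ hξ ζ hζ
  refine hb ζ (mem_ball_zero_iff.2 ?_)
  rw [mem_ball_zero_iff, ← hζ, norm_pow] at hξ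
  exact lt_of_pow_lt_pow_left₀ m hr.le hξ

theorem eventually_of_pow_ne {m : ℕ} (hm : 0 < m) {P : ℂ → Prop} (h : ∀ᶠ ζ in 𝓝[≠] (0:ℂ), P ζ) :
    ∀ᶠ ξ in 𝓝[≠] (0:ℂ), ∀ ζ, ζ ^ m = ξ → P ζ := by
  rw [eventually_nhdsWithin_iff] at h ⊢
  filter_upwards [eventually_of_pow h] with ξ hξ hξ0 ζ hζ
  refine hξ ζ hζ fun h0 => hξ0 ?_
  rw [← hζ, (h0 : ζ = 0), zero_pow hm.ne']
  rfl

theorem contDiffAt_of_apply {G : Type*} [NormedAddCommGroup G] [NormedSpace ℝ G] {n : ℕ∞ω}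
    {f : ℂ → ℂ →L[ℝ] G} {z : ℂ} (h : ∀ k, ContDiffAt ℝ n (fun x => f x k) z) :
    ContDiffAt ℝ n f z := by
  have e : f = fun x => ContinuousLinearMap.smulRightL ℝ ℂ G reCLM (f x 1) +
      ContinuousLinearMap.smulRightL ℝ ℂ G imCLM (f x I) := by
    funext x
    ext k
    conv_lhs => rw [show k = k.re • (1:ℂ) + k.im • I by simp, map_add, map_smul, map_smul]
    simp
  rw [e]
  exact ((ContinuousLinearMap.contDiff _).contDiffAt.comp z (h 1)).add
    ((ContinuousLinearMap.contDiff _).contDiffAt.comp z (h I))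

/-- Finite regularity at the origin of a function whose pull-back under `ζ ↦ ζ ^ m` vanishes to
high order. -/
theorem contDiffAt_of_comp_pow [CompleteSpace F] {m : ℕ} (hm : 0 < m) (N : ℕ) :
    ∀ {r S : ℂ → F} {p M : ℕ}, (∀ᶠ ξ in 𝓝[≠] 0, ContDiffAt ℝ ∞ r ξ) → r 0 = 0 → SmoothGerm S →
      S =O[𝓝 0] (fun z : ℂ => ‖z‖ ^ M) → 2 * p + m * N + 1 ≤ M →
      (∀ᶠ ζ in 𝓝[≠] (0:ℂ), (‖ζ‖ ^ 2) ^ p • r (ζ ^ m) = S ζ) → ContDiffAt ℝ N r 0 := by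
  have bound : ∀ {r S : ℂ → F} {p M N : ℕ}, r 0 = 0 → S =O[𝓝 0] (fun z : ℂ => ‖z‖ ^ M) →
      2 * p + m * N + 1 ≤ M →
      (∀ᶠ ζ in 𝓝[≠] (0:ℂ), (‖ζ‖ ^ 2) ^ p • r (ζ ^ m) = S ζ) →
      r =o[𝓝 0] fun ξ : ℂ => ‖ξ‖ ^ N := by
    intro r S p M N hr0 hSO hM hrS
    have h1 := (isLittleO_norm_pow_of_lt hSO (show 2 * p + m * N < M by omega))
    rw [isLittleO_iff]
    intro ε hε
    have h2 : ∀ᶠ ζ in 𝓝[≠] (0:ℂ), ‖r (ζ ^ m)‖ ≤ ε * ‖‖ζ ^ m‖ ^ N‖ := by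
      filter_upwards [nhdsWithin_le_nhds (isLittleO_iff.1 h1 hε), hrS, self_mem_nhdsWithin]
        with ζ e1 e2 e3
      have hζ : 0 < ‖ζ‖ := norm_pos_iff.2 e3
      rw [← e2, norm_smul, norm_pow, norm_pow, norm_norm, norm_pow, norm_norm, pow_add,
        pow_mul, mul_left_comm] at e1
      have := le_of_mul_le_mul_left e1 (by positivity)
      rwa [norm_pow, norm_norm, norm_pow, ← pow_mul]
    have h3 := eventually_nhdsWithin_iff.1 (eventually_of_pow_ne hm h2)
    filter_upwards [h3] with ξ hξ
    by_cases h0 : ξ = 0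
    · rw [h0, hr0, norm_zero]; positivity
    · obtain ⟨ζ, hζ⟩ := exists_pow_eq hm ξ
      have := hξ h0 ζ hζ
      rwa [hζ] at this
  induction N with
  | zero =>
    intro r S p M hr hr0 hS hSO hM hrS
    have hb := bound hr0 hSO hM hrS
    simp only [pow_zero] at hb
    have hc : ContinuousAt r 0 := by
      rw [ContinuousAt, hr0]
      exact (isLittleO_one_iff ℝ).1 hb
    refine contDiffAt_zero.2 ?_
    have h1 : ∀ᶠ ξ in 𝓝 (0:ℂ), ContinuousAt r ξ := by
      filter_upwards [eventually_nhdsWithin_iff.1 hr] with ξ hξ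
      by_cases h0 : ξ = 0
      · rwa [h0]
      · exact (hξ h0).continuousAt
    exact ⟨_, h1, fun ξ hξ => ContinuousAt.continuousWithinAt hξ⟩
  | succ N ih =>
    intro r S p M hr hr0 hS hSO hM hrS
    have hd0 : HasFDerivAt r (0 : ℂ →L[ℝ] F) 0 := by
      rw [hasFDerivAt_iff_isLittleO_nhds_zero]
      have hb := bound (N := 1) hr0 hSO (by nlinarith) hrS
      simp only [pow_one] at hb
      simpa [hr0] using! isLittleO_norm_right.1 hb
    have hrd : ∀ᶠ ξ in 𝓝 (0:ℂ), HasFDerivAt r (fderiv ℝ r ξ) ξ := by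
      filter_upwards [eventually_nhdsWithin_iff.1 hr] with ξ hξ
      by_cases h0 : ξ = 0
      · rw [h0, hd0.fderiv]; exact hd0
      · exact ((hξ h0).differentiableAt (by simp)).hasFDerivAt
    push_cast
    refine contDiffAt_succ_iff_hasFDerivAt.2 ⟨fderiv ℝ r, ⟨_, hrd, fun x hx => hx⟩, ?_⟩
    refine contDiffAt_of_apply fun h => ?_
    obtain ⟨n, rfl⟩ : ∃ n, m = n + 1 := ⟨m - 1, by omega⟩
    let κ : ℂ → ℂ := fun ζ => ((n + 1 : ℕ) : ℂ)⁻¹ * conj ζ ^ n * h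
    let W : ℂ → ℝ := fun ζ => ‖ζ‖ ^ 2
    have hW : ContDiff ℝ ∞ W := contDiff_norm_sq ℝ
    have hκ : ContDiff ℝ ∞ κ := by
      have : ContDiff ℝ ∞ (fun ζ : ℂ => conj ζ) := conjCLE.contDiff
      exact ((contDiff_const.mul (this.pow n)).mul contDiff_const)
    have hWd : ∀ ζ, HasFDerivAt W (2 • (innerSL ℝ ζ)) ζ := fun ζ => by
      simpa using (hasFDerivAt_id (𝕜 := ℝ) ζ).norm_sq
    let S' : ℂ → F := fun ζ => W ζ • fderiv ℝ S ζ (κ ζ) -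
      ((p : ℝ) * (fderiv ℝ W ζ (κ ζ))) • S ζ
    have hS' : SmoothGerm S' := by
      filter_upwards [hS, hS.fderiv] with ζ e1 e2
      have e3 := (hW.fderiv_right (m := ∞) (by simp)).contDiffAt (x := ζ)
      exact (hW.contDiffAt.smul (e2.clm_apply hκ.contDiffAt)).sub
        ((contDiffAt_const.mul (e3.clm_apply hκ.contDiffAt)).smul e1)
    have hκO : κ =O[𝓝 0] fun z : ℂ => ‖z‖ ^ n := by
      refine IsBigO.of_bound (‖(((n + 1 : ℕ) : ℂ))⁻¹‖ * ‖h‖) (Eventually.of_forall fun z => ?_)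
      simp only [κ, norm_mul, norm_pow, norm_norm, RCLike.norm_conj]
      exact le_of_eq (by ring)
    have hWO : W =O[𝓝 0] fun z : ℂ => ‖z‖ ^ 2 := isBigO_refl _ _
    have hW'O : (fun ζ => fderiv ℝ W ζ (κ ζ)) =O[𝓝 0] fun z : ℂ => ‖z‖ ^ (n + 1) := by
      have : (fun ζ => fderiv ℝ W ζ (κ ζ)) =O[𝓝 0] fun z : ℂ => ‖z‖ * ‖κ z‖ := by
        refine IsBigO.of_bound 2 (Eventually.of_forall fun z => ?_)
        rw [(hWd z).fderiv]
        simp only [smul_apply, innerSL_apply_apply, nsmul_eq_mul, norm_mul,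
          norm_norm]
        have := norm_inner_le_norm (𝕜 := ℝ) z (κ z)
        simpa using this
      refine this.trans ?_
      simpa [pow_succ'] using (isBigO_refl (fun z : ℂ => ‖z‖) (𝓝 0)).mul hκO.norm_left
    obtain ⟨M, rfl⟩ : ∃ M', M = M' + 1 := ⟨M - 1, by omega⟩
    have hS'O : S' =O[𝓝 0] fun z : ℂ => ‖z‖ ^ (M + 1 + (n + 1)) := by
      have h1 : (fun ζ => fderiv ℝ S ζ (κ ζ)) =O[𝓝 0] fun z : ℂ => ‖z‖ ^ (M + n) := by
        have : (fun ζ => fderiv ℝ S ζ (κ ζ)) =O[𝓝 0] fun z : ℂ => ‖fderiv ℝ S z‖ * ‖κ z‖ :=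
          IsBigO.of_bound 1 (Eventually.of_forall fun z => by
            simpa using (fderiv ℝ S z).le_opNorm (κ z))
        refine this.trans ?_
        simpa [pow_add] using (hS.fderiv_isBigO hSO).norm_left.mul hκO.norm_left
      refine IsBigO.sub ?_ ?_
      · refine (hWO.smul h1).congr_right fun z => ?_
        rw [smul_eq_mul]; ring
      · refine ((hW'O.const_mul_left (p : ℝ)).smul hSO).congr_right fun z => ?_
        rw [smul_eq_mul]; ring
    refine ih (S := S') (p := p + (n + 1)) (M := M + 1 + (n + 1)) ?_ ?_ hS' hS'O (by
      nlinarith) ?_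
    · have : ∀ᶠ ξ in 𝓝[≠] (0:ℂ), ContDiffAt ℝ ∞ (fderiv ℝ r) ξ :=
        hr.mono fun ξ hξ => hξ.fderiv_right (by simp)
      exact this.mono fun ξ hξ => hξ.clm_apply contDiffAt_const
    · rw [hd0.fderiv]; rfl
    · filter_upwards [eventually_eventually_nhdsWithin.2 hrS, self_mem_nhdsWithin,
        (tendsto_pow_nhdsNE hm).eventually hr, nhdsWithin_le_nhds hS] with ζ e1 hζ0 e2 e3
      have hζ : IsOpen ({0}ᶜ : Set ℂ) := isOpen_compl_singleton
      rw [hζ.nhdsWithin_eq hζ0] at e1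
      have d1 : HasFDerivAt (fun ζ : ℂ => r (ζ ^ (n + 1)))
          ((fderiv ℝ r (ζ ^ (n + 1))).comp (((n + 1) • ζ ^ n) • ContinuousLinearMap.id ℝ ℂ)) ζ := by
        have := hasFDerivAt_pow (𝕜 := ℝ) (n + 1) (x := ζ)
        exact (e2.differentiableAt (by simp)).hasFDerivAt.comp ζ this
      have d2 : HasFDerivAt (fun ζ => W ζ ^ p) _ ζ := (hWd ζ).pow p
      have d3 := d2.smul d1
      have d4 : HasFDerivAt S (fderiv ℝ S ζ) ζ := (e3.differentiableAt (by simp)).hasFDerivAt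
      have d5 := (d3.congr_of_eventuallyEq (f₁ := S) (e1.mono fun z hz => hz.symm)).unique d4
      have d6 := congrArg (fun l => l (κ ζ)) d5
      have hv := e1.self_of_nhds
      have hκe : ((n + 1) • ζ ^ n) * κ ζ = ((W ζ ^ n : ℝ)) • h := by
        simp only [κ, W, nsmul_eq_mul, real_smul]
        have : ((‖ζ‖ ^ 2 : ℝ) : ℂ) = ζ * conj ζ := by
          rw [mul_conj, normSq_eq_norm_sq]
        push_cast at this ⊢
        rw [this, mul_pow]
        have hn : (n : ℂ) + 1 ≠ 0 := by exact_mod_cast n.succ_ne_zero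
        field_simp
      simp only [add_apply, smul_apply, ContinuousLinearMap.smulRight_apply,
        ContinuousLinearMap.comp_apply, ContinuousLinearMap.id_apply] at d6
      rw [smul_eq_mul, hκe, map_smul] at d6
      change (W ζ ^ p) • _ = S ζ at hv
      change (W ζ ^ (p + (n + 1))) • fderiv ℝ r (ζ ^ (n + 1)) h = W ζ • fderiv ℝ S ζ (κ ζ) -
        ((p : ℝ) * (fderiv ℝ W ζ (κ ζ))) • S ζ
      rw [← d6, ← hv, (hWd ζ).fderiv]
      have hp : (p : ℝ) * W ζ ^ p = W ζ * (p * W ζ ^ (p - 1)) := by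
        rcases p with _ | p
        · simp
        · rw [Nat.add_sub_cancel]; ring
      simp only [smul_apply, smul_add, smul_smul, smul_eq_mul, nsmul_eq_mul]
      rw [add_sub_assoc, ← sub_smul]
      have hz : W ζ * (p * W ζ ^ (p - 1) * (2 * (innerSL ℝ ζ) (κ ζ))) -
        p * (2 * (innerSL ℝ ζ) (κ ζ)) * W ζ ^ p = 0 := by
        linear_combination -(2 * (innerSL ℝ ζ) (κ ζ)) * hp
      norm_num at hz ⊢
      rw [hz, zero_smul, add_zero]
      congr 1
      ring
end JCurve

namespace JCurve

open Filter Topology Asymptotics ComplexConjugate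
open scoped ContDiff

variable {F : Type*} [NormedAddCommGroup F] [NormedSpace ℂ F]
variable {J : F → F →L[ℝ] F} {U g : ℂ → F} {m N : ℕ}

/-- The defect in the Cauchy–Riemann equation for `J`. -/
noncomputable def dbarJ (J : F → F →L[ℝ] F) (g : ℂ → F) (z : ℂ) : F :=
  fderiv ℝ g z 1 + J (g z) (fderiv ℝ g z I)

theorem contDiff_dbarJ (hJ : ContDiff ℝ ∞ J) (hg : ContDiff ℝ ∞ g) : ContDiff ℝ ∞ (dbarJ J g) := by
  have h := hg.fderiv_right (m := ∞) (by simp)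
  exact (h.clm_apply contDiff_const).add ((hJ.comp hg).clm_apply (h.clm_apply contDiff_const))

theorem fderiv_apply_eq (f : ℂ → F) (z c : ℂ) :
    fderiv ℝ f z c = c.re • fderiv ℝ f z 1 + c.im • fderiv ℝ f z I := by
  conv_lhs => rw [show c = c.re • (1:ℂ) + c.im • I by simp, map_add, map_smul, map_smul]

theorem fderiv_comp_pow {f : ℂ → F} {ζ : ℂ} (hf : DifferentiableAt ℝ f (ζ ^ m)) (h : ℂ) :
    fderiv ℝ (fun ζ => f (ζ ^ m)) ζ h = fderiv ℝ f (ζ ^ m) (m * ζ ^ (m - 1) * h) := by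
  have h1 := hf.hasFDerivAt.comp ζ (hasFDerivAt_pow (𝕜 := ℝ) m (x := ζ))
  have h2 : HasFDerivAt (fun ζ => f (ζ ^ m)) _ ζ := h1
  rw [h2.fderiv]
  simp

theorem conj_smul_eq (c : ℂ) (w : F) : conj c • w = c.re • w - c.im • (I • w) := by
  conv_lhs => rw [show conj c = c.re - c.im * I by apply Complex.ext <;> simp]
  rw [sub_smul, mul_smul, coe_smul, coe_smul]

theorem dbar_comp_pow {f : ℂ → F} {ζ : ℂ} (hf : DifferentiableAt ℝ f (ζ ^ m)) :
    dbar (fun ζ => f (ζ ^ m)) ζ = conj (m * ζ ^ (m - 1) : ℂ) • dbar f (ζ ^ m) := by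
  rw [dbar, fderiv_comp_pow hf, fderiv_comp_pow hf, mul_one, fderiv_apply_eq f,
    fderiv_apply_eq f _ (_ * I), dbar, conj_smul_eq]
  generalize (m * ζ ^ (m - 1) : ℂ) = c
  have e1 : (c * I).re = - c.im := by simp
  have e2 : (c * I).im = c.re := by simp
  rw [e1, e2, smul_add I, smul_add I, smul_smul I I, I_mul_I, smul_comm I, smul_comm I]
  module

theorem dbar_sub_comp_pow_eq {ζ : ℂ} (hJsq : ∀ x w, J x (J x w) = -w)
    (hU : DifferentiableAt ℝ U ζ) (hUc : fderiv ℝ U ζ 1 + J (U ζ) (fderiv ℝ U ζ I) = 0)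
    (hg : Differentiable ℝ g) :
    dbar (fun ζ => U ζ - g (ζ ^ m)) ζ + conj (m * ζ ^ (m - 1) : ℂ) • dbarJ J g (ζ ^ m) =
      (I • fderiv ℝ (fun ζ => U ζ - g (ζ ^ m)) ζ I -
        J (U ζ) (fderiv ℝ (fun ζ => U ζ - g (ζ ^ m)) ζ I)) +
      (J (g (ζ ^ m)) - J (U ζ)) (fderiv ℝ (fun ζ => g (ζ ^ m)) ζ I) -
      (m * ζ ^ (m - 1) : ℂ).im • (I • dbarJ J g (ζ ^ m) - J (g (ζ ^ m)) (dbarJ J g (ζ ^ m))) := by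
  have hG : DifferentiableAt ℝ (fun ζ => g (ζ ^ m)) ζ :=
    (hg _).comp ζ (hasFDerivAt_pow (𝕜 := ℝ) m (x := ζ)).differentiableAt
  have h1 : fderiv ℝ (fun ζ => U ζ - g (ζ ^ m)) ζ =
      fderiv ℝ U ζ - fderiv ℝ (fun ζ => g (ζ ^ m)) ζ := fderiv_sub hU hG
  rw [dbar_sub hU hG, dbar_comp_pow (hg _), h1, sub_apply, fderiv_comp_pow (hg _),
    dbar, eq_neg_of_add_eq_zero_left hUc, sub_apply, fderiv_apply_eq g]
  generalize (m * ζ ^ (m - 1) : ℂ) = c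
  have e1 : (c * I).re = - c.im := by simp
  have e2 : (c * I).im = c.re := by simp
  rw [e1, e2, dbar, dbarJ, conj_smul_eq, conj_smul_eq]
  simp only [map_add, map_sub, map_smul, hJsq, smul_add I, smul_sub I, smul_comm I (_ : ℝ),
    smul_smul I I, I_mul_I]
  module

theorem CurveGerm.dbar_sub_comp_pow [CompleteSpace F] (hU : CurveGerm J U) (hJ : ContDiff ℝ ∞ J)
    (hJsq : ∀ x w, J x (J x w) = -w) (hJ0 : ∀ w, J 0 w = I • w) (hU0 : U 0 = 0)
    (hm : 0 < m) (hg : ContDiff ℝ ∞ g)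
    (hV : (fun ζ => U ζ - g (ζ ^ m)) =O[𝓝 0] fun ζ : ℂ => ‖ζ‖ ^ (N + 1)) :
    ((fun ζ => conj (m * ζ ^ (m - 1) : ℂ) • dbarJ J g (ζ ^ m)) =O[𝓝 0] fun ζ : ℂ => ‖ζ‖ ^ N) ∧
    (fun ζ => dbar (fun ζ => U ζ - g (ζ ^ m)) ζ +
      conj (m * ζ ^ (m - 1) : ℂ) • dbarJ J g (ζ ^ m)) =O[𝓝 0] fun ζ : ℂ => ‖ζ‖ ^ (N + 1) := by
  have hGs : ContDiff ℝ ∞ fun ζ : ℂ => g (ζ ^ m) := hg.comp (contDiff_id.pow m)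
  have hVs : SmoothGerm fun ζ => U ζ - g (ζ ^ m) := by
    filter_upwards [hU] with z hz using hz.1.sub hGs.contDiffAt
  have hg0 : g 0 = 0 := by
    have := hV.eq_zero_imp.self_of_nhds (by simp)
    simpa [hU0, zero_pow hm.ne'] using this
  have hUO : U =O[𝓝 0] fun z : ℂ => ‖z‖ ^ 1 := by
    simpa [hU0] using
      isBigO_norm_of_differentiableAt (hU.self_of_nhds.1.differentiableAt (by simp))
  have hGO : (fun ζ : ℂ => g (ζ ^ m)) =O[𝓝 0] fun z : ℂ => ‖z‖ ^ 1 := by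
    simpa [hg0, zero_pow hm.ne'] using
      isBigO_norm_of_differentiableAt (hGs.differentiable (by simp) 0)
  have hUt : Tendsto U (𝓝 0) (𝓝 0) := by simpa [hU0] using hU.continuousAt.tendsto
  have hGt : Tendsto (fun ζ : ℂ => g (ζ ^ m)) (𝓝 0) (𝓝 0) := by
    simpa [hg0, zero_pow hm.ne'] using hGs.continuous.tendsto 0
  have hJU : (fun z => J (U z) - J 0) =O[𝓝 0] fun z : ℂ => ‖z‖ ^ 1 := by
    have h3 := (hJ.differentiable (by simp) 0).isBigO_sub.comp_tendsto hUt
    simp only [sub_zero] at h3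
    exact h3.trans hUO
  have hJG : (fun z : ℂ => J (g (z ^ m)) - J 0) =O[𝓝 0] fun z : ℂ => ‖z‖ ^ 1 := by
    have h3 := (hJ.differentiable (by simp) 0).isBigO_sub.comp_tendsto hGt
    simp only [sub_zero] at h3
    exact h3.trans hGO
  have hJGU : (fun z : ℂ => J (g (z ^ m)) - J (U z)) =O[𝓝 0] fun z : ℂ => ‖z‖ ^ (N + 1) := by
    have h3 := ((hJ.contDiffAt (x := 0)).hasStrictFDerivAt (by simp)).isBigO_sub.comp_tendsto
      ((hGt.prodMk_nhds hUt))
    refine IsBigO.trans h3 (hV.neg_left.congr_left fun z => ?_)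
    simp
  have clm : ∀ {A : ℂ → F →L[ℝ] F} {b : ℂ → F} {i j : ℕ}, A =O[𝓝 0] (fun z : ℂ => ‖z‖ ^ i) →
      b =O[𝓝 0] (fun z : ℂ => ‖z‖ ^ j) → (fun z => A z (b z)) =O[𝓝 0]
      fun z : ℂ => ‖z‖ ^ (i + j) := by
    intro A b i j hA hb
    have : (fun z => A z (b z)) =O[𝓝 0] fun z : ℂ => ‖A z‖ * ‖b z‖ :=
      IsBigO.of_bound 1 (Eventually.of_forall fun z => by simpa using (A z).le_opNorm (b z))
    refine this.trans ?_
    simpa [pow_add] using hA.norm_left.mul hb.norm_left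
  have app : ∀ {A : ℂ → ℂ →L[ℝ] F} {j : ℕ}, A =O[𝓝 0] (fun z : ℂ => ‖z‖ ^ j) →
      (fun z => A z I) =O[𝓝 0] fun z : ℂ => ‖z‖ ^ j := by
    intro A j hA
    refine IsBigO.trans (IsBigO.of_bound 1 (Eventually.of_forall fun z => ?_)) hA
    simpa using (A z).le_opNorm I
  have hGI : (fun ζ : ℂ => fderiv ℝ (fun ζ => g (ζ ^ m)) ζ I) =O[𝓝 0] fun z : ℂ => ‖z‖ ^ 0 := by
    simp only [pow_zero]
    exact Tendsto.isBigO_one ℝ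
      (((hGs.continuous_fderiv (by simp)).clm_apply continuous_const).tendsto 0)
  have hVI := app (hVs.fderiv_isBigO hV)
  have hR : (fun ζ : ℂ => (I • fderiv ℝ (fun ζ => U ζ - g (ζ ^ m)) ζ I -
        J (U ζ) (fderiv ℝ (fun ζ => U ζ - g (ζ ^ m)) ζ I)) +
      (J (g (ζ ^ m)) - J (U ζ)) (fderiv ℝ (fun ζ => g (ζ ^ m)) ζ I)) =O[𝓝 0]
        fun z : ℂ => ‖z‖ ^ (N + 1) := by
    refine IsBigO.add ?_ (by simpa using clm hJGU hGI)
    have := clm hJU hVI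
    rw [add_comm] at this
    refine this.neg_left.congr_left fun z => ?_
    rw [sub_apply, hJ0]
    abel
  set x : ℂ → F := fun ζ => conj (m * ζ ^ (m - 1) : ℂ) • dbarJ J g (ζ ^ m) with hx
  have hR' : (fun ζ : ℂ => (m * ζ ^ (m - 1) : ℂ).im • (I • dbarJ J g (ζ ^ m) -
      J (g (ζ ^ m)) (dbarJ J g (ζ ^ m)))) =O[𝓝 0] fun z : ℂ => ‖z‖ ^ 1 * ‖x z‖ := by
    refine IsBigO.trans (IsBigO.of_bound 1 (Eventually.of_forall fun z => ?_))
      (hJG.norm_left.mul (isBigO_refl (fun z => ‖x z‖) _))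
    rw [show I • dbarJ J g (z ^ m) - J (g (z ^ m)) (dbarJ J g (z ^ m)) =
      - ((J (g (z ^ m)) - J 0) (dbarJ J g (z ^ m))) by rw [sub_apply, hJ0]; abel, norm_smul,
      norm_neg, hx, norm_smul, RCLike.norm_conj, one_mul, norm_mul, norm_norm, norm_mul, norm_norm,
      norm_norm, mul_left_comm]
    gcongr
    · exact Complex.abs_im_le_norm _
    · exact ContinuousLinearMap.le_opNorm _ _
  have heq := hU.mono fun ζ hζ => dbar_sub_comp_pow_eq (m := m) hJsq
    (hζ.1.differentiableAt (by simp)) hζ.2 (hg.differentiable (by simp))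
  have hdV := JCurve.dbar_isBigO hVs hV
  have hlit : (fun z : ℂ => ‖z‖ ^ 1 * ‖x z‖) =o[𝓝 0] x := by
    have h1 : (fun z : ℂ => ‖z‖ ^ 1) =o[𝓝 0] fun _ => (1:ℝ) := by
      rw [isLittleO_one_iff]
      simpa using (continuous_norm.tendsto (0:ℂ))
    simpa using h1.mul_isBigO (isBigO_refl (fun z => ‖x z‖) _)
  have hxO : x =O[𝓝 0] fun ζ : ℂ => ‖ζ‖ ^ N := by
    have h1 := (hR'.trans_isLittleO hlit).right_isBigO_add
    refine h1.trans ?_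
    refine ((isBigO_norm_pow_of_le hR (Nat.le_succ N)).sub hdV).congr' ?_ EventuallyEq.rfl
    filter_upwards [heq] with ζ hζ
    rw [← sub_eq_zero] at hζ ⊢
    rw [← neg_eq_zero, ← hζ]
    abel
  refine ⟨hxO, ?_⟩
  refine (hR.sub (hR'.trans ?_)).congr' (heq.mono fun ζ hζ => hζ.symm) EventuallyEq.rfl
  refine ((isBigO_refl (fun z : ℂ => ‖z‖ ^ 1) (𝓝 0)).mul hxO.norm_left).congr_right fun z => ?_
  ring

end JCurve

namespace JCurve

open Filter Topology Asymptotics ComplexConjugate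
open scoped ContDiff

variable {F : Type*} [NormedAddCommGroup F] [NormedSpace ℂ F]
variable {J : F → F →L[ℝ] F} {U g : ℂ → F} {m N : ℕ}

theorem isBigO_comp_pow {G : Type*} [NormedAddCommGroup G] (hm : 0 < m) {f : ℂ → G}
    {t : ℕ} (h : f =O[𝓝 0] fun ξ : ℂ => ‖ξ‖ ^ t) :
    (fun ζ => f (ζ ^ m)) =O[𝓝 0] fun ζ : ℂ => ‖ζ‖ ^ (m * t) := by
  refine (h.comp_tendsto (tendsto_pow_nhds hm)).congr_right fun z => ?_
  simp [pow_mul]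

theorem isBigO_of_conj_smul_comp_pow [CompleteSpace F] (hm : 0 < m) {e : ℂ → F} (he : SmoothGerm e)
    (hx : (fun ζ => conj (m * ζ ^ (m - 1) : ℂ) • e (ζ ^ m)) =O[𝓝 0] fun ζ : ℂ => ‖ζ‖ ^ N) (t : ℕ)
    (ht : m * t ≤ N) : e =O[𝓝 0] fun ξ : ℂ => ‖ξ‖ ^ t := by
  have hec : ContinuousAt e 0 := he.self_of_nhds.continuousAt
  induction t with
  | zero =>
    simp only [pow_zero]
    exact hec.tendsto.isBigO_one ℝ
  | succ t ih =>
    have ho : e =o[𝓝 0] fun ξ : ℂ => ‖ξ‖ ^ t := by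
      rw [isLittleO_iff]
      intro ε hε
      have h1 := isLittleO_norm_pow_of_lt hx (show (m - 1) + m * t < N by
        rw [mul_add] at ht; omega)
      have h2 : ∀ᶠ ζ in 𝓝[≠] (0:ℂ), ‖e (ζ ^ m)‖ ≤ ε * ‖‖ζ ^ m‖ ^ t‖ := by
        filter_upwards [nhdsWithin_le_nhds (isLittleO_iff.1 h1 hε), self_mem_nhdsWithin]
          with ζ e1 e3
        have hζ : 0 < ‖ζ‖ := norm_pos_iff.2 e3
        rw [norm_smul, RCLike.norm_conj, norm_mul, norm_pow, norm_pow, norm_norm, norm_natCast,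
          pow_add, mul_left_comm, mul_comm (m : ℝ), mul_assoc] at e1
        have e2 := le_of_mul_le_mul_left e1 (by positivity)
        rw [norm_pow, norm_norm, norm_pow, ← pow_mul]
        refine le_trans ?_ e2
        have : (1:ℝ) ≤ m := by exact_mod_cast hm
        nlinarith [norm_nonneg (e (ζ ^ m))]
      have h3 : ∀ᶠ ξ in 𝓝[≠] (0:ℂ), ‖e ξ‖ ≤ ε * ‖‖ξ‖ ^ t‖ := by
        filter_upwards [eventually_of_pow_ne hm h2] with ξ hξ
        obtain ⟨ζ, hζ⟩ := exists_pow_eq hm ξ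
        have := hξ ζ hζ
        rwa [hζ] at this
      have h4 : ‖e 0‖ ≤ ε * ‖‖(0:ℂ)‖ ^ t‖ := by
        refine le_of_tendsto_of_tendsto (b := 𝓝[≠] (0:ℂ)) (hec.norm.tendsto.mono_left
          nhdsWithin_le_nhds) (Tendsto.mono_left ?_ nhdsWithin_le_nhds) h3
        have : Continuous fun ξ : ℂ => ε * ‖‖ξ‖ ^ t‖ := by fun_prop
        exact this.tendsto 0
      filter_upwards [eventually_nhdsWithin_iff.1 h3] with ξ hξ
      by_cases h0 : ξ = 0
      · rwa [h0]
      · exact hξ h0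
    obtain ⟨c, hc⟩ := he.exists_leading (ih (by nlinarith))
    have hh : homSum t c =o[𝓝 0] fun z : ℂ => ‖z‖ ^ t :=
      (ho.sub (isLittleO_norm_pow_of_lt hc t.lt_succ_self)).congr_left fun z => by simp
    refine hc.congr_left fun z => ?_
    rw [sub_eq_self, homSum]
    refine Finset.sum_eq_zero fun a ha => ?_
    rw [eq_zero_of_homSum_isLittleO hh (by simpa [Nat.lt_succ_iff] using ha), smul_zero]

theorem eq_zero_of_pow_smul_isBigO {N : ℕ} {c : F}
    (h : (fun z : ℂ => z ^ N • c) =O[𝓝 0] fun z : ℂ => ‖z‖ ^ (N + 1)) : c = 0 := by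
  have h1 := isLittleO_norm_pow_of_lt h N.lt_succ_self
  by_contra hc
  have h2 : ∀ᶠ z in 𝓝[≠] (0:ℂ), False := by
    filter_upwards [nhdsWithin_le_nhds (isLittleO_iff.1 h1 (half_pos (norm_pos_iff.2 hc))),
      self_mem_nhdsWithin] with z hz h0
    have h0 : 0 < ‖z‖ := norm_pos_iff.2 h0
    rw [norm_smul, norm_pow, norm_pow, norm_norm, mul_comm] at hz
    have := le_of_mul_le_mul_right hz (by positivity)
    linarith [norm_pos_iff.2 hc]
  exact h2.exists.elim fun _ h => h

theorem CurveGerm.exists_next_comp_pow [CompleteSpace F] (hU : CurveGerm J U) (hJ : ContDiff ℝ ∞ J)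
    (hJsq : ∀ x w, J x (J x w) = -w) (hJ0 : ∀ w, J 0 w = I • w) (hU0 : U 0 = 0)
    (hm : 0 < m) (hinv : ∀ η : ℂ, η ^ m = 1 → ∀ᶠ ζ in 𝓝 0, U (η * ζ) = U ζ)
    (hg : ContDiff ℝ ∞ g)
    (hV : (fun ζ => U ζ - g (ζ ^ m)) =O[𝓝 0] fun ζ : ℂ => ‖ζ‖ ^ (N + 1)) :
    ∃ g' : ℂ → F, ContDiff ℝ ∞ g' ∧
      (fun ζ => U ζ - g' (ζ ^ m)) =O[𝓝 0] fun ζ : ℂ => ‖ζ‖ ^ (N + 2) := by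
  obtain ⟨h1, h2⟩ := hU.dbar_sub_comp_pow hJ hJsq hJ0 hU0 hm hg hV
  have hes : ContDiff ℝ ∞ (dbarJ J g) := contDiff_dbarJ hJ hg
  have heO := isBigO_of_conj_smul_comp_pow hm hes.smoothGerm h1 (N / m) (Nat.mul_div_le N m)
  obtain ⟨q, hq, hqO, hqd⟩ := hes.neg.smoothGerm.exists_dbar_solution heO.neg_left
  have hNm : N + 1 ≤ m * (N / m + 1) := Nat.lt_mul_div_succ N hm
  have hqp : (fun ζ => q (ζ ^ m)) =O[𝓝 0] fun ζ : ℂ => ‖ζ‖ ^ (N + 1) :=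
    isBigO_norm_pow_of_le (isBigO_comp_pow hm hqO) hNm
  have hGs : ContDiff ℝ ∞ fun ζ : ℂ => g (ζ ^ m) := hg.comp (contDiff_id.pow m)
  have hqs : ContDiff ℝ ∞ fun ζ : ℂ => q (ζ ^ m) := hq.comp (contDiff_id.pow m)
  let V : ℂ → F := fun ζ => U ζ - g (ζ ^ m) - q (ζ ^ m)
  have hVs : SmoothGerm V := by
    filter_upwards [hU] with z hz using (hz.1.sub hGs.contDiffAt).sub hqs.contDiffAt
  have hVO : V =O[𝓝 0] fun ζ : ℂ => ‖ζ‖ ^ (N + 1) := hV.sub hqp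
  have hVd : dbar V =O[𝓝 0] fun ζ : ℂ => ‖ζ‖ ^ (N + 1) := by
    have h3 : (fun ζ => conj (m * ζ ^ (m - 1) : ℂ) • (dbar q (ζ ^ m) + dbarJ J g (ζ ^ m)))
        =O[𝓝 0] fun ζ : ℂ => ‖ζ‖ ^ (N + 1) := by
      have h4 : (fun ζ : ℂ => conj (m * ζ ^ (m - 1) : ℂ)) =O[𝓝 0] fun _ => (1:ℝ) := by
        have : Continuous fun ζ : ℂ => conj (m * ζ ^ (m - 1) : ℂ) := by fun_prop
        exact (this.tendsto 0).isBigO_one ℝ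
      have h5 := h4.smul (isBigO_norm_pow_of_le (isBigO_comp_pow hm hqd) hNm)
      simpa using h5
    refine (h2.sub h3).congr' ?_ EventuallyEq.rfl
    filter_upwards [hU] with ζ hζ
    have e1 := dbar_sub (f := fun ζ => U ζ - g (ζ ^ m)) (g := fun ζ => q (ζ ^ m)) (z := ζ)
      ((hζ.1.sub hGs.contDiffAt).differentiableAt (by simp)) (hqs.differentiable (by simp) ζ)
    rw [dbar_comp_pow (hq.differentiable (by simp) _)] at e1
    change _ = dbar (fun ζ => U ζ - g (ζ ^ m) - q (ζ ^ m)) ζ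
    rw [e1, smul_add]
    abel
  obtain ⟨c, hc⟩ := hVs.exists_holomorphic_leading hVO hVd
  have hηc : ∀ η : ℂ, η ^ m = 1 → (η ^ (N + 1) - 1) • c = 0 := by
    intro η hη
    refine eq_zero_of_pow_smul_isBigO (N := N + 1) ?_
    have ht : Tendsto (fun ζ : ℂ => η * ζ) (𝓝 0) (𝓝 0) := by
      have : Continuous fun ζ : ℂ => η * ζ := by fun_prop
      simpa using this.tendsto 0
    have h3 := hc.comp_tendsto ht
    have hη1 : ‖η‖ = 1 := by
      have := congrArg norm hη
      rw [norm_pow, norm_one] at this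
      exact (pow_eq_one_iff_of_nonneg (norm_nonneg _) hm.ne').1 this
    have h4 := h3.congr_right (g₂ := fun z : ℂ => ‖z‖ ^ (N + 1 + 1)) fun z => by simp [hη1]
    refine (hc.sub h4).congr' ?_ EventuallyEq.rfl
    filter_upwards [hinv η hη] with ζ hζ
    simp only [V, Function.comp_apply, hζ, mul_pow, hη, one_mul]
    module
  obtain ⟨g₁, hg₁, hg₁c⟩ : ∃ g₁ : ℂ → F, ContDiff ℝ ∞ g₁ ∧ ∀ ζ, g₁ (ζ ^ m) = ζ ^ (N + 1) • c := by
    by_cases hdvd : m ∣ N + 1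
    · obtain ⟨k, hk⟩ := hdvd
      refine ⟨fun ξ => ξ ^ k • c, (contDiff_id.pow k).smul contDiff_const, fun ζ => ?_⟩
      rw [hk, pow_mul]
    · have hprim := Complex.isPrimitiveRoot_exp m hm.ne'
      have := hηc _ hprim.pow_eq_one
      have hc0 : c = 0 := by
        refine (smul_eq_zero.1 this).resolve_left fun h0 => hdvd ?_
        exact (hprim.pow_eq_one_iff_dvd _).1 (sub_eq_zero.1 h0)
      exact ⟨fun _ => 0, contDiff_const, fun ζ => by rw [hc0, smul_zero]⟩
  refine ⟨fun ξ => g ξ + q ξ + g₁ ξ, (hg.add hq).add hg₁, hc.congr_left fun ζ => ?_⟩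
  simp only [V, hg₁c]
  abel

theorem CurveGerm.exists_comp_pow_approx [CompleteSpace F] (hU : CurveGerm J U)
    (hJ : ContDiff ℝ ∞ J) (hJsq : ∀ x w, J x (J x w) = -w) (hJ0 : ∀ w, J 0 w = I • w)
    (hU0 : U 0 = 0) (hm : 0 < m)
    (hinv : ∀ η : ℂ, η ^ m = 1 → ∀ᶠ ζ in 𝓝 0, U (η * ζ) = U ζ) (N : ℕ) :
    ∃ g : ℂ → F, ContDiff ℝ ∞ g ∧
      (fun ζ => U ζ - g (ζ ^ m)) =O[𝓝 0] fun ζ : ℂ => ‖ζ‖ ^ (N + 1) := by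
  induction N with
  | zero =>
    refine ⟨fun _ => 0, contDiff_const, ?_⟩
    simpa [hU0] using
      isBigO_norm_of_differentiableAt (hU.self_of_nhds.1.differentiableAt (by simp))
  | succ N ih =>
    obtain ⟨g, hg, hV⟩ := ih
    exact hU.exists_next_comp_pow hJ hJsq hJ0 hU0 hm hinv hg hV

end JCurve

namespace JCurve

open Filter Topology Asymptotics ComplexConjugate
open scoped ContDiff

variable {F : Type*} [NormedAddCommGroup F] [NormedSpace ℂ F]
variable {J : F → F →L[ℝ] F} {U : ℂ → F} {m : ℕ}

theorem curve_comp_holomorphic {u : ℂ → F} {H : ℂ → ℂ} {z : ℂ} (hJsq : ∀ x w, J x (J x w) = -w)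
    (hu : ContDiffAt ℝ ∞ u (H z))
    (huc : fderiv ℝ u (H z) 1 + J (u (H z)) (fderiv ℝ u (H z) I) = 0) (hH : AnalyticAt ℂ H z) :
    ContDiffAt ℝ ∞ (fun z => u (H z)) z ∧ fderiv ℝ (fun z => u (H z)) z 1 +
      J (u (H z)) (fderiv ℝ (fun z => u (H z)) z I) = 0 := by
  refine ⟨hu.comp z (hH.contDiffAt.restrict_scalars ℝ), ?_⟩
  have h1 := hH.differentiableAt.hasDerivAt.hasFDerivAt.restrictScalars ℝ
  have h2 : HasFDerivAt (fun z => u (H z)) _ z :=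
    (hu.differentiableAt (by simp)).hasFDerivAt.comp z h1
  rw [h2.fderiv]
  simp only [ContinuousLinearMap.comp_apply, ContinuousLinearMap.coe_restrictScalars',
    ContinuousLinearMap.toSpanSingleton_apply, smul_eq_mul, one_mul]
  rw [fderiv_I_mul hJsq huc, hJsq, add_neg_cancel]

theorem exists_local_root (hm : 0 < m) {ξ₀ : ℂ} (hξ₀ : ξ₀ ≠ 0) {ζ₀ : ℂ} (hζ₀ : ζ₀ ^ m = ξ₀) :
    ∃ β : ℂ → ℂ, AnalyticAt ℂ β ξ₀ ∧ β ξ₀ = ζ₀ ∧ ∀ ξ, β ξ ^ m = ξ := by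
  refine ⟨fun ξ => ζ₀ * (ξ / ξ₀) ^ (m⁻¹ : ℂ), ?_, ?_, fun ξ => ?_⟩
  · refine analyticAt_const.mul ((analyticAt_id.div_const).cpow analyticAt_const ?_)
    simp [hξ₀]
  · simp [hξ₀]
  · rw [mul_pow, hζ₀, cpow_nat_inv_pow _ hm.ne', mul_div_cancel₀ _ hξ₀]

/-- A curve whose fibres are those of `ζ ↦ ζ ^ m` descends to an injective curve. -/
theorem CurveGerm.exists_injective_of_pow [CompleteSpace F] (hU : CurveGerm J U)
    (hJ : ContDiff ℝ ∞ J) (hJsq : ∀ x w, J x (J x w) = -w) (hJ0 : ∀ w, J 0 w = I • w)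
    (hU0 : U 0 = 0) (hm : 0 < m) {ρ : ℝ} (hρ : 0 < ρ)
    (hfib : ∀ ζ ξ, ‖ζ‖ < ρ → ‖ξ‖ < ρ → (U ζ = U ξ ↔ ζ ^ m = ξ ^ m)) :
    ∃ v : ℂ → F, CurveGerm J v ∧ (∃ r > 0, Set.InjOn v (ball 0 r)) ∧
      ∀ᶠ ζ in 𝓝 0, U ζ = v (ζ ^ m) := by
  have hroot : ∀ ξ : ℂ, (ξ ^ (m⁻¹ : ℂ)) ^ m = ξ := fun ξ => cpow_nat_inv_pow _ hm.ne'
  let v : ℂ → F := fun ξ => U (ξ ^ (m⁻¹ : ℂ))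
  have hsmall : ∀ {ζ : ℂ}, ‖ζ ^ m‖ < ρ ^ m → ‖ζ‖ < ρ := fun {ζ} h => by
    rw [norm_pow] at h
    exact lt_of_pow_lt_pow_left₀ m hρ.le h
  have hvp : ∀ ζ : ℂ, ‖ζ‖ < ρ → U ζ = v (ζ ^ m) := by
    intro ζ hζ
    refine (hfib _ _ hζ (hsmall ?_)).2 ?_
    · rw [hroot, norm_pow]
      exact pow_lt_pow_left₀ hζ (norm_nonneg _) hm.ne'
    · rw [hroot]
  have hv0 : v 0 = 0 := by
    have := hvp 0 (by simpa using hρ)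
    rw [zero_pow hm.ne', hU0] at this
    exact this.symm
  have hoff : ∀ᶠ ξ in 𝓝[≠] (0:ℂ), ContDiffAt ℝ ∞ v ξ ∧
      fderiv ℝ v ξ 1 + J (v ξ) (fderiv ℝ v ξ I) = 0 := by
    have h1 : ∀ᶠ ζ in 𝓝[≠] (0:ℂ), (ContDiffAt ℝ ∞ U ζ ∧
        fderiv ℝ U ζ 1 + J (U ζ) (fderiv ℝ U ζ I) = 0) ∧ ‖ζ‖ < ρ := by
      refine nhdsWithin_le_nhds (hU.and ?_)
      filter_upwards [ball_mem_nhds (0:ℂ) hρ] with ζ hζ using mem_ball_zero_iff.1 hζ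
    filter_upwards [eventually_of_pow_ne hm h1, self_mem_nhdsWithin] with ξ hξ hξ0
    obtain ⟨⟨e1, e2⟩, e3⟩ := hξ _ (hroot ξ)
    obtain ⟨β, hβ, hβξ, hβm⟩ := exists_local_root hm hξ0 (hroot ξ)
    have hvβ : v =ᶠ[𝓝 ξ] fun ξ => U (β ξ) := by
      have : ∀ᶠ η in 𝓝 ξ, ‖β η‖ < ρ := by
        refine hβ.continuousAt.norm.eventually_lt_const ?_
        simpa only [hβξ] using e3
      filter_upwards [this] with η hη
      rw [hvp _ hη, hβm]
    rw [← hβξ] at e1 e2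
    obtain ⟨e4, e5⟩ := curve_comp_holomorphic hJsq e1 e2 hβ
    refine ⟨e4.congr_of_eventuallyEq hvβ, ?_⟩
    rw [hvβ.fderiv_eq, hvβ.self_of_nhds]
    exact e5
  have hinv : ∀ η : ℂ, η ^ m = 1 → ∀ᶠ ζ in 𝓝 0, U (η * ζ) = U ζ := by
    intro η hη
    have hη1 : ‖η‖ = 1 := by
      have := congrArg norm hη
      rw [norm_pow, norm_one] at this
      exact (pow_eq_one_iff_of_nonneg (norm_nonneg _) hm.ne').1 this
    filter_upwards [ball_mem_nhds (0:ℂ) hρ] with ζ hζ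
    rw [mem_ball_zero_iff] at hζ
    refine (hfib _ _ (by rwa [norm_mul, hη1, one_mul]) hζ).2 ?_
    rw [mul_pow, hη, one_mul]
  have hv0s : ContDiffAt ℝ ∞ v 0 := by
    refine contDiffAt_infty.2 fun N => ?_
    obtain ⟨g, hg, hV⟩ := hU.exists_comp_pow_approx hJ hJsq hJ0 hU0 hm hinv (m * N)
    have hGs : ContDiff ℝ ∞ fun ζ : ℂ => g (ζ ^ m) := hg.comp (contDiff_id.pow m)
    have hg0 : g 0 = 0 := by
      have := hV.eq_zero_imp.self_of_nhds (by simp)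
      simpa [hU0, zero_pow hm.ne'] using this
    have h1 : ContDiffAt ℝ N (fun ξ => v ξ - g ξ) 0 := by
      refine contDiffAt_of_comp_pow hm N (S := fun ζ => U ζ - g (ζ ^ m)) (p := 0)
        (M := m * N + 1) (hoff.mono fun ξ hξ => hξ.1.sub hg.contDiffAt) (by rw [hv0, hg0, sub_zero])
        ?_ hV (by omega) ?_
      · filter_upwards [hU] with z hz using hz.1.sub hGs.contDiffAt
      · refine nhdsWithin_le_nhds ?_
        filter_upwards [ball_mem_nhds (0:ℂ) hρ] with ζ hζ
        rw [hvp ζ (mem_ball_zero_iff.1 hζ), pow_zero, one_smul]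
    have h2 : ContDiffAt ℝ N g 0 := (hg.of_le (by exact_mod_cast le_top)).contDiffAt
    simpa using! h1.add h2
  have hv0c : fderiv ℝ v 0 1 + J (v 0) (fderiv ℝ v 0 I) = 0 := by
    have h1 : ContinuousAt (fderiv ℝ v) 0 := (hv0s.fderiv_right (m := ∞) (by simp)).continuousAt
    have h2 : ContinuousAt (fun ξ => fderiv ℝ v ξ 1 + J (v ξ) (fderiv ℝ v ξ I)) 0 := by
      refine (h1.clm_apply continuousAt_const).add (ContinuousAt.clm_apply ?_
        (h1.clm_apply continuousAt_const))
      exact ContinuousAt.comp (f := v) (g := J) hJ.continuous.continuousAt hv0s.continuousAt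
    refine tendsto_nhds_unique (l := 𝓝[≠] (0:ℂ)) (h2.tendsto.mono_left nhdsWithin_le_nhds) ?_
    exact tendsto_const_nhds.congr' (hoff.mono fun ξ hξ => hξ.2.symm)
  refine ⟨v, ?_, ⟨ρ ^ m, pow_pos hρ m, ?_⟩, ?_⟩
  · filter_upwards [eventually_nhdsWithin_iff.1 hoff] with ξ hξ
    by_cases h0 : ξ = 0
    · rw [h0]; exact ⟨hv0s, hv0c⟩
    · exact hξ h0
  · intro ξ hξ η hη h
    rw [mem_ball_zero_iff] at hξ hη
    have := (hfib _ _ (hsmall (by rwa [hroot])) (hsmall (by rwa [hroot]))).1 h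
    rwa [hroot, hroot] at this
  · filter_upwards [ball_mem_nhds (0:ℂ) hρ] with ζ hζ using hvp ζ (mem_ball_zero_iff.1 hζ)

end JCurve

namespace JCurve

open Filter Topology Asymptotics ComplexConjugate
open scoped ContDiff

/-- Local factorization when the almost complex structure is standard at the base point. -/
theorem CurveGerm.exists_factorization {F : Type*} [NormedAddCommGroup F] [NormedSpace ℂ F]
    [CompleteSpace F] {J : F → F →L[ℝ] F} {u : ℂ → F} (hu : CurveGerm J u)
    (hJ : ContDiff ℝ ∞ J) (hJsq : ∀ x w, J x (J x w) = -w) (hJ0 : ∀ w, J 0 w = I • w)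
    (hu0 : u 0 = 0) (hne : ¬ ∀ᶠ z in 𝓝 0, u z = 0) :
    ∃ (v : ℂ → F) (φ : ℂ → ℂ), CurveGerm J v ∧ (∃ r > 0, Set.InjOn v (ball 0 r)) ∧
      AnalyticAt ℂ φ 0 ∧ φ 0 = 0 ∧ ∀ᶠ z in 𝓝 0, u z = v (φ z) := by
  obtain ⟨K, a, ha, hlead⟩ := hu.exists_leading hJ hJ0 hu0 hne
  obtain ⟨l, hl⟩ := SeparatingDual.exists_eq_one (R := ℂ) ha
  have h : LeadingData J u K a l := ⟨hJ, hJsq, hJ0, hu, hu0, hlead, hl⟩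
  obtain ⟨m, hm, g, H, hg, hH, hg0, hH0, hHg, -, ρ, hρ, hfib⟩ := h.exists_coordinate
  have hHt : Tendsto H (𝓝 0) (𝓝 0) := by simpa [hH0] using hH.continuousAt.tendsto
  have hgt : Tendsto g (𝓝 0) (𝓝 0) := by simpa [hg0] using hg.continuousAt.tendsto
  have hU : CurveGerm J fun z => u (H z) := by
    filter_upwards [hHt.eventually hu, hH.eventually_analyticAt] with z h1 h2
    exact curve_comp_holomorphic hJsq h1.1 h1.2 h2
  obtain ⟨v, hv, hinj, hUv⟩ := hU.exists_injective_of_pow hJ hJsq hJ0 (by rw [hH0, hu0]) hm hρ hfib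
  refine ⟨v, fun z => g z ^ m, hv, hinj, hg.pow m, by simp [hg0, hm.ne'], ?_⟩
  filter_upwards [hgt.eventually hUv, hHg] with z h1 h2
  rw [← h1, h2]

section RealSpace

variable {E : Type*} [NormedAddCommGroup E] [NormedSpace ℝ E]

theorem exists_complex_coordinates [FiniteDimensional ℝ E] (j : E →L[ℝ] E)
    (hj : ∀ w, j (j w) = -w) :
    ∃ (F : Type) (_ : NormedAddCommGroup F) (_ : NormedSpace ℂ F) (_ : CompleteSpace F)
      (L : E ≃L[ℝ] F), ∀ w, L (j w) = I • L w := by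
  have hj2 : (j : Module.End ℝ E) * (j : Module.End ℝ E) = -1 := by
    ext w
    exact hj w
  let ι : ℂ →ₐ[ℝ] Module.End ℝ E := Complex.lift ⟨(j : Module.End ℝ E), hj2⟩
  let _ : Module ℂ E := Module.compHom E (ι : ℂ →+* Module.End ℝ E)
  have hsmul : ∀ (c : ℂ) (w : E), c • w = ι c w := fun _ _ => rfl
  have : IsScalarTower ℝ ℂ E := ⟨fun r c w => by
    rw [hsmul, hsmul, map_smul]
    rfl⟩
  have : FiniteDimensional ℂ E := Module.Finite.of_restrictScalars_finite ℝ ℂ E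
  let b := (Module.finBasis ℂ E).equivFun
  refine ⟨_, inferInstance, inferInstance, inferInstance,
    (b.restrictScalars ℝ).toContinuousLinearEquiv, fun w => ?_⟩
  change b (j w) = I • b w
  rw [← map_smul, hsmul]
  congr 1
  simp [ι]

variable {F : Type*} [NormedAddCommGroup F] [NormedSpace ℝ F]

/-- Push-forward of an almost complex structure under a linear isomorphism. -/
noncomputable def pushforward (L : E ≃L[ℝ] F) (J : E → E →L[ℝ] E) (x : F) : F →L[ℝ] F :=
  (L : E →L[ℝ] F).comp ((J (L.symm x)).comp (L.symm : F →L[ℝ] E))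

theorem contDiff_pushforward (L : E ≃L[ℝ] F) {J : E → E →L[ℝ] E} (hJ : ContDiff ℝ ∞ J) :
    ContDiff ℝ ∞ (pushforward L J) :=
  contDiff_const.clm_comp ((hJ.comp L.symm.contDiff).clm_comp contDiff_const)

theorem pushforward_apply (L : E ≃L[ℝ] F) (J : E → E →L[ℝ] E) (x w : F) :
    pushforward L J x w = L (J (L.symm x) (L.symm w)) := rfl

theorem pushforward_curve (L : E ≃L[ℝ] F) {J : E → E →L[ℝ] E} {u : ℂ → E} {z : ℂ}
    (h : fderiv ℝ u z 1 + J (u z) (fderiv ℝ u z I) = 0) :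
    fderiv ℝ (fun z => L (u z)) z 1 +
      pushforward L J (L (u z)) (fderiv ℝ (fun z => L (u z)) z I) = 0 := by
  have : fderiv ℝ (fun z => L (u z)) z = (L : E →L[ℝ] F).comp (fderiv ℝ u z) :=
    L.comp_fderiv
  rw [this, pushforward_apply]
  simp only [ContinuousLinearMap.comp_apply, ContinuousLinearEquiv.coe_coe,
    ContinuousLinearEquiv.symm_apply_apply]
  rw [← map_add, h, map_zero]

theorem pushforward_symm (L : E ≃L[ℝ] F) (J : E → E →L[ℝ] E) :
    pushforward L.symm (pushforward L J) = J := by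
  funext x
  ext w
  simp [pushforward_apply]

theorem pushforward_sq (L : E ≃L[ℝ] F) {J : E → E →L[ℝ] E} (hJsq : ∀ x w, J x (J x w) = -w)
    (x w : F) : pushforward L J x (pushforward L J x w) = -w := by
  simp [pushforward_apply, hJsq]

theorem not_eventually_eq_zero [FiniteDimensional ℝ E] {J : E → E →L[ℝ] E}
    (hJ : ContDiff ℝ ∞ J) (hJsq : ∀ x w, J x (J x w) = -w) {u : ℂ → E} {r : ℝ}
    (hu : ∀ z ∈ ball (0 : ℂ) r, ContDiffAt ℝ ∞ u z ∧
      fderiv ℝ u z 1 + J (u z) (fderiv ℝ u z I) = 0)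
    (hne : ∃ z ∈ ball (0 : ℂ) r, ∃ w ∈ ball (0 : ℂ) r, u z ≠ u w) {z₀ : ℂ}
    (hz₀ : z₀ ∈ ball (0 : ℂ) r) : ¬ ∀ᶠ z in 𝓝 z₀, u z = 0 := by
  intro h0
  obtain ⟨F, _, _, _, L, hL⟩ := exists_complex_coordinates (J 0) (hJsq 0)
  have hsub : ball (0 : ℂ) r ⊆ {z | ∀ᶠ w in 𝓝 z, u w = 0} := by
    refine (convex_ball (0:ℂ) r).isPreconnected.subset_of_closure_inter_subset
      isOpen_setOfPred_eventually_nhds ⟨z₀, hz₀, h0⟩ ?_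
    rintro z ⟨hz, hzr⟩
    by_contra hzZ
    have hfreq : ∃ᶠ w in 𝓝[≠] z, u w = 0 := by
      intro hev
      rw [mem_closure_iff_frequently] at hz
      refine hz ?_
      filter_upwards [eventually_nhdsWithin_iff.1 hev] with w hw hw0
      by_cases hwz : w = z
      · exact hzZ (hwz ▸ hw0)
      · exact hw hwz hw0.self_of_nhds
    have huz : u z = 0 := by
      by_contra hne
      exact (hfreq.and_eventually (nhdsWithin_le_nhds
        ((hu z hzr).1.continuousAt.eventually_ne hne))).exists.elim fun w hw => hw.2 hw.1
    let U : ℂ → F := fun w => L (u (z + w))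
    have hadd : Tendsto (fun w => z + w) (𝓝 0) (𝓝 z) := by
      simpa using (continuous_const_add z).tendsto 0
    have hU : CurveGerm (pushforward L J) U := by
      filter_upwards [hadd.eventually (isOpen_ball.mem_nhds hzr)] with w hw
      obtain ⟨e1, e2⟩ := hu _ hw
      obtain ⟨e3, e4⟩ := curve_comp_holomorphic (H := fun w => z + w) (z := w)
        (pushforward_sq L hJsq) (L.contDiff.contDiffAt.comp (z + w) e1)
        (pushforward_curve L e2) (analyticAt_const.add analyticAt_id)
      exact ⟨e3, e4⟩
    have hU0 : ∃ᶠ w in 𝓝[≠] 0, U w = 0 := by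
      have : Tendsto (fun w => w - z) (𝓝[≠] z) (𝓝[≠] 0) := by
        refine tendsto_nhdsWithin_iff.2 ⟨?_, ?_⟩
        · have : Tendsto (fun w => w - z) (𝓝 z) (𝓝 0) := by
            simpa using (continuous_sub_right z).tendsto z
          exact this.mono_left nhdsWithin_le_nhds
        · filter_upwards [self_mem_nhdsWithin] with w hw using sub_ne_zero.2 hw
      refine this.frequently (hfreq.mono fun w hw => ?_)
      simp only [U, add_sub_cancel, hw, map_zero]
    have hzero := hU.eventually_eq_zero (contDiff_pushforward L hJ)
      (fun w => by rw [pushforward_apply, map_zero, hL, L.apply_symm_apply])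
      (by simp [U, huz]) (Or.inr hU0)
    refine hzZ ?_
    have hsub : Tendsto (fun w => w - z) (𝓝 z) (𝓝 0) := by
      simpa using (continuous_sub_right z).tendsto z
    filter_upwards [hsub.eventually hzero] with w hw
    simpa [U] using hw
  obtain ⟨z, hz, w, hw, h⟩ := hne
  exact h ((hsub hz).self_of_nhds.trans (hsub hw).self_of_nhds.symm)

theorem exists_factorization [FiniteDimensional ℝ E] {J : E → E →L[ℝ] E}
    (hJ : ContDiff ℝ ∞ J) (hJsq : ∀ x w, J x (J x w) = -w) {u : ℂ → E}
    (hus : ContDiffOn ℝ ∞ u (ball 0 1))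
    (huc : ∀ z ∈ ball (0 : ℂ) 1, fderiv ℝ u z 1 + J (u z) (fderiv ℝ u z I) = 0)
    (hu0 : u 0 = 0) (hne : ∃ z ∈ ball (0 : ℂ) 1, ∃ w ∈ ball (0 : ℂ) 1, u z ≠ u w) :
    ∃ v : ℂ → E, Set.InjOn v (ball 0 1) ∧ ContDiffOn ℝ ∞ v (ball 0 1) ∧
      (∀ z ∈ ball (0 : ℂ) 1, fderiv ℝ v z 1 + J (v z) (fderiv ℝ v z I) = 0) ∧
      ∃ ε : ℝ, 0 < ε ∧ ∃ φ : ℂ → ℂ, Set.MapsTo φ (ball 0 ε) (ball 0 1) ∧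
        DifferentiableOn ℂ φ (ball 0 ε) ∧ φ 0 = 0 ∧ ∀ z ∈ ball (0 : ℂ) ε, u z = v (φ z) := by
  have hu : ∀ z ∈ ball (0 : ℂ) 1, ContDiffAt ℝ ∞ u z ∧
      fderiv ℝ u z 1 + J (u z) (fderiv ℝ u z I) = 0 := fun z hz =>
    ⟨hus.contDiffAt (isOpen_ball.mem_nhds hz), huc z hz⟩
  have hne0 := not_eventually_eq_zero hJ hJsq hu hne (mem_ball_self one_pos)
  obtain ⟨F, _, _, _, L, hL⟩ := exists_complex_coordinates (J 0) (hJsq 0)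
  have hLu : CurveGerm (pushforward L J) fun z => L (u z) := by
    filter_upwards [ball_mem_nhds (0:ℂ) one_pos] with z hz
    exact ⟨L.contDiff.contDiffAt.comp z (hu z hz).1, pushforward_curve L (hu z hz).2⟩
  obtain ⟨v, φ, hv, ⟨r, hr, hinj⟩, hφ, hφ0, huv⟩ := hLu.exists_factorization
    (contDiff_pushforward L hJ) (pushforward_sq L hJsq)
    (fun w => by rw [pushforward_apply, map_zero, hL, L.apply_symm_apply]) (by simp [hu0])
    (by simpa using hne0)
  obtain ⟨s, hs, hvs⟩ := Metric.eventually_nhds_iff_ball.1 hv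
  obtain ⟨δ, hδ, hδr, hδs⟩ : ∃ δ > 0, δ ≤ r ∧ δ ≤ s :=
    ⟨min r s, lt_min hr hs, min_le_left _ _, min_le_right _ _⟩
  have hδ0 : (δ : ℂ) ≠ 0 := by exact_mod_cast hδ.ne'
  have hmaps : ∀ {z : ℂ} {t : ℝ}, δ ≤ t → z ∈ ball (0:ℂ) 1 → (δ : ℂ) * z ∈ ball (0:ℂ) t := by
    intro z t ht hz
    rw [mem_ball_zero_iff] at hz ⊢
    rw [norm_mul, norm_real, Real.norm_of_nonneg hδ.le]
    nlinarith
  have hev : ∀ᶠ z in 𝓝 (0:ℂ), AnalyticAt ℂ φ z ∧ φ z ∈ ball (0:ℂ) δ ∧ L (u z) = v (φ z) := by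
    refine hφ.eventually_analyticAt.and (Eventually.and ?_ huv)
    exact hφ.continuousAt.eventually (by rw [hφ0]; exact ball_mem_nhds 0 hδ)
  obtain ⟨ε, hε, hb⟩ := Metric.eventually_nhds_iff_ball.1 hev
  have hvδ : ∀ z ∈ ball (0:ℂ) 1, ContDiffAt ℝ ∞ (fun z => v (δ * z)) z ∧
      fderiv ℝ (fun z => v (δ * z)) z 1 +
        pushforward L J (v (δ * z)) (fderiv ℝ (fun z => v (δ * z)) z I) = 0 := by
    intro z hz
    obtain ⟨e1, e2⟩ := hvs _ (hmaps hδs hz)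
    exact curve_comp_holomorphic (H := fun z => δ * z) (pushforward_sq L hJsq) e1 e2
      (analyticAt_const.mul analyticAt_id)
  refine ⟨fun z => L.symm (v (δ * z)), ?_, fun z hz => ?_, fun z hz => ?_, ε, hε,
    fun z => φ z / δ, fun z hz => ?_, fun z hz => ?_, by simp [hφ0], fun z hz => ?_⟩
  · intro z hz w hw h
    exact mul_left_cancel₀ hδ0 (hinj (hmaps hδr hz) (hmaps hδr hw) (L.symm.injective h))
  · exact (L.symm.contDiff.contDiffAt.comp z (hvδ z hz).1).contDiffWithinAt
  · have := pushforward_curve L.symm (hvδ z hz).2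
    rwa [pushforward_symm] at this
  · have := (hb z hz).2.1
    rw [mem_ball_zero_iff] at this ⊢
    rwa [norm_div, norm_real, Real.norm_of_nonneg hδ.le, div_lt_one hδ]
  · exact ((hb z hz).1.differentiableAt.div_const _).differentiableWithinAt
  · simp only [mul_div_cancel₀ _ hδ0, ← (hb z hz).2.2, L.symm_apply_apply]

end RealSpace

end JCurve

/-- **Local factorization through an injective curve.**  Let `u : B → ℂⁿ` be a nonconstant
smooth `J`-holomorphic curve with `u(0) = 0`.  Then there exist an injective smooth
`J`-holomorphic curve `v : B → ℂⁿ`, some `ε > 0`, and a holomorphic map `φ : B_ε → B`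
with `φ(0) = 0`, such that `u = v ∘ φ` on `B_ε`. -/
theorem pseudoholomorphic_local_factorization (n : ℕ)
    (J : EuclideanSpace ℂ (Fin n) →
      (EuclideanSpace ℂ (Fin n) →L[ℝ] EuclideanSpace ℂ (Fin n)))
    (hJsmooth : ContDiff ℝ (⊤ : ℕ∞) J)
    (hJsq : ∀ x w, J x (J x w) = -w)
    (u : ℂ → EuclideanSpace ℂ (Fin n))
    (husmooth : ContDiffOn ℝ (⊤ : ℕ∞) u (ball 0 1))
    (huCR : ∀ z ∈ ball (0 : ℂ) 1,
      fderiv ℝ u z 1 + J (u z) (fderiv ℝ u z Complex.I) = 0)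
    (hu0 : u 0 = 0)
    (hnonconst : ∃ z ∈ ball (0 : ℂ) 1, ∃ w ∈ ball (0 : ℂ) 1, u z ≠ u w) :
    ∃ v : ℂ → EuclideanSpace ℂ (Fin n),
      Set.InjOn v (ball 0 1) ∧
      ContDiffOn ℝ (⊤ : ℕ∞) v (ball 0 1) ∧
      (∀ z ∈ ball (0 : ℂ) 1,
        fderiv ℝ v z 1 + J (v z) (fderiv ℝ v z Complex.I) = 0) ∧
      ∃ ε : ℝ, 0 < ε ∧ ∃ φ : ℂ → ℂ,
        Set.MapsTo φ (ball 0 ε) (ball 0 1) ∧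
        DifferentiableOn ℂ φ (ball 0 ε) ∧ φ 0 = 0 ∧
        ∀ z ∈ ball (0 : ℂ) ε, u z = v (φ z) := by
  have : FiniteDimensional ℝ (EuclideanSpace ℂ (Fin n)) := FiniteDimensional.complexToReal _
  exact JCurve.exists_factorization hJsmooth hJsq husmooth huCR hu0 hnonconst
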